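/- Assume the Riemann Hypothesis. Then at least two thirds of the zeros of ζ are simple, in the sense that N_s(T) ≥ (2/3 − o(1)) N(T) as T → ∞, where N_s(T) is the number of simple non-trivial zeros ρ = 1/2 + iγ with 0 < γ ≤ T and N(T) is the number of non-trivial zeros with 0 < γ ≤ T counted with multiplicity. -/

import Mathlib

open Complex Filter MeasureTheory Real Set

noncomputable section

/-- A non-trivial zero of the Riemann zeta function. -/
def ZetaNontrivZero (ρ : ℂ) : Prop := riemannZeta ρ = 0 ∧ 0 < ρ.re ∧ ρ.re < 1

/-- The multiplicity of `ρ` as a zero of `ζ`. -/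
def zetaMult (ρ : ℂ) : ℕ := sInf {n : ℕ | iteratedDeriv n riemannZeta ρ ≠ 0}

/-- The set of non-trivial zeros with ordinate in `(0, T]`. -/
def zerosUpTo (T : ℝ) : Set ℂ := {ρ | ZetaNontrivZero ρ ∧ 0 < ρ.im ∧ ρ.im ≤ T}

/-- `N(T)`: the number of non-trivial zeros with `0 < γ ≤ T` counted with multiplicity. -/
def NofT (T : ℝ) : ℝ := ∑' ρ : zerosUpTo T, (zetaMult (ρ : ℂ) : ℝ)

/-- `N_s(T)`: the number of simple non-trivial zeros with `0 < γ ≤ T`. -/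
def NsofT (T : ℝ) : ℝ := ∑' ρ : {ρ : ℂ // ρ ∈ zerosUpTo T ∧ zetaMult ρ = 1}, (1 : ℝ)

/-- Dividing out the zero of an entire function at one nonzero point. -/
lemma exists_entire_div_one {f : ℂ → ℂ} (hf : Differentiable ℂ f) (h0 : f 0 ≠ 0) {ρ : ℂ}
    (hρ : ρ ≠ 0) : ∃ g : ℂ → ℂ, Differentiable ℂ g ∧ g ρ ≠ 0 ∧ 
      ∀ z, f z = (1 - z / ρ) ^ (analyticOrderNatAt f ρ) * g z := by
  have hA : AnalyticOnNhd ℂ f univ := fun z _ => hf.analyticAt z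
  have ht : analyticOrderAt f ρ ≠ ⊤ := by
    refine hA.analyticOrderAt_ne_top_of_isPreconnected isPreconnected_univ (mem_univ 0)
      (mem_univ ρ) ?_
    rw [(hf.analyticAt 0).analyticOrderAt_eq_zero.2 h0]; simp
  obtain ⟨g, hg, hgρ, hfg⟩ := (hf.analyticAt ρ).analyticOrderAt_ne_top.1 ht
  set n := analyticOrderNatAt f ρ
  have hpow : ∀ z, (z - ρ) ^ n = (1 - z / ρ) ^ n * (-ρ) ^ n := by
    intro z; rw [← mul_pow]; congr 1; field_simp; ring
  let G : ℂ → ℂ := fun z => if z = ρ then (-ρ) ^ n * g ρ else f z / (1 - z / ρ) ^ n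
  have hne : ∀ z, z ≠ ρ → (1 - z / ρ) ^ n ≠ 0 := by
    intro z hz
    apply pow_ne_zero
    intro h
    apply hz
    field_simp at h
    linear_combination -h
  refine ⟨G, ?_, ?_, ?_⟩
  · intro z
    by_cases hz : z = ρ
    · subst hz
      have : G =ᶠ[nhds z] fun w => (-z) ^ n * g w := by
        filter_upwards [hfg] with w hw
        by_cases hwz : w = z
        · simp [G, hwz]
        · simp only [G, hwz, if_false]
          rw [hw, smul_eq_mul, hpow w]
          field_simp [hne w hwz]
      exact (this.differentiableAt_iff).2 (hg.differentiableAt.const_mul _)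
    · have : G =ᶠ[nhds z] fun w => f w / (1 - w / ρ) ^ n := by
        filter_upwards [isOpen_ne.mem_nhds hz] with w hw
        simp only [G, if_neg (show w ≠ ρ from hw)]
      refine (this.differentiableAt_iff).2 ?_
      exact (hf z).div (by fun_prop) (hne z hz)
  · simp [G, hgρ, hρ]
  · intro z
    by_cases hz : z = ρ
    · subst hz
      have := hfg.self_of_nhds
      simp only [G, if_true]
      rw [this]; simp only [smul_eq_mul]; rw [hpow z]; ring
    · simp only [G, if_neg hz]
      field_simp [hne z hz]

/-- Dividing out finitely many zeros of an entire function. -/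
lemma exists_entire_div {f : ℂ → ℂ} (hf : Differentiable ℂ f) (h0 : f 0 ≠ 0) (F : Finset ℂ)
    (hF : ∀ ρ ∈ F, ρ ≠ 0) : ∃ g : ℂ → ℂ, Differentiable ℂ g ∧ (∀ ρ ∈ F, g ρ ≠ 0) ∧ 
      ∀ z, f z = (∏ ρ ∈ F, (1 - z / ρ) ^ (analyticOrderNatAt f ρ)) * g z := by
  classical
  induction F using Finset.induction_on with
  | empty => exact ⟨f, hf, by simp, by simp⟩
  | insert a F ha ih =>
    obtain ⟨g, hg, hgF, hfg⟩ := ih (fun ρ hρ => hF ρ (Finset.mem_insert_of_mem hρ))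
    have ha0 : a ≠ 0 := hF a (Finset.mem_insert_self _ _)
    have hg0 : g 0 ≠ 0 := by
      intro h; apply h0; rw [hfg 0, h, mul_zero]
    have hq : Differentiable ℂ (fun z => ∏ ρ ∈ F, (1 - z / ρ) ^ (analyticOrderNatAt f ρ)) := by
      fun_prop
    have hqa : (fun z => ∏ ρ ∈ F, (1 - z / ρ) ^ (analyticOrderNatAt f ρ)) a ≠ 0 := by
      simp only
      refine Finset.prod_ne_zero_iff.2 fun ρ hρ => pow_ne_zero _ ?_
      have hρ0 : ρ ≠ 0 := hF ρ (Finset.mem_insert_of_mem hρ)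
      intro h
      have : a = ρ := by field_simp at h; linear_combination -h
      exact ha (this ▸ hρ)
    have hord : analyticOrderNatAt f a = analyticOrderNatAt g a := by
      have : f = (fun z => ∏ ρ ∈ F, (1 - z / ρ) ^ (analyticOrderNatAt f ρ)) * g := by
        funext z; exact hfg z
      have h2 := analyticOrderAt_mul (hq.analyticAt a) (hg.analyticAt a)
      rw [← this, (hq.analyticAt a).analyticOrderAt_eq_zero.2 hqa, zero_add] at h2
      simp [analyticOrderNatAt, h2]
    obtain ⟨k, hk, hka, hgk⟩ := exists_entire_div_one hg hg0 ha0
    refine ⟨k, hk, ?_, ?_⟩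
    · intro ρ hρ
      rcases Finset.mem_insert.1 hρ with rfl | hρ
      · exact hka
      · intro h
        apply hgF ρ hρ
        rw [hgk, h, mul_zero]
    · intro z
      rw [Finset.prod_insert ha, hfg z, hgk z, hord]
      ring

lemma zeros_finite {f : ℂ → ℂ} (hf : Differentiable ℂ f) (h0 : f 0 ≠ 0) (R : ℝ) :
    {z | f z = 0 ∧ ‖z‖ ≤ R}.Finite := by
  have hA : AnalyticOnNhd ℂ f univ := fun z _ => hf.analyticAt z
  have h1 := hA.preimage_zero_mem_codiscreteWithin h0 (mem_univ 0) isConnected_univ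
  have h2 := mem_codiscrete'.1 h1
  have h3 : (f ⁻¹' {0}ᶜ)ᶜ = {z | f z = 0} := by ext z; simp
  have h4 := h2.1.isClosed_compl
  have h5 := h2.2
  rw [h3] at h4 h5
  have hc : IsCompact (Metric.closedBall (0:ℂ) R ∩ {z | f z = 0}) :=
    (isCompact_closedBall 0 R).inter_right h4
  have := hc.finite (h5.mono inter_subset_right)
  refine this.subset ?_
  rintro z ⟨hz, hz'⟩
  exact ⟨by simpa using hz', hz⟩

/-- Zero-free part of an entire function on a disc, with growth bound. -/
lemma exists_zero_free {f : ℂ → ℂ} (hf : Differentiable ℂ f) (h0 : f 0 ≠ 0) {R B : ℝ} (hR : 0 < R)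
    (hB : ∀ z, ‖z‖ ≤ 4 * R → ‖f z‖ ≤ Real.exp B) (F : Finset ℂ)
    (hF : ∀ z, z ∈ F ↔ f z = 0 ∧ ‖z‖ ≤ R) :
    ∃ g : ℂ → ℂ, Differentiable ℂ g ∧ (∀ z, ‖z‖ ≤ R → g z ≠ 0) ∧ g 0 = f 0 ∧
      (∀ z, ‖z‖ ≤ 4 * R → ‖g z‖ ≤ Real.exp B / 3 ^ (∑ ρ ∈ F, analyticOrderNatAt f ρ)) ∧
      ∀ z, f z = (∏ ρ ∈ F, (1 - z / ρ) ^ (analyticOrderNatAt f ρ)) * g z := by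
  have hF0 : ∀ ρ ∈ F, ρ ≠ 0 := by
    rintro ρ hρ rfl; exact h0 ((hF 0).1 hρ).1
  obtain ⟨g, hg, hgF, hfg⟩ := exists_entire_div hf h0 F hF0
  refine ⟨g, hg, ?_, ?_, ?_, hfg⟩
  · intro z hz hgz
    by_cases hzF : z ∈ F
    · exact hgF z hzF hgz
    · apply hzF
      rw [hF]
      exact ⟨by rw [hfg, hgz, mul_zero], hz⟩
  · have := hfg 0
    simpa using this.symm
  · intro z hz
    have hU : Bornology.IsBounded (Metric.ball (0:ℂ) (4 * R)) := Metric.isBounded_ball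
    refine Complex.norm_le_of_forall_mem_frontier_norm_le hU hg.diffContOnCl ?_
      (z := z) ?_
    · intro w hw
      rw [frontier_ball _ (by positivity)] at hw
      have hw' : ‖w‖ = 4 * R := by simpa using hw
      rw [le_div_iff₀ (by positivity)]
      have h1 : (3:ℝ) ^ (∑ ρ ∈ F, analyticOrderNatAt f ρ) ≤
          ‖∏ ρ ∈ F, (1 - w / ρ) ^ (analyticOrderNatAt f ρ)‖ := by
        rw [norm_prod, ← Finset.prod_pow_eq_pow_sum]
        refine Finset.prod_le_prod (fun _ _ => by positivity) fun ρ hρ => ?_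
        rw [norm_pow]
        have hρR : ‖ρ‖ ≤ R := ((hF ρ).1 hρ).2
        have hρp : 0 < ‖ρ‖ := norm_pos_iff.2 (hF0 ρ hρ)
        gcongr
        have : (4:ℝ) ≤ ‖w / ρ‖ := by
          rw [norm_div, hw', le_div_iff₀ hρp]; linarith
        have h2 := norm_sub_norm_le (w / ρ) 1
        rw [norm_one, norm_sub_rev] at h2
        linarith
      calc ‖g w‖ * 3 ^ (∑ ρ ∈ F, analyticOrderNatAt f ρ) ≤ 
          ‖g w‖ * ‖∏ ρ ∈ F, (1 - w / ρ) ^ (analyticOrderNatAt f ρ)‖ := by gcongr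
        _ = ‖f w‖ := by rw [hfg w, norm_mul, mul_comm]
        _ ≤ _ := hB w hw'.le
    · rw [closure_ball _ (by positivity)]
      simpa using hz

/-- Counting bound for zeros. -/
lemma count_zeros_le {f : ℂ → ℂ} (hf : Differentiable ℂ f) (h0 : f 0 ≠ 0) {R B : ℝ} (hR : 0 < R)
    (hB : ∀ z, ‖z‖ ≤ 4 * R → ‖f z‖ ≤ Real.exp B) (F : Finset ℂ)
    (hF : ∀ z, z ∈ F ↔ f z = 0 ∧ ‖z‖ ≤ R) :
    ((∑ ρ ∈ F, analyticOrderNatAt f ρ : ℕ) : ℝ) ≤ B - Real.log ‖f 0‖ := by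
  obtain ⟨g, hg, hgF, hg0, hgb, hfg⟩ := exists_zero_free hf h0 hR hB F hF
  have h1 := hgb 0 (by simp; positivity)
  rw [hg0] at h1
  have hp : 0 < ‖f 0‖ := norm_pos_iff.2 h0
  have h2 := Real.log_le_log hp h1
  rw [Real.log_div (by positivity) (by positivity), Real.log_exp, Real.log_pow] at h2
  have h3 : (1:ℝ) ≤ Real.log 3 := by
    rw [Real.le_log_iff_exp_le (by norm_num)]
    exact Real.exp_one_lt_d9.le.trans (by norm_num)
  have : ((∑ ρ ∈ F, analyticOrderNatAt f ρ : ℕ) : ℝ) ≤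
    ((∑ ρ ∈ F, analyticOrderNatAt f ρ : ℕ) : ℝ) * Real.log 3 :=
    le_mul_of_one_le_right (by positivity) h3
  linarith

/-- Borel–Carathéodory bound for the variation of the logarithmic derivative. -/
lemma logDeriv_sub_le {g : ℂ → ℂ} (hg : Differentiable ℂ g) {R B : ℝ} (hR : 0 < R)
    (hg0 : ∀ z, ‖z‖ ≤ R → g z ≠ 0) (hB : ∀ z, ‖z‖ ≤ R → ‖g z‖ ≤ Real.exp B)
    {z w : ℂ} (hz : ‖z‖ < R / 8) (hw : ‖w‖ < R / 8) :
    ‖logDeriv g z - logDeriv g w‖ ≤ 64 * (B - Real.log ‖g 0‖ + 1) / R ^ 2 * ‖z - w‖ := by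
  have hball : ∀ x ∈ Metric.ball (0:ℂ) R, ‖x‖ ≤ R := fun x hx => by
    have := mem_ball_zero_iff.1 hx; exact this.le
  have hld : DifferentiableOn ℂ (logDeriv g) (Metric.ball 0 R) := by
    intro x hx
    have : DifferentiableAt ℂ (fun y => deriv g y / g y) x :=
      (hg.contDiff (n := 2)).differentiable_deriv_two x |>.div (hg x) (hg0 x (hball x hx))
    exact this.differentiableWithinAt
  obtain ⟨h, hh⟩ := hld.isExactOn_ball
  have hder : ∀ x ∈ Metric.ball (0:ℂ) R, HasDerivAt (fun y => g y * cexp (-(h y - h 0))) 0 x := by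
    intro x hx
    have h1 := (hg x).hasDerivAt.mul (((hh x hx).sub_const (h 0)).neg.cexp)
    refine h1.congr_deriv ?_
    simp only [logDeriv_apply]
    field_simp [hg0 x (hball x hx)]
    ring
  have h0m : (0:ℂ) ∈ Metric.ball (0:ℂ) R := by simpa using hR
  have hconst : ∀ x ∈ Metric.ball (0:ℂ) R, g x = g 0 * cexp (h x - h 0) := by
    intro x hx
    have := Metric.isOpen_ball.is_const_of_deriv_eq_zero (convex_ball (0:ℂ) R).isPreconnected
      (fun y hy => (hder y hy).differentiableAt.differentiableWithinAt)
      (fun y hy => (hder y hy).deriv) hx h0m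
    simp only [sub_self, neg_zero, Complex.exp_zero, mul_one] at this
    rw [← this, mul_assoc, ← Complex.exp_add]
    simp
  set M := B - Real.log ‖g 0‖ + 1 with hM
  have hg0p : 0 < ‖g 0‖ := norm_pos_iff.2 (hg0 0 (by simpa using hR.le))
  have hMpos : 0 < M := by
    have := Real.log_le_log hg0p (hB 0 (by simpa using hR.le))
    rw [Real.log_exp] at this; linarith
  have hu : DifferentiableOn ℂ (fun x => h x - h 0) (Metric.ball 0 R) := fun x hx =>
    ((hh x hx).sub_const (h 0)).differentiableAt.differentiableWithinAt
  have hmaps : MapsTo (fun x => h x - h 0) (Metric.ball 0 R) {z | z.re ≤ M} := by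
    intro x hx
    have h1 := hB x (hball x hx)
    rw [hconst x hx, norm_mul, Complex.norm_exp] at h1
    have h2 := Real.log_le_log (by positivity) h1
    rw [Real.log_mul hg0p.ne' (Real.exp_ne_zero _), Real.log_exp, Real.log_exp] at h2
    simp only [mem_ofPred_eq]
    linarith
  have hub : ∀ x, ‖x‖ ≤ R / 2 → ‖h x - h 0‖ ≤ 2 * M := by
    intro x hx
    have := borelCaratheodory_zero hMpos hu hmaps hR
      (z := x) (by rw [mem_ball_zero_iff]; linarith) (by simp)
    refine this.trans ?_
    rw [div_le_iff₀ (by linarith)]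
    nlinarith [norm_nonneg x]
  have hd1 : ∀ x, ‖x‖ ≤ R / 4 → ‖logDeriv g x‖ ≤ 2 * M / (R / 4) := by
    intro x hx
    have hx' : x ∈ Metric.ball (0:ℂ) R := by rw [mem_ball_zero_iff]; linarith
    rw [← ((hh x hx').sub_const (h 0)).deriv]
    refine Complex.norm_deriv_le_of_forall_mem_sphere_norm_le (by positivity) ?_ ?_
    · refine DifferentiableOn.diffContOnCl ?_
      refine hu.mono ?_
      refine (closure_minimal Metric.ball_subset_closedBall Metric.isClosed_closedBall).trans ?_
      intro y hy
      rw [mem_closedBall_iff_norm] at hy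
      rw [mem_ball_zero_iff]
      have := norm_le_norm_add_norm_sub' y x
      linarith
    · intro y hy
      rw [mem_sphere_iff_norm] at hy
      apply hub
      have := norm_le_norm_add_norm_sub' y x
      linarith
  have hd2 : ∀ x ∈ Metric.ball (0:ℂ) (R / 8), ‖deriv (logDeriv g) x‖ ≤ 64 * M / R ^ 2 := by
    intro x hx
    rw [mem_ball_zero_iff] at hx
    have : 64 * M / R ^ 2 = (2 * M / (R / 4)) / (R / 8) := by field_simp; ring
    rw [this]
    refine Complex.norm_deriv_le_of_forall_mem_sphere_norm_le (by positivity) ?_ ?_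
    · refine DifferentiableOn.diffContOnCl ?_
      refine hld.mono ?_
      refine (closure_minimal Metric.ball_subset_closedBall Metric.isClosed_closedBall).trans ?_
      intro y hy
      rw [mem_closedBall_iff_norm] at hy
      rw [mem_ball_zero_iff]
      have := norm_le_norm_add_norm_sub' y x
      linarith
    · intro y hy
      rw [mem_sphere_iff_norm] at hy
      apply hd1
      have := norm_le_norm_add_norm_sub' y x
      linarith
  refine (convex_ball (0:ℂ) (R / 8)).norm_image_sub_le_of_norm_deriv_le (𝕜 := ℂ) ?_ hd2
    (by rwa [mem_ball_zero_iff]) (by rwa [mem_ball_zero_iff])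
  intro x hx
  rw [mem_ball_zero_iff] at hx
  exact (hld x (by rw [mem_ball_zero_iff]; linarith)).differentiableAt
    (Metric.isOpen_ball.mem_nhds (by rw [mem_ball_zero_iff]; linarith))

lemma ord_eq_zero {f : ℂ → ℂ} {ρ : ℂ} (h : f ρ ≠ 0) : analyticOrderNatAt f ρ = 0 := by
  rw [analyticOrderNatAt, ENat.toNat_eq_zero]
  by_cases ha : AnalyticAt ℂ f ρ
  · left; exact ha.analyticOrderAt_eq_zero.2 h
  · left; exact analyticOrderAt_of_not_analyticAt ha

lemma ord_ne_zero {f : ℂ → ℂ} (hf : Differentiable ℂ f) (h0 : f 0 ≠ 0) {ρ : ℂ} (h : f ρ = 0) :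
    analyticOrderNatAt f ρ ≠ 0 := by
  have hA : AnalyticOnNhd ℂ f univ := fun z _ => hf.analyticAt z
  have ht : analyticOrderAt f ρ ≠ ⊤ := by
    refine hA.analyticOrderAt_ne_top_of_isPreconnected isPreconnected_univ (mem_univ 0)
      (mem_univ ρ) ?_
    rw [(hf.analyticAt 0).analyticOrderAt_eq_zero.2 h0]; simp
  rw [analyticOrderNatAt, Ne, ENat.toNat_eq_zero]
  rintro (h1 | h1)
  · exact (hf.analyticAt ρ).analyticOrderAt_eq_zero.1 h1 h
  · exact ht h1

/-- sum over zeros converges -/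
lemma summable_ord {f : ℂ → ℂ} (hf : Differentiable ℂ f) (h0 : f 0 ≠ 0) {C : ℝ}
    (hC : ∀ k : ℕ, ∀ z, ‖z‖ ≤ 4 ^ k → ‖f z‖ ≤ Real.exp (C * 8 ^ k)) :
    Summable (fun ρ : ℂ => (analyticOrderNatAt f ρ : ℝ) / (1 + ‖ρ‖ ^ 2)) := by
  classical
  set m : ℂ → ℝ := fun ρ => (analyticOrderNatAt f ρ : ℝ) with hm
  have hm0 : ∀ ρ, 0 ≤ m ρ := fun ρ => by simp [hm]
  set D : ℝ := |8 * C| + |Real.log ‖f 0‖| with hD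
  have hD0 : 0 ≤ D := by positivity
  have hcount : ∀ k : ℕ, ∀ s : Finset ℂ, (∀ ρ ∈ s, ‖ρ‖ ≤ 4 ^ k) → ∑ ρ ∈ s, m ρ ≤ D * 8 ^ k := by
    intro k s hs
    set F := (zeros_finite hf h0 ((4:ℝ) ^ k)).toFinset with hF
    have h1 := count_zeros_le hf h0 (R := 4 ^ k) (B := C * 8 ^ (k+1)) (by positivity)
      (fun z hz => hC (k+1) z (by rw [pow_succ]; linarith)) F (by intro z; simp [hF])
    have h2 : ∑ ρ ∈ s, m ρ ≤ ∑ ρ ∈ F, m ρ := by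
      calc ∑ ρ ∈ s, m ρ = ∑ ρ ∈ s with f ρ = 0, m ρ := by
            rw [Finset.sum_filter]
            refine Finset.sum_congr rfl fun ρ _ => ?_
            split_ifs with h
            · rfl
            · simp [hm, ord_eq_zero h]
        _ ≤ _ := by
            refine Finset.sum_le_sum_of_subset_of_nonneg ?_ fun ρ _ _ => hm0 ρ
            intro ρ hρ
            rw [Finset.mem_filter] at hρ
            simp [hF, hρ.2, hs ρ hρ.1]
    push_cast at h1
    refine h2.trans (h1.trans ?_)
    have h8 : (1:ℝ) ≤ 8 ^ k := one_le_pow₀ (by norm_num)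
    have e1 : C * 8 ^ (k+1) ≤ |8 * C| * 8 ^ k := by
      rw [pow_succ]; nlinarith [le_abs_self (8*C)]
    have e2 : - Real.log ‖f 0‖ ≤ |Real.log ‖f 0‖| * 8 ^ k := by
      nlinarith [neg_le_abs (Real.log ‖f 0‖), abs_nonneg (Real.log ‖f 0‖)]
    rw [hD, add_mul]; linarith
  refine summable_of_sum_le (c := 32 * D) (fun ρ => by positivity) fun s => ?_
  -- choose K
  obtain ⟨K, hK⟩ : ∃ K : ℕ, ∀ ρ ∈ s, ‖ρ‖ ≤ 4 ^ K := by
    have : ∀ ρ : ℂ, ∃ K : ℕ, ‖ρ‖ ≤ 4 ^ K := fun ρ => by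
      obtain ⟨n, hn⟩ := pow_unbounded_of_one_lt ‖ρ‖ (by norm_num : (1:ℝ) < 4)
      exact ⟨n, hn.le⟩
    choose K hK using this
    refine ⟨s.sup K, fun ρ hρ => (hK ρ).trans ?_⟩
    exact pow_le_pow_right₀ (by norm_num) (Finset.le_sup hρ)
  have key : ∀ ρ ∈ s, m ρ / (1 + ‖ρ‖ ^ 2) ≤
      ∑ k ∈ Finset.range (K+1), (if ‖ρ‖ ≤ 4 ^ k then 16 * (1/16:ℝ) ^ k * m ρ else 0) := by
    intro ρ hρ
    have hex : ∃ k : ℕ, ‖ρ‖ ≤ 4 ^ k := ⟨K, hK ρ hρ⟩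
    set k := Nat.find hex
    have hk1 : ‖ρ‖ ≤ 4 ^ k := Nat.find_spec hex
    have hkK : k ≤ K := Nat.find_min' hex (hK ρ hρ)
    have hlow : (16:ℝ) ^ k ≤ 16 * (1 + ‖ρ‖ ^ 2) := by
      rcases Nat.eq_zero_or_pos k with h | h
      · rw [h]; nlinarith [sq_nonneg ‖ρ‖]
      · have h2 := Nat.find_min hex (m := k - 1) (by omega)
        push Not at h2
        have h3 : (4:ℝ) ^ k = 4 * 4 ^ (k-1) := by rw [← pow_succ']; congr 1; omega
        have h4 : (16:ℝ) ^ k = (4 ^ k) ^ 2 := by rw [← pow_mul, mul_comm, pow_mul]; norm_num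
        rw [h4, h3]
        have : (4:ℝ)^(k-1) > 0 := by positivity
        nlinarith
    calc m ρ / (1 + ‖ρ‖ ^ 2) ≤ 16 * (1/16:ℝ) ^ k * m ρ := by
          rw [div_le_iff₀ (by positivity), one_div, inv_pow]
          have : 1 ≤ 16 * (1 + ‖ρ‖ ^ 2) * ((16:ℝ) ^ k)⁻¹ := by
            rw [← div_eq_mul_inv, le_div_iff₀ (by positivity)]; linarith
          nlinarith [hm0 ρ]
      _ = (if ‖ρ‖ ≤ 4 ^ k then 16 * (1/16:ℝ) ^ k * m ρ else 0) := by rw [if_pos hk1]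
      _ ≤ _ := by
          refine Finset.single_le_sum (f := fun k => if ‖ρ‖ ≤ 4 ^ k then 16 * (1/16:ℝ) ^ k * m ρ else 0) (fun i _ => ?_) (Finset.mem_range.2 (by omega))
          have := hm0 ρ
          show 0 ≤ ite _ _ _
          split_ifs <;> positivity
  calc ∑ ρ ∈ s, m ρ / (1 + ‖ρ‖ ^ 2) ≤ ∑ ρ ∈ s, ∑ k ∈ Finset.range (K+1),
        (if ‖ρ‖ ≤ 4 ^ k then 16 * (1/16:ℝ) ^ k * m ρ else 0) := Finset.sum_le_sum key
    _ = ∑ k ∈ Finset.range (K+1), 16 * (1/16:ℝ) ^ k * ∑ ρ ∈ s with ‖ρ‖ ≤ 4 ^ k, m ρ := by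
        rw [Finset.sum_comm]
        refine Finset.sum_congr rfl fun k _ => ?_
        rw [← Finset.sum_filter, Finset.mul_sum]
    _ ≤ ∑ k ∈ Finset.range (K+1), 16 * D * (1/2:ℝ) ^ k := by
        refine Finset.sum_le_sum fun k _ => ?_
        have h1 := hcount k (s.filter (fun ρ => ‖ρ‖ ≤ 4 ^ k)) (by simp)
        have h2 : (1/16:ℝ) ^ k * 8 ^ k = (1/2) ^ k := by rw [← mul_pow]; norm_num
        calc _ ≤ 16 * (1/16:ℝ) ^ k * (D * 8 ^ k) := by gcongr
          _ = 16 * D * ((1/16:ℝ) ^ k * 8 ^ k) := by ring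
          _ = _ := by rw [h2]
    _ = 16 * D * ∑ k ∈ Finset.range (K+1), (1/2:ℝ) ^ k := by rw [Finset.mul_sum]
    _ ≤ 16 * D * 2 := by
        gcongr
        exact sum_geometric_two_le _
    _ = 32 * D := by ring

/-- partial-fraction kernel bound -/
lemma inv_sub_le {f : ℂ → ℂ} (hf : Differentiable ℂ f) {z : ℂ} (hz : f z ≠ 0) :
    ∃ K : ℝ, 0 < K ∧ ∀ ρ, f ρ = 0 → ‖(z - ρ)⁻¹‖ ≤ K / (1 + ‖ρ‖) := by
  have h1 : ∀ᶠ x in nhds z, f x ≠ 0 := (hf z).continuousAt.eventually_ne hz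
  obtain ⟨ε, hε, h2⟩ := Metric.eventually_nhds_iff_ball.1 h1
  refine ⟨(1 + ‖z‖) / ε + 1, by positivity, fun ρ hρ => ?_⟩
  have h3 : ε ≤ ‖z - ρ‖ := by
    by_contra h
    push Not at h
    exact h2 ρ (by rw [Metric.mem_ball, dist_comm, dist_eq_norm]; exact h) hρ
  have h4 : 1 + ‖ρ‖ ≤ ((1 + ‖z‖) / ε + 1) * ‖z - ρ‖ := by
    have h5 : ‖ρ‖ ≤ ‖z‖ + ‖z - ρ‖ := by
      calc ‖ρ‖ = ‖z - (z - ρ)‖ := by congr 1; ring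
        _ ≤ _ := norm_sub_le _ _
    have h6 : 1 + ‖z‖ ≤ (1 + ‖z‖) / ε * ‖z - ρ‖ := by
      rw [div_mul_eq_mul_div, le_div_iff₀ hε]
      have : 0 ≤ ‖z‖ := norm_nonneg _
      nlinarith
    linarith
  rw [norm_inv, inv_eq_one_div, div_le_div_iff₀ (by linarith) (by positivity)]
  linarith

lemma hasSum_logDeriv {f : ℂ → ℂ} (hf : Differentiable ℂ f) (h0 : f 0 ≠ 0) {C : ℝ}
    (hC : ∀ k : ℕ, ∀ z, ‖z‖ ≤ 4 ^ k → ‖f z‖ ≤ Real.exp (C * 8 ^ k)) {z w : ℂ}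
    (hz : f z ≠ 0) (hw : f w ≠ 0) :
    HasSum (fun ρ : ℂ => (analyticOrderNatAt f ρ : ℂ) * ((z - ρ)⁻¹ - (w - ρ)⁻¹))
      (logDeriv f z - logDeriv f w) := by
  classical
  set T : ℂ → ℂ := fun ρ : ℂ => (analyticOrderNatAt f ρ : ℂ) * ((z - ρ)⁻¹ - (w - ρ)⁻¹) with hT
  obtain ⟨K, hK0, hK⟩ := inv_sub_le hf hz
  obtain ⟨K', hK0', hK'⟩ := inv_sub_le hf hw
  have hsum := (summable_ord hf h0 hC).mul_left (K * K' * ‖z - w‖)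
  have hb : ∀ ρ, ‖T ρ‖ ≤ K * K' * ‖z - w‖ * ((analyticOrderNatAt f ρ : ℝ) / (1 + ‖ρ‖ ^ 2)) := by
    intro ρ
    by_cases hρ : f ρ = 0
    · have hzρ : z - ρ ≠ 0 := fun h => hz (by rw [sub_eq_zero.1 h]; exact hρ)
      have hwρ : w - ρ ≠ 0 := fun h => hw (by rw [sub_eq_zero.1 h]; exact hρ)
      have e : T ρ = (analyticOrderNatAt f ρ : ℂ) * ((z - ρ)⁻¹ * (w - ρ)⁻¹ * (w - z)) := by
        simp only [hT]; congr 1; field_simp; ring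
      rw [e, norm_mul, norm_mul, norm_mul, Complex.norm_natCast, norm_sub_rev w z]
      have h1 := hK ρ hρ
      have h2 := hK' ρ hρ
      have h3 : ‖(z - ρ)⁻¹‖ * ‖(w - ρ)⁻¹‖ ≤ K * K' / (1 + ‖ρ‖ ^ 2) := by
        calc _ ≤ K / (1 + ‖ρ‖) * (K' / (1 + ‖ρ‖)) := by gcongr
          _ = K * K' / ((1 + ‖ρ‖) * (1 + ‖ρ‖)) := by rw [div_mul_div_comm]
          _ ≤ _ := by
            gcongr
            nlinarith [norm_nonneg ρ]
      calc _ ≤ (analyticOrderNatAt f ρ : ℝ) * (K * K' / (1 + ‖ρ‖ ^ 2) * ‖z - w‖) := by gcongr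
        _ = _ := by ring
    · simp [hT, ord_eq_zero hρ]
  have hTs : Summable T := Summable.of_norm_bounded hsum hb
  have hlim : Tendsto (fun k : ℕ => ∑' ρ, if ‖ρ‖ ≤ 4 ^ k then T ρ else 0) atTop
      (nhds (∑' ρ, T ρ)) := by
    refine tendsto_tsum_of_dominated_convergence hsum ?_ ?_
    · intro ρ
      obtain ⟨n, hn⟩ := pow_unbounded_of_one_lt ‖ρ‖ (by norm_num : (1:ℝ) < 4)
      refine tendsto_const_nhds.congr' ?_
      filter_upwards [eventually_ge_atTop n] with k hk
      rw [if_pos]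
      exact hn.le.trans (pow_le_pow_right₀ (by norm_num) hk)
    · refine Eventually.of_forall fun k ρ => ?_
      split_ifs
      · exact hb ρ
      · rw [norm_zero]; positivity
  have hlim2 : Tendsto (fun k : ℕ => (logDeriv f z - logDeriv f w) -
      ∑' ρ, if ‖ρ‖ ≤ 4 ^ k then T ρ else 0) atTop (nhds 0) := by
    set A : ℝ := 64 * (8 * |C| + |Real.log ‖f 0‖| + 1) * ‖z - w‖ with hA
    have hgeo : Tendsto (fun k : ℕ => A * (1/2:ℝ) ^ k) atTop (nhds 0) := by
      have := (tendsto_pow_atTop_nhds_zero_of_lt_one (by norm_num : (0:ℝ) ≤ 1/2) (by norm_num)).const_mul A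
      simpa using this
    refine squeeze_zero_norm' ?_ hgeo
    obtain ⟨n, hn⟩ := pow_unbounded_of_one_lt (8 * (‖z‖ + ‖w‖)) (by norm_num : (1:ℝ) < 4)
    filter_upwards [eventually_ge_atTop n] with k hk
    have hnk : 8 * (‖z‖ + ‖w‖) < 4 ^ k := hn.trans_le (pow_le_pow_right₀ (by norm_num) hk)
    set F := (zeros_finite hf h0 ((4:ℝ) ^ k)).toFinset with hF
    have hFm : ∀ x, x ∈ F ↔ f x = 0 ∧ ‖x‖ ≤ 4 ^ k := by intro x; simp [hF]
    obtain ⟨g, hg, hgn, hg0, hgb, hfg⟩ := exists_zero_free hf h0 (R := 4 ^ k)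
      (B := C * 8 ^ (k+1)) (by positivity)
      (fun z hz => hC (k+1) z (by rw [pow_succ]; linarith)) F hFm
    have hgb' : ∀ x, ‖x‖ ≤ 4 ^ k → ‖g x‖ ≤ Real.exp (C * 8 ^ (k+1)) := by
      intro x hx
      refine (hgb x ?_).trans ?_
      · have : (0:ℝ) < 4 ^ k := by positivity
        linarith
      · refine div_le_self (Real.exp_pos _).le (one_le_pow₀ (by norm_num))
    have hld := logDeriv_sub_le hg (R := 4 ^ k) (by positivity) hgn hgb' (z := z) (w := w)
      (by rw [lt_div_iff₀ (by norm_num)]; nlinarith [norm_nonneg z, norm_nonneg w])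
      (by rw [lt_div_iff₀ (by norm_num)]; nlinarith [norm_nonneg z, norm_nonneg w])
    have hF0 : ∀ ρ ∈ F, ρ ≠ 0 := by
      intro ρ hρ h; rw [h] at hρ; exact h0 ((hFm 0).1 hρ).1
    have hlog : ∀ x, f x ≠ 0 → ‖x‖ ≤ 4 ^ k → logDeriv f x =
        (∑ ρ ∈ F, (analyticOrderNatAt f ρ : ℂ) * (x - ρ)⁻¹) + logDeriv g x := by
      intro x hx hxk
      have hfe : f = fun z => (∏ ρ ∈ F, (1 - z / ρ) ^ (analyticOrderNatAt f ρ)) * g z :=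
        funext hfg
      have hne : ∀ ρ ∈ F, (1 - x / ρ) ≠ 0 := by
        intro ρ hρ h
        have h1 := hF0 ρ hρ
        have : x = ρ := by rw [sub_eq_zero, eq_div_iff h1, one_mul] at h; exact h.symm
        rw [this] at hx; exact hx ((hFm ρ).1 hρ).1
      have hne' : ∀ ρ ∈ F, (1 - x / ρ) ^ (analyticOrderNatAt f ρ) ≠ 0 := fun ρ hρ =>
        pow_ne_zero _ (hne ρ hρ)
      conv_lhs => rw [hfe]
      rw [logDeriv_mul (f := fun z => ∏ ρ ∈ F, (1 - z / ρ) ^ (analyticOrderNatAt f ρ)) x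
        (Finset.prod_ne_zero_iff.2 hne') (hgn x hxk) (by fun_prop) (hg x)]
      congr 1
      rw [logDeriv_prod (by exact hne') (by intro i _; fun_prop)]
      refine Finset.sum_congr rfl fun ρ hρ => ?_
      rw [logDeriv_fun_pow (by fun_prop)]
      congr 1
      have h1 := hF0 ρ hρ
      have hd : deriv (fun z : ℂ => 1 - z / ρ) x = -(1/ρ) := by
        have : HasDerivAt (fun z : ℂ => 1 - z / ρ) (-(1/ρ)) x := by
          simpa using ((hasDerivAt_id x).div_const ρ).const_sub 1
        exact this.deriv
      rw [logDeriv_apply, hd]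
      have h2 := hne ρ hρ
      have h3 : x - ρ ≠ 0 := by
        intro h; apply h2; rw [sub_eq_zero.1 h]; field_simp; ring
      have h4 : ρ - x ≠ 0 := by rw [← neg_sub]; exact neg_ne_zero.2 h3
      field_simp
      ring
    have hzk : ‖z‖ ≤ 4 ^ k := by nlinarith [norm_nonneg z, norm_nonneg w]
    have hwk : ‖w‖ ≤ 4 ^ k := by nlinarith [norm_nonneg z, norm_nonneg w]
    have hts : (∑' ρ, if ‖ρ‖ ≤ 4 ^ k then T ρ else 0) = ∑ ρ ∈ F, T ρ := by
      rw [tsum_eq_sum (s := F)]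
      · refine Finset.sum_congr rfl fun ρ hρ => ?_
        rw [if_pos ((hFm ρ).1 hρ).2]
      · intro ρ hρ
        split_ifs with h
        · have : f ρ ≠ 0 := fun h' => hρ ((hFm ρ).2 ⟨h', h⟩)
          simp [hT, ord_eq_zero this]
        · rfl
    have e1 : (logDeriv f z - logDeriv f w) - (∑' ρ, if ‖ρ‖ ≤ 4 ^ k then T ρ else 0)
        = logDeriv g z - logDeriv g w := by
      rw [hts, hlog z hz hzk, hlog w hw hwk]
      simp only [hT, mul_sub, Finset.sum_sub_distrib]
      ring
    rw [e1]
    refine hld.trans ?_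
    rw [hg0]
    have h16 : ((4:ℝ) ^ k) ^ 2 = 16 ^ k := by rw [← pow_mul, mul_comm, pow_mul]; norm_num
    have h12 : (1/2:ℝ) ^ k = 8 ^ k / 16 ^ k := by rw [← div_pow]; norm_num
    rw [h16, h12, hA]
    have h8 : (1:ℝ) ≤ 8 ^ k := one_le_pow₀ (by norm_num)
    have : C * 8 ^ (k + 1) - Real.log ‖f 0‖ + 1 ≤ (8 * |C| + |Real.log ‖f 0‖| + 1) * 8 ^ k := by
      rw [pow_succ]
      nlinarith [le_abs_self C, neg_le_abs (Real.log ‖f 0‖), abs_nonneg (Real.log ‖f 0‖), abs_nonneg C]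
    calc _ = 64 * ‖z - w‖ * (C * 8 ^ (k + 1) - Real.log ‖f 0‖ + 1) / 16 ^ k := by ring
      _ ≤ 64 * ‖z - w‖ * ((8 * |C| + |Real.log ‖f 0‖| + 1) * 8 ^ k) / 16 ^ k := by gcongr
      _ = _ := by ring
  have : ∑' ρ, T ρ = logDeriv f z - logDeriv f w := by
    have h3 : Tendsto (fun k : ℕ => (logDeriv f z - logDeriv f w) -
      ∑' ρ, if ‖ρ‖ ≤ 4 ^ k then T ρ else 0) atTop (nhds ((logDeriv f z - logDeriv f w) - ∑' ρ, T ρ)) :=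
      tendsto_const_nhds.sub hlim
    have := tendsto_nhds_unique h3 hlim2
    exact (sub_eq_zero.1 this).symm
  rw [← this]
  exact hTs.hasSum

/-- the entire function `s(s-1)Λ(s)` -/
def xiF (s : ℂ) : ℂ := s * (s - 1) * completedRiemannZeta₀ s + 1

lemma xiF_diff : Differentiable ℂ xiF := by
  have := differentiable_completedZeta₀
  unfold xiF
  fun_prop

lemma xiF_zero : xiF 0 = 1 := by simp [xiF]

lemma xiF_one_sub (s : ℂ) : xiF (1 - s) = xiF s := by
  rw [xiF, xiF, completedRiemannZeta₀_one_sub]; ring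

lemma completedZeta₀_growth_aux : ∃ A : ℝ, 0 ≤ A ∧ ∀ k : ℕ, ∀ s : ℂ, 1/2 ≤ s.re → ‖s‖ ≤ 2 * 4 ^ k →
    ‖completedRiemannZeta₀ s‖ ≤ Real.exp (A * 8 ^ k) := by
  set P := HurwitzZeta.hurwitzEvenFEPair 0 with hP
  obtain ⟨p, hp, hO⟩ := HurwitzZeta.isBigO_atTop_evenKernel_sub 0
  obtain ⟨C, hC⟩ := hO.bound
  obtain ⟨X, hX⟩ := eventually_atTop.1 hC
  set X0 := max X 2 with hX0
  have hX02 : 2 ≤ X0 := le_max_right _ _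
  have hFt : ∀ x, X0 < x → ‖P.f_modif x‖ ≤ |C| * Real.exp (-p * x) := by
    intro x hx
    have h1 : 1 < x := by linarith
    have h2 := hX x ((le_max_left _ _).trans hx.le)
    have h3 : P.f_modif x = ((HurwitzZeta.evenKernel 0 x - 1 : ℝ) : ℂ) := by
      rw [WeakFEPair.f_modif, Pi.add_apply, indicator_of_mem (mem_Ioi.mpr h1),
        indicator_of_notMem (notMem_Ioo_of_ge h1.le)]
      simp [hP, HurwitzZeta.hurwitzEvenFEPair]
    rw [h3, Complex.norm_real]
    simp only [if_true] at h2
    rw [Real.norm_of_nonneg (Real.exp_pos _).le] at h2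
    refine h2.trans ?_
    gcongr
    exact le_abs_self C
  have hmc : ∀ s, MellinConvergent P.f_modif s := fun s =>
    (P.isStrongFEPair_toStrongFEPair.hasMellin s).1
  set K := ∫ x in Ioi (0:ℝ), ‖(x:ℂ) ^ ((1/4:ℂ) - 1) • P.f_modif x‖ with hK
  set J := ∫ x in Ioi (0:ℝ), Real.exp (-(p/2) * x) with hJ
  have hK0 : 0 ≤ K := integral_nonneg fun _ => norm_nonneg _
  have hJ0 : 0 ≤ J := integral_nonneg fun _ => (Real.exp_pos _).le
  have hJi : IntegrableOn (fun x : ℝ => Real.exp (-(p/2) * x)) (Ioi 0) := 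
    integrableOn_exp_mul_Ioi (by linarith) 0
  refine ⟨1 + (X0 + K) + (|C| * J + 2 + 2/p), by positivity, fun k s hs1 hs2 => ?_⟩
  set N : ℕ := 4 ^ k with hN
  have hNr : (N:ℝ) = 4 ^ k := by simp [hN]
  have hσ1 : 1/4 ≤ (s/2).re := by
    have : (s/2).re = s.re / 2 := by simp
    rw [this]; linarith
  have hσ2 : (s/2).re ≤ N := by
    have : (s/2).re = s.re / 2 := by simp
    rw [this, hNr]
    have := (Complex.re_le_norm s).trans hs2
    linarith
  have hintg := (hmc (1/4)).norm
  have hpt : ∀ x ∈ Ioi (0:ℝ), ‖(x:ℂ) ^ (s/2 - 1) • P.f_modif x‖ ≤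
      X0 ^ N * ‖(x:ℂ) ^ ((1/4:ℂ) - 1) • P.f_modif x‖ + 
      |C| * (N.factorial * (2/p) ^ N) * Real.exp (-(p/2) * x) := by
    intro x hx
    have hx0 : (0:ℝ) < x := hx
    rw [norm_smul, norm_smul, Complex.norm_cpow_eq_rpow_re_of_pos hx0,
      Complex.norm_cpow_eq_rpow_re_of_pos hx0]
    have e1 : (s/2 - 1).re = (s/2).re - 1 := by simp
    have e2 : ((1/4:ℂ) - 1).re = 1/4 - 1 := by norm_num
    rw [e1, e2]
    set σ := (s/2).re
    by_cases hxX : x ≤ X0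
    · have : x ^ (σ - 1) ≤ X0 ^ N * x ^ ((1/4:ℝ) - 1) := by
        have h1 : x ^ (σ - 1) = x ^ (σ - 1/4) * x ^ ((1/4:ℝ) - 1) := by
          rw [← Real.rpow_add hx0]; congr 1; ring
        rw [h1]
        gcongr
        calc x ^ (σ - 1/4) ≤ X0 ^ (σ - 1/4) := Real.rpow_le_rpow hx0.le hxX (by linarith)
          _ ≤ X0 ^ (N:ℝ) := Real.rpow_le_rpow_of_exponent_le (by linarith) (by linarith)
          _ = _ := Real.rpow_natCast _ _
      have h2 : 0 ≤ |C| * (N.factorial * (2/p) ^ N) * Real.exp (-(p/2) * x) := by positivity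
      have h3 : 0 ≤ ‖P.f_modif x‖ := norm_nonneg _
      nlinarith
    · push Not at hxX
      have h1 := hFt x hxX
      have h2 : x ^ (σ - 1) ≤ x ^ N := by
        calc _ ≤ x ^ (N:ℝ) := Real.rpow_le_rpow_of_exponent_le (by linarith) (by linarith)
          _ = _ := Real.rpow_natCast _ _
      have h3 : x ^ N ≤ N.factorial * (2/p) ^ N * Real.exp (p/2 * x) := by
        have := Real.pow_div_factorial_le_exp (p/2*x) (by positivity) N
        rw [div_le_iff₀ (by positivity), mul_pow] at this
        have h4 : (2/p) ^ N * ((p/2) ^ N * x ^ N) = x ^ N := by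
          rw [← mul_assoc, ← mul_pow]
          have : 2/p*(p/2) = 1 := by field_simp
          rw [this]; simp
        rw [← h4]
        calc _ ≤ (2/p) ^ N * (Real.exp (p/2*x) * N.factorial) := by gcongr
          _ = _ := by ring
      have h5 : 0 ≤ X0 ^ N * (x ^ ((1/4:ℝ) - 1) * ‖P.f_modif x‖) := by positivity
      calc x ^ (σ - 1) * ‖P.f_modif x‖ ≤ (N.factorial * (2/p) ^ N * Real.exp (p/2 * x)) * (|C| * Real.exp (-p * x)) := by
            gcongr
            exact h2.trans h3
        _ = |C| * (N.factorial * (2/p) ^ N) * (Real.exp (p/2 * x) * Real.exp (-p * x)) := by ring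
        _ = |C| * (N.factorial * (2/p) ^ N) * Real.exp (-(p/2) * x) := by
            rw [← Real.exp_add]; congr 2; ring
        _ ≤ _ := by linarith
  have hmain : ‖mellin P.f_modif (s/2)‖ ≤ X0 ^ N * K + |C| * (N.factorial * (2/p) ^ N) * J := by
    rw [mellin]
    refine (norm_integral_le_integral_norm _).trans ?_
    refine (setIntegral_mono_on (hmc (s/2)).norm ((hintg.const_mul _).add (hJi.const_mul _)) measurableSet_Ioi hpt).trans ?_
    rw [integral_add' (hintg.const_mul _) (hJi.const_mul _), integral_const_mul, integral_const_mul]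
  have hz : completedRiemannZeta₀ s = mellin P.f_modif (s/2) / 2 := rfl
  have h8 : (1:ℝ) ≤ 8 ^ k := one_le_pow₀ (by norm_num)
  have h48 : (4:ℝ) ^ k ≤ 8 ^ k := pow_le_pow_left₀ (by norm_num) (by norm_num) k
  have le_exp : ∀ y : ℝ, y ≤ Real.exp y := fun y => by linarith [Real.add_one_le_exp y]
  have e1 : X0 ^ N * K ≤ Real.exp ((X0 + K) * 8 ^ k) := by
    calc X0 ^ N * K ≤ (Real.exp X0) ^ N * Real.exp K := by
          gcongr <;> apply le_exp
      _ = Real.exp (X0 * 4 ^ k + K) := by rw [← Real.exp_nat_mul, ← Real.exp_add, hNr]; ring_nf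
      _ ≤ _ := by
          apply Real.exp_le_exp.2
          nlinarith
  have e2 : (N.factorial : ℝ) ≤ Real.exp (2 * 8 ^ k) := by
    calc (N.factorial : ℝ) ≤ (N:ℝ) ^ N := by exact_mod_cast Nat.factorial_le_pow N
      _ = (4 ^ k : ℝ) ^ N := by rw [hNr]
      _ ≤ (Real.exp 2 ^ k) ^ N := by
          gcongr
          have := Real.add_one_lt_exp (x := 2) (by norm_num)
          have h2 : Real.exp 2 = Real.exp 1 * Real.exp 1 := by rw [← Real.exp_add]; norm_num
          have := Real.exp_one_gt_d9
          nlinarith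
      _ = Real.exp (2 * k * 4 ^ k) := by
          rw [← Real.exp_nat_mul, ← Real.exp_nat_mul, hNr]; ring_nf
      _ ≤ _ := by
          apply Real.exp_le_exp.2
          have h1 : (k:ℝ) ≤ 2 ^ k := by exact_mod_cast Nat.lt_two_pow_self.le
          have h2 : (8:ℝ) ^ k = 2 ^ k * 4 ^ k := by rw [← mul_pow]; norm_num
          rw [h2, mul_assoc]
          gcongr
  have e3 : (2/p) ^ N ≤ Real.exp (2/p * 8 ^ k) := by
    calc (2/p) ^ N ≤ Real.exp (2/p) ^ N := by gcongr; apply le_exp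
      _ = Real.exp (2/p * 4 ^ k) := by rw [← Real.exp_nat_mul, hNr]; ring_nf
      _ ≤ _ := by apply Real.exp_le_exp.2; gcongr
  have e4 : |C| * (N.factorial * (2/p) ^ N) * J ≤ Real.exp ((|C| * J + 2 + 2/p) * 8 ^ k) := by
    calc |C| * (N.factorial * (2/p) ^ N) * J = (|C| * J) * N.factorial * (2/p) ^ N := by ring
      _ ≤ Real.exp (|C| * J * 8 ^ k) * Real.exp (2 * 8 ^ k) * Real.exp (2/p * 8 ^ k) := by
          gcongr
          refine (le_exp _).trans (Real.exp_le_exp.2 ?_)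
          have : 0 ≤ |C| * J := by positivity
          nlinarith
      _ = _ := by rw [← Real.exp_add, ← Real.exp_add]; ring_nf
  rw [hz, norm_div]
  have : ‖(2:ℂ)‖ = 2 := by simp
  rw [this]
  have hexp : ∀ a b : ℝ, 0 ≤ a → 0 ≤ b → Real.exp a + Real.exp b ≤ 2 * Real.exp (a + b) := by
    intro a b ha hb
    have h1 := Real.exp_le_exp.2 (by linarith : a ≤ a + b)
    have h2 := Real.exp_le_exp.2 (by linarith : b ≤ a + b)
    linarith
  have h9 := hexp ((X0 + K) * 8 ^ k) ((|C| * J + 2 + 2/p) * 8 ^ k) (by positivity) (by positivity)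
  have h10 : Real.exp ((X0 + K) * 8 ^ k + (|C| * J + 2 + 2/p) * 8 ^ k) ≤
      Real.exp ((1 + (X0 + K) + (|C| * J + 2 + 2/p)) * 8 ^ k) := by
    apply Real.exp_le_exp.2; nlinarith
  linarith

lemma xiF_growth : ∃ C : ℝ, ∀ k : ℕ, ∀ z, ‖z‖ ≤ 4 ^ k → ‖xiF z‖ ≤ Real.exp (C * 8 ^ k) := by
  obtain ⟨A, hA0, hA⟩ := completedZeta₀_growth_aux
  refine ⟨A + 6, fun k z hz => ?_⟩
  have h4 : (1:ℝ) ≤ 4 ^ k := one_le_pow₀ (by norm_num)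
  have h8 : (1:ℝ) ≤ 8 ^ k := one_le_pow₀ (by norm_num)
  have h1 : ‖completedRiemannZeta₀ z‖ ≤ Real.exp (A * 8 ^ k) := by
    by_cases h : 1/2 ≤ z.re
    · exact hA k z h (by linarith)
    · rw [← completedRiemannZeta₀_one_sub]
      refine hA k _ ?_ ?_
      · simp; linarith
      · calc ‖1 - z‖ ≤ ‖(1:ℂ)‖ + ‖z‖ := norm_sub_le _ _
          _ ≤ _ := by rw [norm_one]; linarith
  have h2 : ‖z - 1‖ ≤ 2 * 4 ^ k := by
    calc ‖z - 1‖ ≤ ‖z‖ + ‖(1:ℂ)‖ := norm_sub_le _ _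
      _ ≤ _ := by rw [norm_one]; linarith
  have h3 : (4:ℝ) ^ k * (2 * 4 ^ k) ≤ Real.exp (4 * 8 ^ k) := by
    have e : (4:ℝ) ^ k ≤ 8 ^ k := pow_le_pow_left₀ (by norm_num) (by norm_num) k
    have e2 : ∀ y : ℝ, y ≤ Real.exp y := fun y => by linarith [Real.add_one_le_exp y]
    calc (4:ℝ) ^ k * (2 * 4 ^ k) ≤ Real.exp (8 ^ k) * Real.exp (2 * 8 ^ k) := by
          gcongr
          · exact e.trans (e2 _)
          · exact (by linarith : (2:ℝ) * 4 ^ k ≤ 2 * 8 ^ k).trans (e2 _)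
      _ ≤ _ := by rw [← Real.exp_add]; apply Real.exp_le_exp.2; linarith
  have h5 : (1:ℝ) ≤ Real.exp ((A + 4) * 8 ^ k) := by
    rw [← Real.exp_zero]; apply Real.exp_le_exp.2; positivity
  calc ‖xiF z‖ ≤ ‖z‖ * ‖z - 1‖ * ‖completedRiemannZeta₀ z‖ + 1 := by
        rw [xiF]
        refine (norm_add_le _ _).trans ?_
        rw [norm_mul, norm_mul, norm_one]
    _ ≤ (4:ℝ) ^ k * (2 * 4 ^ k) * Real.exp (A * 8 ^ k) + 1 := by gcongr
    _ ≤ Real.exp (4 * 8 ^ k) * Real.exp (A * 8 ^ k) + Real.exp ((A + 4) * 8 ^ k) := by gcongr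
    _ = 2 * Real.exp ((A + 4) * 8 ^ k) := by
        rw [← Real.exp_add]
        have : 4 * (8:ℝ) ^ k + A * 8 ^ k = (A + 4) * 8 ^ k := by ring
        rw [this]; ring
    _ ≤ Real.exp 1 * Real.exp ((A + 4) * 8 ^ k) := by
        gcongr
        have := Real.add_one_le_exp (1:ℝ)
        linarith
    _ ≤ _ := by rw [← Real.exp_add]; apply Real.exp_le_exp.2; nlinarith

lemma xiF_eq {s : ℂ} (h0 : s ≠ 0) (h1 : s ≠ 1) : xiF s = s * (s - 1) * completedRiemannZeta s := by
  rw [xiF, completedRiemannZeta_eq]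
  have : s - 1 ≠ 0 := sub_ne_zero.2 h1
  have h1' : 1 - s ≠ 0 := sub_ne_zero.2 h1.symm
  field_simp
  ring

lemma xiF_one : xiF 1 = 1 := by simp [xiF]

lemma zeta_eq_xiF {s : ℂ} (h0 : s ≠ 0) (h1 : s ≠ 1) :
    riemannZeta s = xiF s * ((Gammaℝ s)⁻¹ * (s * (s - 1))⁻¹) := by
  rw [riemannZeta_def_of_ne_zero h0, xiF_eq h0 h1]
  have : s - 1 ≠ 0 := sub_ne_zero.2 h1
  field_simp

lemma xiF_ne_zero_of_one_lt {s : ℂ} (h : 1 < s.re) : xiF s ≠ 0 := by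
  have h0 : s ≠ 0 := by rintro rfl; simp at h; linarith
  have h1 : s ≠ 1 := by rintro rfl; simp at h
  intro hx
  have := zeta_eq_xiF h0 h1
  rw [hx, zero_mul] at this
  exact riemannZeta_ne_zero_of_one_lt_re h this

lemma xiF_zero_re (hRH : RiemannHypothesis) {s : ℂ} (hs : xiF s = 0) : s.re = 1 / 2 := by
  have h0 : s ≠ 0 := by rintro rfl; rw [xiF_zero] at hs; exact one_ne_zero hs
  have h1 : s ≠ 1 := by rintro rfl; rw [xiF_one] at hs; exact one_ne_zero hs
  refine hRH s ?_ ?_ h1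
  · rw [zeta_eq_xiF h0 h1, hs, zero_mul]
  · rintro ⟨n, rfl⟩
    rw [← xiF_one_sub] at hs
    refine xiF_ne_zero_of_one_lt ?_ hs
    simp
    positivity

lemma xiF_of_nontriv {s : ℂ} (hs : ZetaNontrivZero s) : xiF s = 0 := by
  obtain ⟨h, h2, h3⟩ := hs
  have h0 : s ≠ 0 := by rintro rfl; simp at h2
  have h1 : s ≠ 1 := by rintro rfl; simp at h3
  rw [zeta_eq_xiF h0 h1] at h
  rcases mul_eq_zero.1 h with h | h
  · exact h
  · exfalso
    have : s - 1 ≠ 0 := sub_ne_zero.2 h1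
    have := Gammaℝ_ne_zero_of_re_pos h2
    simp_all

lemma nontriv_iff (hRH : RiemannHypothesis) {s : ℂ} : ZetaNontrivZero s ↔ xiF s = 0 := by
  refine ⟨xiF_of_nontriv, fun h => ?_⟩
  have hr := xiF_zero_re hRH h
  have h0 : s ≠ 0 := by rintro rfl; rw [xiF_zero] at h; exact one_ne_zero h
  have h1 : s ≠ 1 := by rintro rfl; rw [xiF_one] at h; exact one_ne_zero h
  refine ⟨?_, by rw [hr]; norm_num, by rw [hr]; norm_num⟩
  rw [zeta_eq_xiF h0 h1, h, zero_mul]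

lemma xiF_order_ne_top (s : ℂ) : analyticOrderAt xiF s ≠ ⊤ := by
  have hA : AnalyticOnNhd ℂ xiF univ := fun z _ => xiF_diff.analyticAt z
  refine hA.analyticOrderAt_ne_top_of_isPreconnected isPreconnected_univ (mem_univ 0)
      (mem_univ s) ?_
  rw [(xiF_diff.analyticAt 0).analyticOrderAt_eq_zero.2 (by rw [xiF_zero]; exact one_ne_zero)]; simp

lemma zetaMult_eq {s : ℂ} (hs : ZetaNontrivZero s) : zetaMult s = analyticOrderNatAt xiF s := by
  obtain ⟨h, h2, h3⟩ := hs
  have h0 : s ≠ 0 := by rintro rfl; simp at h2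
  have h1 : s ≠ 1 := by rintro rfl; simp at h3
  have hs1 : s - 1 ≠ 0 := sub_ne_zero.2 h1
  have han : AnalyticAt ℂ (fun s : ℂ => (Gammaℝ s)⁻¹ * (s * (s - 1))⁻¹) s := by
    refine (differentiable_Gammaℝ_inv.analyticAt s).mul ?_
    refine AnalyticAt.inv (by fun_prop) (mul_ne_zero h0 hs1)
  have hev : riemannZeta =ᶠ[nhds s] (xiF * fun s : ℂ => (Gammaℝ s)⁻¹ * (s * (s - 1))⁻¹) := by
    filter_upwards [isOpen_ne.mem_nhds h0, isOpen_ne.mem_nhds h1] with z hz0 hz1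
    exact zeta_eq_xiF hz0 hz1
  have hzan : AnalyticAt ℂ riemannZeta s := ((xiF_diff.analyticAt s).mul han).congr hev.symm
  have hord : analyticOrderAt riemannZeta s = analyticOrderAt xiF s := by
    rw [analyticOrderAt_congr hev, analyticOrderAt_mul (xiF_diff.analyticAt s) han]
    rw [han.analyticOrderAt_eq_zero.2 ?_, add_zero]
    exact mul_ne_zero (inv_ne_zero (Gammaℝ_ne_zero_of_re_pos h2)) (inv_ne_zero (mul_ne_zero h0 hs1))
  set d := analyticOrderNatAt xiF s with hd
  have hd' : analyticOrderAt riemannZeta s = (d : ℕ∞) := by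
    rw [hord, hd, Nat.cast_analyticOrderNatAt (xiF_order_ne_top s)]
  have key : ∀ n : ℕ, n ≤ d ↔ ∀ i < n, iteratedDeriv i riemannZeta s = 0 := by
    intro n
    rw [← natCast_le_analyticOrderAt_iff_iteratedDeriv_eq_zero hzan, hd', Nat.cast_le]
  have hmem : d ∈ {n : ℕ | iteratedDeriv n riemannZeta s ≠ 0} := by
    intro hc
    have := (key (d+1)).2 (fun i hi => by
      rcases Nat.lt_succ_iff_lt_or_eq.1 hi with hi | hi
      · exact (key d).1 le_rfl i hi
      · rw [hi]; exact hc)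
    omega
  rw [zetaMult]
  refine le_antisymm (Nat.sInf_le hmem) ?_
  refine le_csInf ⟨d, hmem⟩ fun n hn => ?_
  by_contra hlt
  push Not at hlt
  exact hn ((key d).1 le_rfl n hlt)

/-- multiplicity of `1/2 + iγ` -/
def zm (γ : ℝ) : ℕ := analyticOrderNatAt xiF (1 / 2 + γ * I)

lemma zm_neg (γ : ℝ) : zm (-γ) = zm γ := by
  have h : analyticOrderAt (xiF ∘ fun s => 1 - s) (1/2 + γ * I) = analyticOrderAt xiF (1 - (1/2 + γ * I)) :=
    analyticOrderAt_comp_of_deriv_ne_zero (by fun_prop) (by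
      have : HasDerivAt (fun s : ℂ => 1 - s) (-1) (1/2 + γ * I) := by
        simpa using (hasDerivAt_id (1/2 + γ * I : ℂ)).const_sub 1
      rw [this.deriv]; norm_num)
  have h2 : (xiF ∘ fun s => 1 - s) = xiF := funext fun s => xiF_one_sub s
  rw [h2] at h
  rw [zm, zm, analyticOrderNatAt, analyticOrderNatAt, h]
  congr 3
  push_cast; ring

lemma half_inj : Function.Injective (fun γ : ℝ => (1/2 + γ * I : ℂ)) := by
  intro a b h
  have := congrArg Complex.im h
  simpa using this

lemma norm_half_sq (γ : ℝ) : ‖(1/2 + γ * I : ℂ)‖ ^ 2 = 1/4 + γ ^ 2 := by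
  rw [Complex.sq_norm, Complex.normSq_apply]
  simp; ring

lemma zm_summable : Summable (fun γ : ℝ => (zm γ : ℝ) / (1 + γ ^ 2)) := by
  obtain ⟨C, hC⟩ := xiF_growth
  have h1 := summable_ord xiF_diff (by rw [xiF_zero]; exact one_ne_zero) hC
  have h2 := (h1.comp_injective half_inj).mul_left 2
  refine Summable.of_nonneg_of_le (fun _ => by positivity) (fun γ => ?_) h2
  simp only [Function.comp, norm_half_sq]
  change _ ≤ 2 * ((zm γ : ℝ) / _)
  rw [mul_div_assoc', div_le_div_iff₀ (by positivity) (by positivity)]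
  have : (0:ℝ) ≤ zm γ := by positivity
  nlinarith [mul_nonneg this (sq_nonneg γ)]

lemma eq_half_of_zero (hRH : RiemannHypothesis) {s : ℂ} (hs : xiF s = 0) : s = 1/2 + (s.im : ℝ) * I := by
  apply Complex.ext
  · simp [xiF_zero_re hRH hs]
  · simp

lemma logDeriv_xiF_one_sub (s : ℂ) : logDeriv xiF (1 - s) = - logDeriv xiF s := by
  have h2 : (fun s => xiF (1 - s)) = xiF := funext fun s => xiF_one_sub s
  have h3 : deriv xiF s = - deriv xiF (1 - s) := by
    conv_lhs => rw [← h2]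
    rw [deriv_comp_const_sub]
  rw [logDeriv_apply, logDeriv_apply, h3, xiF_one_sub]
  ring

lemma hasSum_zm (hRH : RiemannHypothesis) {p : ℂ} (hp : 0 < p.re) :
    HasSum (fun γ : ℝ => (zm γ : ℂ) * ((p - γ * I)⁻¹ + (p + γ * I)⁻¹))
      (2 * logDeriv xiF (1/2 + p)) := by
  obtain ⟨C, hC⟩ := xiF_growth
  have h1 : xiF (1/2 + p) ≠ 0 := by
    intro h
    have := xiF_zero_re hRH h
    simp at this; linarith
  have h2 : xiF (1/2 - p) ≠ 0 := by
    intro h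
    have := xiF_zero_re hRH h
    simp at this; linarith
  have h3 := hasSum_logDeriv xiF_diff (by rw [xiF_zero]; exact one_ne_zero) hC h1 h2
  have h4 : logDeriv xiF (1/2 - p) = - logDeriv xiF (1/2 + p) := by
    rw [← logDeriv_xiF_one_sub]; congr 1; ring
  rw [h4] at h3
  rw [← half_inj.hasSum_iff] at h3
  · convert h3 using 1
    · ext γ
      simp only [Function.comp]
      change _ = (zm γ : ℂ) * _
      congr 1
      have e1 : 1/2 + p - (1/2 + γ * I) = p - γ * I := by ring
      have e2 : 1/2 - p - (1/2 + γ * I) = -(p + γ * I) := by ring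
      rw [e1, e2, inv_neg, sub_neg_eq_add]
    · ring
  · intro s hs
    have : xiF s ≠ 0 := by
      intro h
      exact hs ⟨s.im, (eq_half_of_zero hRH h).symm⟩
    simp [ord_eq_zero this]

/-- ordinates of zeros in `(0,T]` -/
lemma ordinates_finite (T : ℝ) : {γ : ℝ | xiF (1/2 + γ * I) = 0 ∧ 0 < γ ∧ γ ≤ T}.Finite := by
  have h1 := zeros_finite xiF_diff (by rw [xiF_zero]; exact one_ne_zero) (1 + |T|)
  refine (h1.preimage half_inj.injOn).subset ?_
  rintro γ ⟨h, h2, h3⟩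
  refine ⟨h, ?_⟩
  calc ‖(1/2 + γ * I : ℂ)‖ ≤ ‖(1/2:ℂ)‖ + ‖(γ * I : ℂ)‖ := norm_add_le _ _
    _ = 1/2 + γ := by simp [abs_of_pos h2]
    _ ≤ _ := by linarith [le_abs_self T]

def ZT (T : ℝ) : Finset ℝ := (ordinates_finite T).toFinset

lemma mem_ZT {T γ : ℝ} : γ ∈ ZT T ↔ xiF (1/2 + γ * I) = 0 ∧ 0 < γ ∧ γ ≤ T := by
  simp [ZT]

lemma zm_pos {γ : ℝ} (h : xiF (1/2 + γ * I) = 0) : 1 ≤ zm γ :=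
  Nat.one_le_iff_ne_zero.2 (ord_ne_zero xiF_diff (by rw [xiF_zero]; exact one_ne_zero) h)

lemma NofT_eq (hRH : RiemannHypothesis) (T : ℝ) : NofT T = ∑ γ ∈ ZT T, (zm γ : ℝ) := by
  rw [NofT, ← Finset.tsum_subtype]
  let e : {γ // γ ∈ ZT T} ≃ zerosUpTo T :=
    { toFun := fun γ => ⟨1/2 + (γ:ℝ) * I, (nontriv_iff hRH).2 (mem_ZT.1 γ.2).1, 
        by simpa using (mem_ZT.1 γ.2).2⟩
      invFun := fun s => ⟨(s:ℂ).im, mem_ZT.2 ⟨by 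
        rw [← eq_half_of_zero hRH (xiF_of_nontriv s.2.1)]; exact xiF_of_nontriv s.2.1, s.2.2⟩⟩
      left_inv := fun γ => by simp
      right_inv := fun s => by
        apply Subtype.ext
        exact (eq_half_of_zero hRH (xiF_of_nontriv s.2.1)).symm }
  rw [← e.tsum_eq]
  refine tsum_congr fun γ => ?_
  have : zetaMult (e γ : ℂ) = zm γ := zetaMult_eq (e γ).2.1
  rw [this]

lemma NsofT_eq (hRH : RiemannHypothesis) (T : ℝ) :
    NsofT T = ∑ γ ∈ ZT T with zm γ = 1, (1 : ℝ) := by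
  rw [NsofT, ← Finset.tsum_subtype]
  have hz : ∀ γ : ℝ, γ ∈ ZT T → zetaMult (1/2 + γ * I) = zm γ := fun γ h => 
    zetaMult_eq ((nontriv_iff hRH).2 (mem_ZT.1 h).1)
  let e : {γ // γ ∈ (ZT T).filter (fun γ => zm γ = 1)} ≃ {ρ : ℂ // ρ ∈ zerosUpTo T ∧ zetaMult ρ = 1} :=
    { toFun := fun γ => ⟨1/2 + (γ:ℝ) * I, ⟨(nontriv_iff hRH).2 (mem_ZT.1 (Finset.mem_filter.1 γ.2).1).1, 
        by simpa using (mem_ZT.1 (Finset.mem_filter.1 γ.2).1).2⟩, 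
        by rw [hz _ (Finset.mem_filter.1 γ.2).1]; exact (Finset.mem_filter.1 γ.2).2⟩
      invFun := fun s => ⟨(s:ℂ).im, Finset.mem_filter.2 ⟨mem_ZT.2 ⟨by 
        rw [← eq_half_of_zero hRH (xiF_of_nontriv s.2.1.1)]; exact xiF_of_nontriv s.2.1.1, s.2.1.2⟩, by
        have h := s.2.2
        rw [zetaMult_eq s.2.1.1, eq_half_of_zero hRH (xiF_of_nontriv s.2.1.1)] at h
        exact h⟩⟩
      left_inv := fun γ => by simp
      right_inv := fun s => by
        apply Subtype.ext
        exact (eq_half_of_zero hRH (xiF_of_nontriv s.2.1.1)).symm }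
  rw [← e.tsum_eq]

/-- combinatorial core -/
lemma NsofT_ge (hRH : RiemannHypothesis) (T : ℝ) :
    2 * NofT T - ∑ γ ∈ ZT T, (zm γ : ℝ) ^ 2 ≤ NsofT T := by
  rw [NofT_eq hRH, NsofT_eq hRH, Finset.mul_sum, ← Finset.sum_sub_distrib, Finset.sum_filter]
  refine Finset.sum_le_sum fun γ hγ => ?_
  have h1 := zm_pos (mem_ZT.1 hγ).1
  split_ifs with h
  · rw [h]; norm_num
  · have h2 : (2:ℝ) ≤ zm γ := by exact_mod_cast (by omega : 2 ≤ zm γ)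
    nlinarith

/-- Gaussian test function -/
def gG (a : ℝ) (b d p : ℂ) : ℂ := cexp (a * p ^ 2 + b * p + d)

lemma gG_neg (a : ℝ) (b d p : ℂ) : gG a b d (-p) = gG a (-b) d p := by
  rw [gG, gG]; congr 1; ring

lemma gG_line (a : ℝ) (b d : ℂ) (c y : ℝ) : gG a b d (c + y * I) =
    cexp (-(a:ℂ) * y ^ 2 + (I * (2 * a * c + b)) * y + (a * c ^ 2 + b * c + d)) := by
  rw [gG]; congr 1
  linear_combination (a * y ^ 2 : ℂ) * I_sq

lemma gG_integrable {a : ℝ} (ha : 0 < a) (b d : ℂ) (c : ℝ) :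
    Integrable (fun y : ℝ => gG a b d (c + y * I)) := by
  simp_rw [gG_line]
  exact integrable_cexp_quadratic (by simpa using ha) _ _

lemma gG_continuous (a : ℝ) (b d : ℂ) : Continuous (gG a b d) := by
  unfold gG; fun_prop

lemma cpow_half {x : ℝ} (hx : 0 ≤ x) : ((x : ℂ)) ^ (1/2 : ℂ) = (√x : ℝ) := by
  rw [Real.sqrt_eq_rpow, Complex.ofReal_cpow hx]; norm_num

lemma gG_integral {a : ℝ} (ha : 0 < a) (b d : ℂ) (c : ℝ) :
    ∫ y : ℝ, gG a b d (c + y * I) = (√(π/a) : ℝ) * cexp (d - b ^ 2 / (4 * a)) := by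
  simp_rw [gG_line]
  rw [integral_cexp_quadratic (by simpa using ha)]
  have ha' : (a:ℂ) ≠ 0 := by exact_mod_cast ha.ne'
  congr 1
  · rw [← cpow_half (by positivity)]; push_cast; rw [neg_neg]
  · congr 1
    rw [mul_pow, I_sq]
    field_simp
    ring

lemma gG_weight_integrable {a : ℝ} (ha : 0 < a) (b d : ℂ) (c : ℝ) :
    Integrable (fun y : ℝ => ‖gG a b d (c + y * I)‖ * (1 + y ^ 2) ^ 2) := by
  have h2 : 0 < a / 2 := by positivity
  have hi := ((integrable_cexp_quadratic (b := ((a/2 : ℝ) : ℂ)) (by simpa using h2)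
    (I * (2 * a * c + b)) (a * c ^ 2 + b * c + d)).norm).const_mul (8 / a ^ 2 * Real.exp (a/2))
  refine hi.mono' ?_ (Eventually.of_forall fun y => ?_)
  · refine Continuous.aestronglyMeasurable ?_
    have := gG_continuous a b d
    fun_prop
  · rw [Real.norm_of_nonneg (by positivity), gG_line]
    have h3 : (1 + y ^ 2) ^ 2 ≤ 8 / a ^ 2 * Real.exp (a/2) * Real.exp (a/2 * y ^ 2) := by
      have := Real.pow_div_factorial_le_exp (a/2 * (1 + y ^ 2)) (by positivity) 2
      rw [mul_assoc, ← Real.exp_add]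
      have e : a/2 + a/2*y^2 = a/2 * (1 + y^2) := by ring
      rw [e]
      calc (1 + y ^ 2) ^ 2 = 8 / a ^ 2 * ((a/2 * (1 + y ^ 2)) ^ 2 / (Nat.factorial 2 : ℕ)) := by
            simp [Nat.factorial]; field_simp; ring
        _ ≤ _ := by gcongr
    have h4 : ‖cexp (-(a:ℂ) * y ^ 2 + (I * (2 * a * c + b)) * y + (a * c ^ 2 + b * c + d))‖ *
        Real.exp (a/2 * y ^ 2) = ‖cexp (-((a/2 : ℝ):ℂ) * y ^ 2 + (I * (2 * a * c + b)) * y + (a * c ^ 2 + b * c + d))‖ := by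
      have : Real.exp (a/2 * y ^ 2) = ‖cexp (((a/2*y^2 : ℝ)) : ℂ)‖ := by
        rw [← Complex.ofReal_exp, Complex.norm_real, Real.norm_of_nonneg (Real.exp_pos _).le]
      rw [this, ← norm_mul, ← Complex.exp_add]
      congr 2; push_cast; ring
    rw [← h4]
    calc _ ≤ ‖cexp (-(a:ℂ) * y ^ 2 + (I * (2 * a * c + b)) * y + (a * c ^ 2 + b * c + d))‖ * (8 / a ^ 2 * Real.exp (a/2) * Real.exp (a/2 * y ^ 2)) := by gcongr
      _ = _ := by ring

/-- multiply by polynomially bounded continuous function -/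
lemma gG_mul_integrable {a : ℝ} (ha : 0 < a) (b d : ℂ) (c : ℝ) {h : ℝ → ℂ} (hh : AEStronglyMeasurable h volume)
    {C : ℝ} (hb : ∀ y, ‖h y‖ ≤ C * (1 + y ^ 2) ^ 2) :
    Integrable (fun y : ℝ => gG a b d (c + y * I) * h y) := by
  refine ((gG_weight_integrable ha b d c).const_mul C).mono' ?_ (Eventually.of_forall fun y => ?_)
  · refine AEStronglyMeasurable.mul (Continuous.aestronglyMeasurable ?_) hh
    have := gG_continuous a b d
    fun_prop
  · rw [norm_mul]
    calc _ ≤ ‖gG a b d (c + y * I)‖ * (C * (1 + y ^ 2) ^ 2) := by gcongr; exact hb y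
      _ = _ := by ring

lemma gG_div_integral {a : ℝ} (ha : 0 < a) (b d : ℂ) {c : ℝ} {p0 : ℂ} (hp : p0.re < c) :
    ∫ y : ℝ, gG a b d (c + y * I) * (c + y * I - p0)⁻¹ =
      (√(π/a) : ℝ) * ∫ x in Ioi (0:ℝ), cexp (d - (b - x) ^ 2 / (4 * a) + p0 * x) := by
  have h1 : ∀ y : ℝ, gG a b d (c + y * I) * (c + y * I - p0)⁻¹ =
      ∫ x in Ioi (0:ℝ), gG a b d (c + y * I) * cexp ((p0 - (c + y * I)) * x) := by
    intro y
    have hre : (p0 - (c + y * I)).re < 0 := by simp; linarith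
    rw [integral_const_mul, integral_exp_mul_complex_Ioi hre]
    congr 1
    rw [Complex.ofReal_zero, mul_zero, Complex.exp_zero, ← neg_sub p0, inv_neg, neg_div, one_div]
  simp_rw [h1]
  rw [integral_integral_swap]
  · rw [← integral_const_mul]
    refine integral_congr_ae (Eventually.of_forall fun x => ?_)
    have h2 : ∀ y : ℝ, gG a b d (c + y * I) * cexp ((p0 - (c + y * I)) * x) =
        cexp (p0 * x) * gG a (b - x) d (c + y * I) := by
      intro y
      rw [gG, gG, ← Complex.exp_add, ← Complex.exp_add]; congr 1; ring
    simp only [h2]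
    rw [integral_const_mul, gG_integral ha, add_comm, Complex.exp_add]
    ring
  · have hi := (gG_integrable ha b d c).mul_prod (integrableOn_exp_mul_complex_Ioi (a := p0 - c) (by simp; linarith) 0)
    refine hi.mono ?_ (Eventually.of_forall fun z => ?_)
    · refine Continuous.aestronglyMeasurable ?_
      have := gG_continuous a b d
      unfold Function.uncurry
      fun_prop
    · simp only [Function.uncurry, norm_mul, Complex.norm_exp]
      apply le_of_eq
      congr 2
      simp

lemma gG_pole {a : ℝ} (ha : 0 < a) (b d : ℂ) {c : ℝ} {p0 : ℂ} (hp : |p0.re| < c) :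
    (∫ y : ℝ, gG a b d (c + y * I) * (c + y * I - p0)⁻¹) +
    (∫ y : ℝ, gG a b d (-(c + y * I)) * (c + y * I + p0)⁻¹) = 2 * π * gG a b d p0 := by
  obtain ⟨hp1, hp2⟩ := abs_lt.1 hp
  have ha' : (a:ℂ) ≠ 0 := by exact_mod_cast ha.ne'
  simp_rw [gG_neg]
  have h2 := gG_div_integral ha (-b) d (c := c) (p0 := -p0) (by simp; linarith)
  simp_rw [sub_neg_eq_add] at h2
  rw [gG_div_integral ha b d hp2, h2, ← mul_add]
  have hq : ∀ x : ℝ, cexp (d - (b - x) ^ 2 / (4 * a) + p0 * x) =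
      cexp (-(((4 * a)⁻¹ : ℝ) : ℂ) * x ^ 2 + (b / (2 * a) + p0) * x + (d - b ^ 2 / (4 * a))) := by
    intro x; congr 1; push_cast; field_simp; ring
  have h3 : ∫ x in Ioi (0:ℝ), cexp (d - (-b - x) ^ 2 / (4 * a) + -p0 * x) =
      ∫ x in Iic (0:ℝ), cexp (d - (b - x) ^ 2 / (4 * a) + p0 * x) := by
    have := integral_comp_neg_Ioi 0 (fun x : ℝ => cexp (d - (b - x) ^ 2 / (4 * a) + p0 * x))
    rw [neg_zero] at this
    rw [← this]
    refine integral_congr_ae (Eventually.of_forall fun x => ?_)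
    simp only
    congr 1; push_cast; ring
  have h4a : 0 < (4 * a)⁻¹ := by positivity
  have hintg : Integrable (fun x : ℝ => cexp (d - (b - x) ^ 2 / (4 * a) + p0 * x)) := by
    simp_rw [hq]
    exact integrable_cexp_quadratic (by rw [Complex.ofReal_re]; exact h4a) _ _
  rw [h3, add_comm (∫ x in Ioi (0:ℝ), _), intervalIntegral.integral_Iic_add_Ioi hintg.integrableOn hintg.integrableOn]
  simp_rw [hq]
  rw [integral_cexp_quadratic (by rw [Complex.neg_re, Complex.ofReal_re]; linarith)]
  have e1 : ((π:ℂ) / - -(((4 * a)⁻¹ : ℝ) : ℂ)) = ((π * (4 * a) : ℝ) : ℂ) := by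
    push_cast; rw [neg_neg]; field_simp
  rw [e1, cpow_half (by positivity), ← mul_assoc, ← Complex.ofReal_mul, ← Real.sqrt_mul (by positivity)]
  have e2 : π / a * (π * (4 * a)) = (2 * π) ^ 2 := by field_simp; ring
  rw [e2, Real.sqrt_sq (by positivity), gG]
  push_cast
  congr 2
  field_simp
  ring

lemma gG_swap {a : ℝ} (ha : 0 < a) (b d : ℂ) (c : ℝ) {ι : Type*} {F : ι → ℝ → ℂ} {w : ι → ℝ} (hw : Summable w)
    (hF : ∀ i, AEStronglyMeasurable (F i) volume) (hb : ∀ i y, ‖F i y‖ ≤ w i * (1 + y ^ 2) ^ 2) :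
    HasSum (fun i => ∫ y : ℝ, gG a b d (c + y * I) * F i y)
      (∫ y : ℝ, gG a b d (c + y * I) * ∑' i, F i y) := by
  have hz : ∀ i, w i = 0 → ∀ y, F i y = 0 := by
    intro i hi y
    have := hb i y
    rw [hi, zero_mul] at this
    exact norm_le_zero_iff.1 this
  have hwn : ∀ i, 0 ≤ w i := fun i => by
    have := (norm_nonneg _).trans (hb i 0)
    simpa using this
  have hc : Countable (Function.support w) := hw.countable_support
  have hintg : ∀ i, Integrable (fun y : ℝ => gG a b d (c + y * I) * F i y) := fun i =>
    gG_mul_integrable ha b d c (hF i) (hb i)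
  rw [← hasSum_subtype_iff_of_support_subset (s := Function.support w)]
  · have h2 : ∀ y, ∑' i, F i y = ∑' i : Function.support w, F i y := by
      intro y
      symm
      apply tsum_subtype_eq_of_support_subset (s := Function.support w) (f := fun i => F i y)
      intro i hi hi'
      exact hi (hz i hi' y)
    simp_rw [h2, ← tsum_mul_left]
    refine hasSum_integral_of_summable_integral_norm (F := fun (i : Function.support w) (y : ℝ) =>
      gG a b d (c + y * I) * F i y) (fun i => hintg i) ?_
    refine Summable.of_nonneg_of_le (fun i => integral_nonneg fun _ => norm_nonneg _) (fun i => ?_)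
      (((hw.comp_injective Subtype.val_injective).mul_right
        (∫ y : ℝ, ‖gG a b d (c + y * I)‖ * (1 + y ^ 2) ^ 2)) : Summable fun i : Function.support w => _)
    simp only [Function.comp]
    rw [← integral_const_mul]
    refine integral_mono (hintg i).norm ((gG_weight_integrable ha b d c).const_mul _) fun y => ?_
    simp only [norm_mul]
    calc ‖gG a b d (c + y * I)‖ * ‖F i y‖ ≤ ‖gG a b d (c + y * I)‖ * (w i * (1 + y ^ 2) ^ 2) :=
          mul_le_mul_of_nonneg_left (hb i y) (norm_nonneg _)
      _ = _ := by ring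
  · intro i hi hi'
    apply hi
    simp [hz i hi']

lemma two_inv_bound (y γ : ℝ) : ‖((1:ℝ) + y * I - γ * I : ℂ)⁻¹ + ((1:ℝ) + y * I + γ * I : ℂ)⁻¹‖ ≤
    4 * (1 + y ^ 2) ^ 2 / (1 + γ ^ 2) := by
  have hn : ∀ t : ℝ, ‖((1:ℝ) + t * I : ℂ)‖ = √(1 + t ^ 2) := by
    intro t; rw [Complex.norm_add_mul_I]; simp
  have h0 : ∀ t : ℝ, ((1:ℝ) + t * I : ℂ) ≠ 0 := by
    intro t h
    have := congrArg Complex.re h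
    simp at this
  have e1 : ((1:ℝ) + y * I - γ * I : ℂ) = (1:ℝ) + ((y - γ : ℝ):ℂ) * I := by push_cast; ring
  have e2 : ((1:ℝ) + y * I + γ * I : ℂ) = (1:ℝ) + ((y + γ : ℝ):ℂ) * I := by push_cast; ring
  have h1 : ((1:ℝ) + y * I - γ * I : ℂ)⁻¹ + ((1:ℝ) + y * I + γ * I : ℂ)⁻¹ =
      2 * ((1:ℝ) + y * I) / (((1:ℝ) + ((y - γ : ℝ):ℂ) * I) * ((1:ℝ) + ((y + γ : ℝ):ℂ) * I)) := by
    rw [e1, e2]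
    rw [inv_add_inv (h0 _) (h0 _)]
    congr 1
    push_cast
    ring
  rw [h1, norm_div, norm_mul, norm_mul, hn, hn, hn, ← Real.sqrt_mul (by positivity)]
  rw [div_le_div_iff₀ (by positivity) (by positivity)]
  simp only [Complex.norm_ofNat]
  have h3 : √(1 + y ^ 2) ≤ 1 + y ^ 2 := by
    rw [Real.sqrt_le_left (by positivity)]
    nlinarith [sq_nonneg y]
  have h4 : (1 + γ ^ 2) / (2 * (1 + y ^ 2)) ≤ √((1 + (y - γ) ^ 2) * (1 + (y + γ) ^ 2)) := by
    apply Real.le_sqrt_of_sq_le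
    rw [div_pow]
    have a1 : 1 + γ ^ 2 ≤ 2 * (1 + y ^ 2) * (1 + (y - γ) ^ 2) := by nlinarith [sq_nonneg (2 * y - γ), sq_nonneg (y * (y - γ)), sq_nonneg (y-γ)]
    have a2 : 1 + γ ^ 2 ≤ 2 * (1 + y ^ 2) * (1 + (y + γ) ^ 2) := by nlinarith [sq_nonneg (2 * y + γ), sq_nonneg (y * (y + γ)), sq_nonneg (y+γ)]
    rw [div_le_iff₀ (by positivity)]
    calc (1 + γ ^ 2) ^ 2 = (1 + γ ^ 2) * (1 + γ ^ 2) := by ring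
      _ ≤ (2 * (1 + y ^ 2) * (1 + (y - γ) ^ 2)) * (2 * (1 + y ^ 2) * (1 + (y + γ) ^ 2)) := by gcongr
      _ = _ := by ring
  rw [div_le_iff₀ (by positivity)] at h4
  calc 2 * √(1 + y ^ 2) * (1 + γ ^ 2) ≤ 2 * (1 + y^2) * (√((1 + (y - γ) ^ 2) * (1 + (y + γ) ^ 2)) * (2 * (1 + y ^ 2))) := by gcongr
    _ = _ := by ring

lemma line_ne {c : ℝ} {p0 : ℂ} (hp : p0.re < c) (y : ℝ) : (c + y * I - p0 : ℂ) ≠ 0 := by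
  intro h
  have := congrArg Complex.re h
  simp at this
  linarith

lemma inv_line_meas {c : ℝ} {p0 : ℂ} (hp : p0.re < c) : Continuous (fun y : ℝ => (c + y * I - p0 : ℂ)⁻¹) :=
  Continuous.inv₀ (by fun_prop) (line_ne hp)

lemma inv_line_bound {c : ℝ} {p0 : ℂ} (hp : p0.re < c) (y : ℝ) :
    ‖(c + y * I - p0 : ℂ)⁻¹‖ ≤ (c - p0.re)⁻¹ * (1 + y ^ 2) ^ 2 := by
  have h1 : c - p0.re ≤ ‖(c + y * I - p0 : ℂ)‖ := by
    have := Complex.re_le_norm (c + y * I - p0 : ℂ)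
    simpa using this
  have h2 : 0 < c - p0.re := by linarith
  rw [norm_inv]
  calc ‖(c + y * I - p0 : ℂ)‖⁻¹ ≤ (c - p0.re)⁻¹ := by gcongr
    _ ≤ (c - p0.re)⁻¹ * (1 + y ^ 2) ^ 2 := by
      apply le_mul_of_one_le_right (by positivity)
      nlinarith [sq_nonneg y]

lemma gG_inv_integrable {a : ℝ} (ha : 0 < a) (b d : ℂ) {c : ℝ} {p0 : ℂ} (hp : p0.re < c) :
    Integrable (fun y : ℝ => gG a b d (c + y * I) * (c + y * I - p0)⁻¹) :=
  gG_mul_integrable ha b d c (inv_line_meas hp).aestronglyMeasurable (inv_line_bound hp)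

lemma gG_pair {a : ℝ} (ha : 0 < a) (b d : ℂ) {c : ℝ} {p0 : ℂ} (hp : |p0.re| < c) :
    (∫ y : ℝ, gG a b d (c + y * I) * ((c + y * I - p0)⁻¹ + (c + y * I + p0)⁻¹)) +
    (∫ y : ℝ, gG a (-b) d (c + y * I) * ((c + y * I - p0)⁻¹ + (c + y * I + p0)⁻¹)) =
      2 * π * (gG a b d p0 + gG a b d (-p0)) := by
  obtain ⟨hp1, hp2⟩ := abs_lt.1 hp
  have i1 : ∀ b, Integrable (fun y : ℝ => gG a b d (c + y * I) * (c + y * I - p0)⁻¹) := fun b =>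
    gG_inv_integrable ha b d hp2
  have i2 : ∀ b, Integrable (fun y : ℝ => gG a b d (c + y * I) * (c + y * I + p0)⁻¹) := fun b => by
    have := gG_inv_integrable ha b d (c := c) (p0 := -p0) (by simp; linarith)
    simpa using this
  have h1 := gG_pole ha b d hp
  have h2 := gG_pole ha b d (c := c) (p0 := -p0) (by simpa using hp)
  simp_rw [gG_neg a b d (_ + _)] at h1 h2
  simp only [sub_neg_eq_add, ← sub_eq_add_neg] at h2
  simp_rw [mul_add]
  rw [integral_add (i1 b) (i2 b), integral_add (i1 (-b)) (i2 (-b))]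
  linear_combination h1 + h2

lemma gG_imag_bound {a : ℝ} (ha : 0 < a) (b d : ℂ) : ∃ C, 0 ≤ C ∧ ∀ y : ℝ, ‖gG a b d (y * I)‖ ≤ C / (1 + y ^ 2) := by
  refine ⟨Real.exp (d.re + b.im ^ 2 / (2 * a)) * (2 / a + 1), by positivity, fun y => ?_⟩
  rw [gG, Complex.norm_exp]
  have hre : ((a:ℂ) * (y * I) ^ 2 + b * (y * I) + d).re = - a * y ^ 2 - b.im * y + d.re := by
    simp [pow_two]
    ring
  rw [hre]
  have h1 : - a * y ^ 2 - b.im * y + d.re ≤ (d.re + b.im ^ 2 / (2 * a)) + - (a / 2 * y ^ 2) := by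
    have : b.im ^ 2 / (2 * a) = a / 2 * (b.im / a) ^ 2 := by field_simp
    rw [this]
    have e : b.im = a * (b.im / a) := by field_simp
    have : a * ((y + b.im / a) ^ 2) ≥ 0 := by positivity
    generalize b.im / a = t at *
    rw [e]
    nlinarith
  have h2 : Real.exp (-(a / 2 * y ^ 2)) ≤ (2 / a + 1) / (1 + y ^ 2) := by
    rw [Real.exp_neg, inv_eq_one_div, div_le_div_iff₀ (Real.exp_pos _) (by positivity)]
    have := Real.add_one_le_exp (a / 2 * y ^ 2)
    calc 1 * (1 + y ^ 2) ≤ (2 / a + 1) * (a / 2 * y ^ 2 + 1) := by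
          have : (2 / a + 1) * (a / 2 * y ^ 2 + 1) = y ^ 2 + 2 / a + a / 2 * y ^ 2 + 1 := by field_simp; ring
          rw [this]
          have : 0 ≤ 2 / a + a / 2 * y ^ 2 := by positivity
          linarith
      _ ≤ _ := by gcongr
  calc _ ≤ Real.exp ((d.re + b.im ^ 2 / (2 * a)) + - (a / 2 * y ^ 2)) := Real.exp_le_exp.2 h1
    _ = Real.exp (d.re + b.im ^ 2 / (2 * a)) * Real.exp (- (a / 2 * y ^ 2)) := Real.exp_add _ _
    _ ≤ Real.exp (d.re + b.im ^ 2 / (2 * a)) * ((2 / a + 1) / (1 + y ^ 2)) := by gcongr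
    _ = _ := by ring

lemma summable_zm_gG {a : ℝ} (ha : 0 < a) (b d : ℂ) : Summable (fun γ : ℝ => (zm γ : ℂ) * gG a b d (γ * I)) := by
  obtain ⟨C, hC, h⟩ := gG_imag_bound ha b d
  refine Summable.of_norm_bounded (zm_summable.mul_left C) fun γ => ?_
  rw [norm_mul, Complex.norm_natCast]
  calc (zm γ : ℝ) * ‖gG a b d (γ * I)‖ ≤ zm γ * (C / (1 + γ ^ 2)) := by gcongr; exact h γ
    _ = _ := by ring

theorem zeros_side (hRH : RiemannHypothesis) {a : ℝ} (ha : 0 < a) (b d : ℂ) :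
    (∫ y : ℝ, gG a b d ((1:ℝ) + y * I) * logDeriv xiF (1/2 + ((1:ℝ) + y * I))) +
    (∫ y : ℝ, gG a (-b) d ((1:ℝ) + y * I) * logDeriv xiF (1/2 + ((1:ℝ) + y * I))) =
      2 * π * ∑' γ : ℝ, (zm γ : ℂ) * gG a b d (γ * I) := by
  set F : ℝ → ℝ → ℂ := fun γ y => (zm γ : ℂ) * (((1:ℝ) + y * I - γ * I)⁻¹ + ((1:ℝ) + y * I + γ * I)⁻¹) with hF
  have hsum : ∀ y : ℝ, ∑' γ : ℝ, F γ y = 2 * logDeriv xiF (1/2 + ((1:ℝ) + y * I)) := fun y =>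
    (hasSum_zm hRH (p := (1:ℝ) + y * I) (by simp)).tsum_eq
  have key : ∀ b, HasSum (fun γ : ℝ => ∫ y : ℝ, gG a b d ((1:ℝ) + y * I) * F γ y)
      (∫ y : ℝ, gG a b d ((1:ℝ) + y * I) * (2 * logDeriv xiF (1/2 + ((1:ℝ) + y * I)))) := by
    intro b
    simp_rw [← hsum]
    refine gG_swap ha b d 1 (zm_summable.mul_left 4) (fun γ => ?_) (fun γ y => ?_)
    · refine Continuous.aestronglyMeasurable (continuous_const.mul (Continuous.add ?_ ?_))
      · exact inv_line_meas (c := 1) (p0 := γ * I) (by simp)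
      · have := inv_line_meas (c := 1) (p0 := -(γ * I)) (by simp)
        simpa using this
    · rw [hF]
      simp only [norm_mul, Complex.norm_natCast]
      calc _ ≤ (zm γ : ℝ) * (4 * (1 + y ^ 2) ^ 2 / (1 + γ ^ 2)) := by gcongr; exact two_inv_bound y γ
        _ = _ := by ring
  have h1 := (key b).add (key (-b))
  have h2 : ∀ γ : ℝ, (∫ y : ℝ, gG a b d ((1:ℝ) + y * I) * F γ y) + (∫ y : ℝ, gG a (-b) d ((1:ℝ) + y * I) * F γ y) =
      2 * π * ((zm γ : ℂ) * gG a b d (γ * I) + (zm (-γ) : ℂ) * gG a b d ((-γ : ℝ) * I)) := by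
    intro γ
    have := gG_pair ha b d (c := 1) (p0 := γ * I) (by simp)
    rw [zm_neg]
    simp only [hF]
    simp_rw [mul_left_comm _ (zm γ : ℂ)]
    rw [integral_const_mul, integral_const_mul, ← mul_add, this]
    push_cast
    rw [neg_mul]
    ring
  simp_rw [h2] at h1
  have h3 := (summable_zm_gG ha b d).hasSum
  have h4 := (Equiv.neg ℝ).hasSum_iff.2 h3
  have h5 := ((h3.add h4).mul_left (2 * π : ℂ)).unique h1
  simp_rw [mul_left_comm _ (2:ℂ)] at h5
  rw [integral_const_mul, integral_const_mul] at h5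
  linear_combination (-1/2 : ℂ) * h5

/-- tail of the digamma series -/
def qser (z : ℂ) : ℂ := ∑' n : ℕ, (((n:ℂ) + 1)⁻¹ - (z + (n + 1))⁻¹)

lemma norm_add_nat_ge {z : ℂ} (hz : 0 ≤ z.re) (n : ℕ) : (n:ℝ) + 1 ≤ ‖z + (n + 1)‖ := by
  have := Complex.re_le_norm (z + (n + 1))
  simp at this
  linarith

lemma qser_term_bound {z : ℂ} (hz : 0 ≤ z.re) (n : ℕ) :
    ‖((n:ℂ) + 1)⁻¹ - (z + (n + 1))⁻¹‖ ≤ ‖z‖ * (((n:ℝ) + 1) ^ 2)⁻¹ := by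
  have h1 := norm_add_nat_ge hz n
  have hn : (0:ℝ) < n + 1 := by positivity
  have h2 : z + (n + 1) ≠ 0 := by rw [← norm_pos_iff]; linarith
  have h3 : (n : ℂ) + 1 ≠ 0 := by exact_mod_cast n.succ_ne_zero
  have h4 : ((n:ℂ) + 1)⁻¹ - (z + (n + 1))⁻¹ = z * (((n:ℂ) + 1)⁻¹ * (z + (n + 1))⁻¹) := by
    field_simp; ring
  have h5 : ‖(n:ℂ) + 1‖ = n + 1 := by
    have : (n:ℂ) + 1 = ((n + 1 : ℝ) : ℂ) := by push_cast; rfl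
    rw [this, Complex.norm_real, Real.norm_of_nonneg hn.le]
  rw [h4, norm_mul, norm_mul, norm_inv, norm_inv, h5, pow_two, mul_inv]
  gcongr

lemma summable_inv_succ_sq : Summable (fun n : ℕ => (((n:ℝ) + 1) ^ 2)⁻¹) := by
  have := (summable_nat_add_iff 1).2 (Real.summable_nat_pow_inv.2 (one_lt_two))
  simpa using this

lemma qser_summable {z : ℂ} (hz : 0 ≤ z.re) : Summable (fun n : ℕ => (((n:ℂ) + 1)⁻¹ - (z + (n + 1))⁻¹)) :=
  Summable.of_norm_bounded (summable_inv_succ_sq.mul_left _) (qser_term_bound hz)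

lemma qser_diff : DifferentiableOn ℂ qser {z | 0 < z.re} := by
  intro z hz
  refine DifferentiableAt.differentiableWithinAt ?_
  have ho : IsOpen ({z : ℂ | 0 < z.re} ∩ Metric.ball 0 (‖z‖ + 1)) :=
    (isOpen_lt continuous_const Complex.continuous_re).inter Metric.isOpen_ball
  have hd : DifferentiableOn ℂ qser ({z : ℂ | 0 < z.re} ∩ Metric.ball 0 (‖z‖ + 1)) := by
    refine differentiableOn_tsum_of_summable_norm (summable_inv_succ_sq.mul_left (‖z‖ + 1)) (fun n => ?_) ho
      (fun n w hw => ?_)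
    · intro w hw
      have h1 := norm_add_nat_ge (z := w) (le_of_lt hw.1) n
      have hn : (0:ℝ) < n + 1 := by positivity
      have h2 : w + (n + 1) ≠ 0 := by rw [← norm_pos_iff]; linarith
      have h3 : DifferentiableAt ℂ (fun x : ℂ => x + ((n:ℂ) + 1)) w := by fun_prop
      exact ((differentiableAt_const _).sub (h3.inv h2)).differentiableWithinAt
    · refine (qser_term_bound (le_of_lt hw.1) n).trans ?_
      gcongr
      have := hw.2
      simp at this
      exact this.le
  exact hd.differentiableAt (ho.mem_nhds ⟨hz, by simp⟩)

lemma qser_add_one {z : ℂ} (hz : 0 ≤ z.re) : qser (z + 1) = qser z + (z + 1)⁻¹ := by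
  have hz1 : 0 ≤ (z + 1).re := by simp; linarith
  have h := (qser_summable hz1).hasSum.sub (qser_summable hz).hasSum
  have h2 : HasSum (fun n : ℕ => (z + (n + 1))⁻¹ - (z + ((n + 1 : ℕ) + 1))⁻¹) (qser (z+1) - qser z) := by
    have he : (fun n : ℕ => (z + ((n:ℂ) + 1))⁻¹ - (z + (((n + 1 : ℕ):ℂ) + 1))⁻¹) =
        fun n : ℕ => (((n:ℂ) + 1)⁻¹ - (z + 1 + (n + 1))⁻¹) - (((n:ℂ) + 1)⁻¹ - (z + (n + 1))⁻¹) := by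
      ext n
      push_cast
      ring
    rw [he]
    exact h

  have h3 := h2.tendsto_sum_nat
  simp_rw [Finset.sum_range_sub' (fun n : ℕ => (z + ((n:ℂ) + 1))⁻¹)] at h3
  have h4 : Tendsto (fun n : ℕ => (z + ((0:ℕ) + 1))⁻¹ - (z + ((n:ℂ) + 1))⁻¹) atTop (nhds ((z + ((0:ℕ) + 1))⁻¹ - 0)) := by
    refine tendsto_const_nhds.sub ?_
    rw [tendsto_zero_iff_norm_tendsto_zero]
    refine squeeze_zero (fun n => norm_nonneg _) (fun n => ?_) tendsto_one_div_add_atTop_nhds_zero_nat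
    rw [norm_inv, one_div]
    have := norm_add_nat_ge hz n
    gcongr
  have h5 := tendsto_nhds_unique h3 h4
  simp at h5
  linear_combination h5

lemma gamma_ne {z : ℂ} (hz : 0 < z.re) (m : ℕ) : z ≠ -m := by
  intro h
  have := congrArg Complex.re h
  simp at this
  have : (0:ℝ) ≤ m := by positivity
  linarith

lemma digamma_diff {z : ℂ} (hz : 0 < z.re) : DifferentiableAt ℂ Complex.digamma z := by
  have h1 : DifferentiableOn ℂ Complex.Gamma {z : ℂ | 0 < z.re} := fun w hw =>
    (Complex.differentiableAt_Gamma w (gamma_ne hw)).differentiableWithinAt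
  have ho : IsOpen {z : ℂ | 0 < z.re} := isOpen_lt continuous_const Complex.continuous_re
  have h2 := (h1.deriv ho).differentiableAt (ho.mem_nhds hz)
  rw [Complex.digamma_def]
  exact h2.div (h1.differentiableAt (ho.mem_nhds hz)) (Complex.Gamma_ne_zero (gamma_ne hz))

lemma digamma_real {x : ℝ} (hx : 0 < x) : Complex.digamma x = (deriv (Real.log ∘ Real.Gamma) x : ℝ) := by
  have hc := (Complex.differentiableAt_Gamma x (gamma_ne (by simpa using hx))).hasDerivAt.comp_ofReal
  have hr : DifferentiableAt ℝ Real.Gamma x := Real.differentiableAt_Gamma (fun m => by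
    have : (0:ℝ) ≤ m := by positivity
    linarith)
  have hr2 := hr.hasDerivAt.ofReal_comp
  have he : (fun y : ℝ => ((Real.Gamma y : ℝ) : ℂ)) = fun y : ℝ => Complex.Gamma y := by
    ext y; rw [Complex.Gamma_ofReal]
  rw [he] at hr2
  have h3 := hr2.unique hc
  have h4 : deriv (Real.log ∘ Real.Gamma) x = deriv Real.Gamma x / Real.Gamma x :=
    (hr.hasDerivAt.log (Real.Gamma_pos_of_pos hx).ne').deriv
  rw [h4, Complex.digamma_def, logDeriv_apply, ← h3, Complex.Gamma_ofReal]
  push_cast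
  rfl

lemma digamma_real_mono {x y : ℝ} (hx : 0 < x) (hxy : x ≤ y) :
    deriv (Real.log ∘ Real.Gamma) x ≤ deriv (Real.log ∘ Real.Gamma) y := by
  refine Real.convexOn_log_Gamma.monotoneOn_deriv ?_ hx (hx.trans_le hxy) hxy
  intro x hx
  have hr : DifferentiableAt ℝ Real.Gamma x := Real.differentiableAt_Gamma (fun m => by
    have : (0:ℝ) ≤ m := by positivity
    have : (0:ℝ) < x := hx
    linarith)
  exact hr.log (Real.Gamma_pos_of_pos hx).ne'

lemma qser_real {x : ℝ} (hx : 0 ≤ x) : qser x = ((∑' n : ℕ, (((n:ℝ) + 1)⁻¹ - (x + (n + 1))⁻¹) : ℝ) : ℂ) := by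
  rw [qser, Complex.ofReal_tsum]
  push_cast
  rfl

lemma qser_real_mono {x y : ℝ} (hx : 0 ≤ x) (hxy : x ≤ y) : (qser x).re ≤ (qser y).re := by
  have hs : ∀ x : ℝ, 0 ≤ x → Summable (fun n : ℕ => (((n:ℝ) + 1)⁻¹ - (x + (n + 1))⁻¹)) := by
    intro x hx
    have := qser_summable (z := x) (by simpa using hx)
    rw [← Complex.summable_ofReal]
    push_cast
    exact this
  rw [qser_real hx, qser_real (hx.trans hxy), Complex.ofReal_re, Complex.ofReal_re]
  refine Summable.tsum_le_tsum (fun n => ?_) (hs x hx) (hs y (hx.trans hxy))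
  have : 0 < x + ((n:ℝ) + 1) := by positivity
  gcongr

lemma digamma_series : ∃ κ : ℂ, ∀ z : ℂ, 0 < z.re → Complex.digamma z = κ - z⁻¹ + qser z := by
  set h : ℂ → ℂ := fun z => Complex.digamma z + z⁻¹ - qser z with hh
  have hper : ∀ z : ℂ, 0 < z.re → h (z + 1) = h z := by
    intro z hz
    simp only [hh]
    rw [qser_add_one hz.le, Complex.digamma_apply_add_one z (gamma_ne hz)]
    ring
  have hperN : ∀ (N : ℕ) (z : ℂ), 0 < z.re → h (z + N) = h z := by
    intro N z hz
    induction N with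
    | zero => simp
    | succ N ih =>
      push_cast
      rw [← add_assoc, hper _ (by simp; positivity), ih]
  have hre : ∀ x : ℝ, 0 < x → h x = ((h x).re : ℂ) := by
    intro x hx
    simp only [hh]
    rw [digamma_real hx, qser_real hx.le]
    norm_cast
  have hH : ∀ x : ℝ, 0 < x → (h x).re = deriv (Real.log ∘ Real.Gamma) (x+1) - (qser x).re := by
    intro x hx
    have := digamma_real (x := x + 1) (by positivity)
    push_cast at this
    rw [Complex.digamma_apply_add_one _ (gamma_ne (by simpa using hx))] at this
    simp only [hh]
    rw [this]
    simp
  have hconst : ∀ y : ℝ, 1 ≤ y → y ≤ 2 → h y = h 1 := by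
    intro y hy1 hy2
    have hh1 : h 1 = h ((1:ℝ):ℂ) := by simp
    rw [hh1, hre y (by linarith), hre 1 one_pos]
    congr 1
    have hb : ∀ N : ℕ, |(h y).re - (h (1:ℝ)).re| ≤ 1 / ((N:ℝ) + 1) := by
      intro N
      rw [← hperN N y (by simp; linarith), ← hperN N (1:ℝ) (by simp)]
      have e1 : (y:ℂ) + N = ((y + N : ℝ) : ℂ) := by push_cast; rfl
      have e2 : ((1:ℝ):ℂ) + N = ((1 + N : ℝ) : ℂ) := by push_cast; rfl
      have hN : (0:ℝ) ≤ N := by positivity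
      rw [e1, e2, hH _ (by linarith), hH _ (by linarith)]
      have d1 := digamma_real_mono (x := 1 + N + 1) (y := y + N + 1) (by linarith) (by linarith)
      have d2 := digamma_real_mono (x := y + N + 1) (y := 1 + N + 1 + 1) (by linarith) (by linarith)
      have q1 := qser_real_mono (x := 1 + N) (y := y + N) (by linarith) (by linarith)
      have q2 := qser_real_mono (x := y + N) (y := 1 + N + 1) (by linarith) (by linarith)
      have d3 : deriv (Real.log ∘ Real.Gamma) (1 + N + 1 + 1) = deriv (Real.log ∘ Real.Gamma) (1 + N + 1) + 1 / (1 + N + 1) := by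
        have a1 := digamma_real (x := 1 + N + 1 + 1) (by linarith)
        have a2 := digamma_real (x := 1 + N + 1) (by linarith)
        have a3 := Complex.digamma_apply_add_one ((1 + N + 1 : ℝ) : ℂ) (gamma_ne (by simp; linarith))
        rw [a2] at a3
        rw [Complex.ofReal_add (1 + N + 1 : ℝ) 1, Complex.ofReal_one, a3] at a1
        rw [one_div]
        exact_mod_cast a1.symm
      have q3 : (qser ((1 + N + 1 : ℝ):ℂ)).re = (qser ((1 + N : ℝ):ℂ)).re + 1 / (1 + N + 1) := by
        have a3 := qser_add_one (z := ((1 + N : ℝ) : ℂ)) (by simp; linarith)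
        rw [Complex.ofReal_add (1 + N) 1, Complex.ofReal_one, a3, Complex.add_re]
        congr 1
        have : (((1 + N : ℝ) : ℂ) + 1)⁻¹ = ((1 / (1 + N + 1) : ℝ) : ℂ) := by push_cast; rw [one_div]
        rw [this, Complex.ofReal_re]
      have f1 : (1:ℝ) / (1 + N + 1) ≤ 1 / (N + 1) := by
        apply one_div_le_one_div_of_le <;> linarith
      rw [d3] at d2
      rw [q3] at q2
      rw [abs_le]
      constructor <;> linarith
    have h0 : |(h y).re - (h (1:ℝ)).re| ≤ 0 :=
      ge_of_tendsto tendsto_one_div_add_atTop_nhds_zero_nat (Eventually.of_forall hb)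
    have := abs_nonpos_iff.1 h0
    linarith
  have ho : IsOpen {z : ℂ | 0 < z.re} := isOpen_lt continuous_const Complex.continuous_re
  have han : AnalyticOnNhd ℂ h {z : ℂ | 0 < z.re} := by
    refine DifferentiableOn.analyticOnNhd ?_ ho
    intro z hz
    have hz0 : z ≠ 0 := by rintro rfl; simp at hz
    refine DifferentiableWithinAt.sub (DifferentiableWithinAt.add ?_ ?_) (qser_diff z hz)
    · exact (digamma_diff hz).differentiableWithinAt
    · exact (differentiableAt_inv hz0).differentiableWithinAt
  have hpc : IsPreconnected {z : ℂ | 0 < z.re} := (convex_halfSpace_re_gt 0).isPreconnected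
  have hE : EqOn h (fun _ => h 1) {z : ℂ | 0 < z.re} := by
    refine han.eqOn_of_preconnected_of_frequently_eq analyticOnNhd_const hpc (z₀ := 1) (by simp) ?_
    have ht : Tendsto (fun n : ℕ => (1:ℂ) + ((1 / ((n:ℝ) + 1) : ℝ) : ℂ)) atTop (nhdsWithin 1 {1}ᶜ) := by
      rw [tendsto_nhdsWithin_iff]
      constructor
      · have := (Complex.continuous_ofReal.tendsto 0).comp (tendsto_one_div_add_atTop_nhds_zero_nat (𝕜 := ℝ))
        have := (tendsto_const_nhds (x := (1:ℂ))).add this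
        simpa using this
      · refine Eventually.of_forall fun n => ?_
        have : (n:ℂ) + 1 ≠ 0 := by exact_mod_cast n.succ_ne_zero
        simp [this]
    refine ht.frequently (Eventually.frequently (Eventually.of_forall fun n => ?_))
    have hn : (0:ℝ) ≤ n := by positivity
    have := hconst (1 + 1 / ((n:ℝ) + 1)) (by simp; positivity) (by
      have : 1 / ((n:ℝ) + 1) ≤ 1 := by rw [div_le_one (by positivity)]; linarith
      linarith)
    push_cast at this ⊢
    exact this
  refine ⟨h 1, fun z hz => ?_⟩
  have := hE hz
  simp only [hh] at this ⊢
  linear_combination this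

lemma log_step {z : ℂ} (hz : 1/4 ≤ z.re) (n : ℕ) :
    ‖(z + (n + 1))⁻¹ - (Complex.log (z + (((n + 1 : ℕ):ℂ) + 1)) - Complex.log (z + (n + 1)))‖ ≤
      5 * (((n:ℝ) + 1) ^ 2)⁻¹ := by
  set u := z + ((n:ℂ) + 1) with hu
  have hn : (0:ℝ) ≤ n := by positivity
  have hure : 5/4 + (n:ℝ) ≤ u.re := by rw [hu]; simp; linarith
  have hun : 5/4 + (n:ℝ) ≤ ‖u‖ := hure.trans (Complex.re_le_norm u)
  have hu0 : u ≠ 0 := by rw [← norm_pos_iff]; linarith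
  have hw : ‖u⁻¹‖ ≤ 4/5 := by
    rw [norm_inv, inv_le_comm₀ (by linarith) (by norm_num)]; linarith
  have hw2 : ‖u⁻¹‖ ≤ ((n:ℝ) + 1)⁻¹ := by
    rw [norm_inv]; apply inv_anti₀ <;> linarith
  have e : z + (((n + 1 : ℕ):ℂ) + 1) = u * (1 + u⁻¹) := by
    rw [mul_add, mul_inv_cancel₀ hu0, hu]; push_cast; ring
  have hwre : 0 < (1 + u⁻¹).re := by
    have := Complex.abs_re_le_norm u⁻¹
    have := abs_le.1 this
    simp only [Complex.add_re, Complex.one_re]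
    linarith
  have h1 : Complex.log (u * (1 + u⁻¹)) = Complex.log u + Complex.log (1 + u⁻¹) := by
    refine Complex.log_mul hu0 (by intro h; rw [h] at hwre; simp at hwre) ?_
    have a1 := Complex.abs_arg_lt_pi_div_two_iff.2 (Or.inl (show 0 < u.re by linarith))
    have a2 := Complex.abs_arg_lt_pi_div_two_iff.2 (Or.inl hwre)
    rw [abs_lt] at a1 a2
    constructor <;> linarith
  rw [e, h1, add_sub_cancel_left, norm_sub_rev]
  refine (Complex.norm_log_one_add_sub_self_le (by linarith)).trans ?_
  have h2 : (1 - ‖u⁻¹‖)⁻¹ ≤ 5 := by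
    rw [inv_le_comm₀ (by linarith) (by norm_num)]; linarith
  have h3 : ‖u⁻¹‖ ^ 2 ≤ (((n:ℝ) + 1) ^ 2)⁻¹ := by
    rw [← inv_pow]; gcongr
  have h4 : 0 < (1 - ‖u⁻¹‖)⁻¹ := inv_pos.2 (by linarith)
  calc ‖u⁻¹‖ ^ 2 * (1 - ‖u⁻¹‖)⁻¹ / 2 ≤ (((n:ℝ) + 1) ^ 2)⁻¹ * 5 / 2 := by gcongr
    _ ≤ _ := by
      have : 0 < (((n:ℝ) + 1) ^ 2)⁻¹ := by positivity
      linarith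

lemma qser_log : ∃ C : ℝ, ∀ t : ℝ, ‖qser (1/4 + t * I) - Complex.log (5/4 + t * I)‖ ≤ C := by
  set K := ∑' n : ℕ, 5 * (((n:ℝ) + 1) ^ 2)⁻¹ with hK
  have hs := summable_inv_succ_sq.mul_left 5
  refine ⟨2 * K + ‖qser (1/4)‖ + ‖Complex.log (5/4)‖, fun t => ?_⟩
  set f : ℂ → ℕ → ℂ := fun z n => (z + (n + 1))⁻¹ - (Complex.log (z + (((n + 1 : ℕ):ℂ) + 1)) - Complex.log (z + (n + 1))) with hf
  have hfs : ∀ z : ℂ, 1/4 ≤ z.re → Summable (f z) := fun z hz =>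
    Summable.of_norm_bounded hs (log_step hz)
  have hfb : ∀ z : ℂ, 1/4 ≤ z.re → ‖∑' n, f z n‖ ≤ K := fun z hz =>
    tsum_of_norm_bounded hs.hasSum (log_step hz)
  obtain ⟨z, hz⟩ : ∃ z : ℂ, z = 1/4 + t * I := ⟨_, rfl⟩
  rw [← hz]
  set w : ℂ := 1/4 with hw
  have hzr : 1/4 ≤ z.re := by rw [hz]; simp [hw]
  have hwr : 1/4 ≤ w.re := by simp [hw]
  have h1 := (qser_summable (z := z) (by linarith)).hasSum.sub (qser_summable (z := w) (by linarith)).hasSum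
  have h2 := (hfs w hwr).hasSum.sub (hfs z hzr).hasSum
  have h3 := (h1.sub h2).tendsto_sum_nat
  have he : ∀ n : ℕ, (((n:ℂ) + 1)⁻¹ - (z + (n + 1))⁻¹ - (((n:ℂ) + 1)⁻¹ - (w + (n + 1))⁻¹) - (f w n - f z n)) =
     ((Complex.log (w + (((n + 1 : ℕ):ℂ) + 1)) - Complex.log (z + (((n + 1 : ℕ):ℂ) + 1))) - (Complex.log (w + (n + 1)) - Complex.log (z + (n + 1)))) := by
    intro n
    simp only [hf]
    ring
  simp_rw [he, Finset.sum_range_sub (fun n : ℕ => Complex.log (w + (n + 1)) - Complex.log (z + (n + 1)))] at h3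
  have h4 : Tendsto (fun n : ℕ => Complex.log (w + (n + 1)) - Complex.log (z + (n + 1))) atTop (nhds 0) := by
    have hl : ∀ n : ℕ, Complex.log (w + (n + 1)) - Complex.log (z + (n + 1)) = - Complex.log (1 + ((t / ((n:ℝ) + 5/4) : ℝ) : ℂ) * I) := by
      intro n
      have hp : (0:ℝ) < (n:ℝ) + 5/4 := by positivity
      have hpc : ((n:ℂ) + 5/4) ≠ 0 := by
        have : (n:ℂ) + 5/4 = (((n:ℝ) + 5/4 : ℝ) : ℂ) := by push_cast; rfl
        rw [this]; exact_mod_cast hp.ne'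
      have e1 : w + ((n:ℂ) + 1) = (((n:ℝ) + 5/4 : ℝ) : ℂ) := by rw [hw]; push_cast; ring
      have e2 : z + ((n:ℂ) + 1) = (((n:ℝ) + 5/4 : ℝ) : ℂ) * (1 + ((t / ((n:ℝ) + 5/4) : ℝ) : ℂ) * I) := by
        have : ((t:ℂ) / ((n:ℂ) + 5/4)) * ((n:ℂ) + 5/4) = t := div_mul_cancel₀ _ hpc
        rw [hz, hw]; push_cast; linear_combination - I * this
      have hne : (1 + ((t / ((n:ℝ) + 5/4) : ℝ) : ℂ) * I) ≠ 0 := by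
        intro h; have := congrArg Complex.re h; rw [Complex.add_re, Complex.re_ofReal_mul] at this; simp at this
      rw [e2, Complex.log_ofReal_mul hp hne, e1, Complex.ofReal_log hp.le]
      ring
    simp_rw [hl]
    have t1 : Tendsto (fun n : ℕ => t / ((n:ℝ) + 5/4)) atTop (nhds 0) :=
      tendsto_const_nhds.div_atTop (tendsto_natCast_atTop_atTop.atTop_add tendsto_const_nhds)
    have t2 : Tendsto (fun x : ℝ => -Complex.log (1 + (x:ℂ) * I)) (nhds 0) (nhds 0) := by
      have : ContinuousAt (fun x : ℝ => -Complex.log (1 + (x:ℂ) * I)) 0 := by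
        refine ContinuousAt.neg (ContinuousAt.clog (by fun_prop) (by simp))
      have := this.tendsto
      simpa using this
    exact t2.comp t1
  have h5 := tendsto_nhds_unique h3 (h4.sub_const _)
  have b1 := hfb w hwr
  have b2 := hfb z hzr
  have e3 : Complex.log (w + (((0:ℕ):ℂ) + 1)) = Complex.log (5/4) := by congr 1; rw [hw]; push_cast; ring
  have e4 : Complex.log (z + (((0:ℕ):ℂ) + 1)) = Complex.log (5/4 + t * I) := by congr 1; rw [hz]; push_cast; ring
  rw [e3, e4] at h5
  have h6 : qser z - Complex.log (5/4 + t * I) = qser w - Complex.log (5/4) + ((∑' n, f w n) - ∑' n, f z n) := by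
    simp only [qser] at h5 ⊢
    linear_combination h5
  rw [h6]
  calc _ ≤ (‖qser w‖ + ‖Complex.log (5/4)‖) + (‖∑' n, f w n‖ + ‖∑' n, f z n‖) :=
        (norm_add_le _ _).trans (add_le_add (norm_sub_le _ _) (norm_sub_le _ _))
    _ ≤ _ := by linarith

lemma digamma_growth : ∃ C : ℝ, 0 ≤ C ∧ ∀ y : ℝ, ‖Complex.digamma (1/4 + (y/2 : ℝ) * I) - (Real.log (1 + |y|) : ℝ)‖ ≤ C := by
  obtain ⟨κ, hκ⟩ := digamma_series
  obtain ⟨C, hC⟩ := qser_log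
  have main : ∀ y : ℝ, ‖Complex.digamma (1/4 + (y/2 : ℝ) * I) - (Real.log (1 + |y|) : ℝ)‖ ≤ C + ‖κ‖ + 4 + Real.log 4 + π := by
    intro y
    set z : ℂ := 1/4 + (y/2 : ℝ) * I with hz
    have hzr : z.re = 1/4 := by simp [hz]
    rw [hκ z (by rw [hzr]; norm_num)]
    have h1 : ‖z⁻¹‖ ≤ 4 := by
      rw [norm_inv, inv_le_comm₀ _ (by norm_num)]
      · have := Complex.re_le_norm z; rw [hzr] at this; linarith
      · have := Complex.re_le_norm z; rw [hzr] at this; linarith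
    have h2 := hC (y/2)
    set u : ℂ := 5/4 + (y/2 : ℝ) * I with hu
    have hun : ‖u‖ ≤ 4 * (1 + |y|) := by
      calc ‖u‖ ≤ ‖(5/4 : ℂ)‖ + ‖((y/2 : ℝ):ℂ) * I‖ := norm_add_le _ _
        _ = 5/4 + |y|/2 := by simp [abs_div]
        _ ≤ _ := by have := abs_nonneg y; linarith
    have hun2 : (1 + |y|) / 4 ≤ ‖u‖ := by
      have a1 := Complex.abs_re_le_norm u
      have a2 := Complex.abs_im_le_norm u
      have e1 : u.re = 5/4 := by simp [hu]
      have e2 : |u.im| = |y|/2 := by simp [hu, abs_div]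
      rw [e1, abs_of_pos (by norm_num)] at a1
      rw [e2] at a2
      linarith
    have hy : 0 < 1 + |y| := by positivity
    have h3 : ‖Complex.log u - (Real.log (1 + |y|) : ℝ)‖ ≤ Real.log 4 + π := by
      refine (Complex.norm_le_abs_re_add_abs_im _).trans ?_
      simp only [Complex.sub_re, Complex.sub_im, Complex.log_re, Complex.log_im, Complex.ofReal_re, Complex.ofReal_im, sub_zero]
      refine add_le_add ?_ (Complex.abs_arg_le_pi u)
      have l1 : Real.log ‖u‖ ≤ Real.log 4 + Real.log (1 + |y|) := by
        rw [← Real.log_mul (by norm_num) hy.ne']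
        exact Real.log_le_log (by linarith) hun
      have l2 : Real.log (1 + |y|) - Real.log 4 ≤ Real.log ‖u‖ := by
        rw [← Real.log_div hy.ne' (by norm_num)]
        exact Real.log_le_log (by positivity) hun2
      rw [abs_le]; constructor <;> linarith
    have e : κ - z⁻¹ + qser z - (Real.log (1 + |y|) : ℝ) = (qser z - Complex.log u) + κ + (- z⁻¹) + (Complex.log u - (Real.log (1 + |y|) : ℝ)) := by ring
    rw [e]
    refine (norm_add_le _ _).trans ?_
    have h4 : ‖(qser z - Complex.log u) + κ + (- z⁻¹)‖ ≤ C + ‖κ‖ + 4 := by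
      refine (norm_add₃_le).trans ?_
      rw [norm_neg]
      linarith
    linarith
  exact ⟨_, (norm_nonneg _).trans (main 0), main⟩

lemma line_quarter_norm {c : ℝ} (hc : 0 ≤ c) (hc1 : c ≤ 1) (y : ℝ) :
    ‖(1/4 + (c + y * I) / 2 : ℂ)‖ ≤ 2 * (1 + y ^ 2) ^ 2 := by
  have h1 : (1/4 + (c + y * I) / 2 : ℂ) = ((1/4 + c/2 : ℝ) : ℂ) + ((y/2 : ℝ):ℂ) * I := by push_cast; ring
  rw [h1]
  refine (norm_add_le _ _).trans ?_
  simp only [norm_mul, Complex.norm_real, Complex.norm_I, mul_one, Real.norm_eq_abs]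
  rw [abs_of_nonneg (by positivity), abs_div, abs_of_pos (by norm_num : (0:ℝ) < 2)]
  have : |y| ≤ 1 + y ^ 2 := by
    rw [← sq_abs]; nlinarith [sq_nonneg (|y| - 1), abs_nonneg y]
  nlinarith [sq_nonneg y, sq_nonneg (y^2)]

lemma line_quarter_re {c : ℝ} (hc : 0 ≤ c) (y : ℝ) : 1/4 ≤ (1/4 + (c + y * I) / 2 : ℂ).re := by
  have h1 : (1/4 + (c + y * I) / 2 : ℂ) = ((1/4 + c/2 : ℝ) : ℂ) + ((y/2 : ℝ):ℂ) * I := by push_cast; ring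
  rw [h1]
  simp
  positivity

lemma digamma_line_cont {c : ℝ} (hc : 0 ≤ c) :
    Continuous (fun y : ℝ => Complex.digamma (1/4 + (c + y * I) / 2)) := by
  rw [continuous_iff_continuousAt]
  intro y
  have h := line_quarter_re hc y
  exact ContinuousAt.comp (f := fun y : ℝ => (1/4 + (c + y * I) / 2 : ℂ))
    (digamma_diff (by linarith)).continuousAt (by fun_prop)

lemma qser_norm_le {z : ℂ} (hz : 0 ≤ z.re) : ‖qser z‖ ≤ ‖z‖ * ∑' n : ℕ, (((n:ℝ) + 1) ^ 2)⁻¹ := by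
  rw [← tsum_mul_left]
  exact tsum_of_norm_bounded (summable_inv_succ_sq.mul_left _).hasSum (qser_term_bound hz)

lemma digamma_line_bound : ∃ C : ℝ, ∀ c : ℝ, 0 ≤ c → c ≤ 1 → ∀ y : ℝ,
    ‖Complex.digamma (1/4 + (c + y * I) / 2)‖ ≤ C * (1 + y ^ 2) ^ 2 := by
  obtain ⟨κ, hκ⟩ := digamma_series
  refine ⟨‖κ‖ + 4 + 2 * ∑' n : ℕ, (((n:ℝ) + 1) ^ 2)⁻¹, fun c hc hc1 y => ?_⟩
  have h := line_quarter_re hc y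
  have hn := line_quarter_norm hc hc1 y
  set z := (1/4 + (c + y * I) / 2 : ℂ) with hz
  have hS : 0 ≤ ∑' n : ℕ, (((n:ℝ) + 1) ^ 2)⁻¹ := tsum_nonneg fun n => by positivity
  have h1 : ‖z⁻¹‖ ≤ 4 := by
    have := Complex.re_le_norm z
    rw [norm_inv, inv_le_comm₀ _ (by norm_num)] <;> linarith
  rw [hκ z (by linarith)]
  have h2 := qser_norm_le (z := z) (by linarith)
  have hy : 1 ≤ (1 + y ^ 2) ^ 2 := by nlinarith [sq_nonneg y]
  calc _ ≤ ‖κ - z⁻¹‖ + ‖qser z‖ := norm_add_le _ _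
    _ ≤ ‖κ‖ + ‖z⁻¹‖ + ‖qser z‖ := by gcongr; exact norm_sub_le _ _
    _ ≤ ‖κ‖ + 4 + (2 * (1 + y ^ 2) ^ 2) * ∑' n : ℕ, (((n:ℝ) + 1) ^ 2)⁻¹ := by
      gcongr
      exact h2.trans (by gcongr)
    _ ≤ (‖κ‖ + 4) * (1 + y ^ 2) ^ 2 + (2 * (1 + y ^ 2) ^ 2) * ∑' n : ℕ, (((n:ℝ) + 1) ^ 2)⁻¹ := by
      gcongr
      exact le_mul_of_one_le_right (by positivity) hy
    _ = _ := by ring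

lemma gG_digamma_integrable {a : ℝ} (ha : 0 < a) (b d : ℂ) {c : ℝ} (hc : 0 ≤ c) (hc1 : c ≤ 1) :
    Integrable (fun y : ℝ => gG a b d (c + y * I) * Complex.digamma (1/4 + (c + y * I) / 2)) := by
  obtain ⟨C, hC⟩ := digamma_line_bound
  exact gG_mul_integrable ha b d c (digamma_line_cont hc).aestronglyMeasurable (hC c hc hc1)

lemma inv_quarter (p : ℂ) (q : ℂ) : (1/4 + p / 2 + q)⁻¹ = 2 * (p - (-1/2 - 2 * q))⁻¹ := by
  rw [show 1/4 + p / 2 + q = (p - (-1/2 - 2 * q)) / 2 by ring, inv_div]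
  ring

lemma arch_shift {a : ℝ} (ha : 0 < a) (b d : ℂ) {c : ℝ} (hc : 0 ≤ c) (hc1 : c ≤ 1) :
    ∫ y : ℝ, gG a b d (c + y * I) * Complex.digamma (1/4 + (c + y * I) / 2) =
    ∫ y : ℝ, gG a b d ((0:ℝ) + y * I) * Complex.digamma (1/4 + ((0:ℝ) + y * I) / 2) := by
  obtain ⟨κ, hκ⟩ := digamma_series
  set A : ℂ := (√(π/a) : ℝ) * cexp (d - b ^ 2 / (4 * a)) with hA
  set B : ℂ → ℂ := fun p0 => (√(π/a) : ℝ) * ∫ x in Ioi (0:ℝ), cexp (d - (b - x) ^ 2 / (4 * a) + p0 * x) with hB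
  have main : ∀ c : ℝ, 0 ≤ c → c ≤ 1 →
      ∫ y : ℝ, gG a b d (c + y * I) * Complex.digamma (1/4 + (c + y * I) / 2) =
      κ * A - 2 * B (-1/2) + ∑' n : ℕ, (((n:ℂ) + 1)⁻¹ * A - 2 * B (-1/2 - 2 * (n + 1))) := by
    intro c hc hc1
    have hA' := gG_integral ha b d c
    have hB' : ∀ p0 : ℂ, p0.re < c → ∫ y : ℝ, gG a b d (c + y * I) * (c + y * I - p0)⁻¹ = B p0 := fun p0 hp =>
      gG_div_integral ha b d hp
    have hre : ∀ n : ℕ, ((-1/2 - 2 * ((n:ℂ) + 1)) : ℂ).re < c := by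
      intro n
      have : (0:ℝ) ≤ n := by positivity
      simp
      linarith
    have hre0 : ((-1/2 : ℂ)).re < c := by simp; linarith
    have i1 := gG_integrable ha b d c
    have i2 := gG_inv_integrable ha b d hre0
    have i3 := fun n => gG_inv_integrable ha b d (hre n)
    have hsw := gG_swap ha b d c (F := fun (n : ℕ) (y : ℝ) => (((n:ℂ) + 1)⁻¹ - ((1/4 + (c + y * I) / 2) + (n + 1))⁻¹))
      (w := fun n : ℕ => 2 * (((n:ℝ) + 1) ^ 2)⁻¹) (summable_inv_succ_sq.mul_left 2) (fun n => ?_) (fun n y => ?_)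
    · have hq : ∀ y : ℝ, ∑' n : ℕ, (((n:ℂ) + 1)⁻¹ - ((1/4 + (c + y * I) / 2) + (n + 1))⁻¹) = qser (1/4 + (c + y * I) / 2) := fun y => rfl
      simp_rw [hq] at hsw
      have ht : ∀ n : ℕ, ∫ y : ℝ, gG a b d (c + y * I) * (((n:ℂ) + 1)⁻¹ - ((1/4 + (c + y * I) / 2) + (n + 1))⁻¹) =
          ((n:ℂ) + 1)⁻¹ * A - 2 * B (-1/2 - 2 * (n + 1)) := by
        intro n
        simp_rw [inv_quarter, mul_sub, mul_left_comm _ (2:ℂ)]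
        have j1 : Integrable (fun y : ℝ => gG a b d (c + y * I) * ((n:ℂ) + 1)⁻¹) := i1.mul_const _
        have j2 := (i3 n).const_mul 2
        rw [integral_sub j1 j2, integral_mul_const, integral_const_mul, hA', hB' _ (hre n), mul_comm A]
      simp_rw [ht] at hsw
      rw [hsw.tsum_eq]
      have hd : ∀ y : ℝ, gG a b d (c + y * I) * Complex.digamma (1/4 + (c + y * I) / 2) =
          (κ * gG a b d (c + y * I) - 2 * (gG a b d (c + y * I) * (c + y * I - (-1/2))⁻¹)) + gG a b d (c + y * I) * qser (1/4 + (c + y * I) / 2) := by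
        intro y
        have h := line_quarter_re hc y
        rw [hκ _ (by linarith)]
        have := inv_quarter (c + y * I) 0
        rw [add_zero, mul_zero, sub_zero] at this
        rw [this]
        ring
      have j3 : Integrable (fun y : ℝ => κ * gG a b d (c + y * I) - 2 * (gG a b d (c + y * I) * (c + y * I - (-1/2))⁻¹)) :=
        (i1.const_mul κ).sub (i2.const_mul 2)
      have j4 : Integrable (fun y : ℝ => gG a b d (c + y * I) * qser (1/4 + (c + y * I) / 2)) := by
        have := (gG_digamma_integrable ha b d hc hc1).sub j3
        refine this.congr (Eventually.of_forall fun y => ?_)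
        simp only [Pi.sub_apply]
        rw [hd y]
        ring
      simp_rw [hd]
      rw [integral_add j3 j4, integral_sub (i1.const_mul κ) (i2.const_mul 2), integral_const_mul, integral_const_mul, hA', hB' _ hre0]
    · have := inv_line_meas (hre n)
      simp_rw [inv_quarter]
      exact (continuous_const.sub (continuous_const.mul this)).aestronglyMeasurable
    · have h := line_quarter_re hc y
      refine (qser_term_bound (by linarith) n).trans ?_
      have := line_quarter_norm hc hc1 y
      calc _ ≤ (2 * (1 + y ^ 2) ^ 2) * (((n:ℝ) + 1) ^ 2)⁻¹ := by gcongr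
        _ = _ := by ring
  rw [main c hc hc1, main 0 le_rfl zero_le_one]

/-- logarithmic derivative of the archimedean factor -/
def Lg (y : ℝ) : ℂ := - (Real.log π / 2 : ℝ) + Complex.digamma (1/4 + ((0:ℝ) + y * I) / 2) / 2

lemma logDeriv_Gammaℝ {s : ℂ} (hs : 0 < s.re) :
    DifferentiableAt ℂ Gammaℝ s ∧ logDeriv Gammaℝ s = - (Real.log π / 2 : ℝ) + Complex.digamma (s / 2) / 2 := by
  have hs2 : 0 < (s / 2).re := by simpa using hs
  have hG := (Complex.differentiableAt_Gamma (s/2) (gamma_ne hs2)).hasDerivAt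
  have hG2 : HasDerivAt (fun s : ℂ => Complex.Gamma (s / 2)) (deriv Complex.Gamma (s/2) * (1 / 2)) s :=
    HasDerivAt.comp s hG ((hasDerivAt_id s).div_const 2)
  have hpi : (π : ℂ) ≠ 0 := by exact_mod_cast Real.pi_ne_zero
  have hP : HasDerivAt (fun s : ℂ => (π:ℂ) ^ (-s/2)) ((π:ℂ) ^ (-s/2) * Complex.log π * (-1/2)) s :=
    HasDerivAt.const_cpow (((hasDerivAt_id s).neg).div_const 2) (Or.inl hpi)
  have hM := hP.mul hG2
  have he : Gammaℝ = fun s : ℂ => (π:ℂ) ^ (-s/2) * Complex.Gamma (s/2) := by ext s; rw [Gammaℝ_def]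
  have hM' : HasDerivAt Gammaℝ ((π:ℂ) ^ (-s/2) * Complex.log π * (-1/2) * Complex.Gamma (s / 2) +
      (π:ℂ) ^ (-s/2) * (deriv Complex.Gamma (s/2) * (1 / 2))) s := by rw [he]; exact hM
  refine ⟨hM'.differentiableAt, ?_⟩
  rw [logDeriv_apply, hM'.deriv, Gammaℝ_def, Complex.digamma_def, logDeriv_apply]
  have h1 : Complex.Gamma (s/2) ≠ 0 := Complex.Gamma_ne_zero (gamma_ne hs2)
  have h2 : (π:ℂ) ^ (-s/2) ≠ 0 := by simp [Complex.cpow_eq_zero_iff, hpi]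
  rw [Complex.ofReal_div, Complex.ofReal_log Real.pi_pos.le]
  push_cast
  field_simp

lemma logDeriv_xiF_right {s : ℂ} (hs : 1 < s.re) :
    logDeriv xiF s = s⁻¹ + (s - 1)⁻¹ + (- (Real.log π / 2 : ℝ) + Complex.digamma (s / 2) / 2) -
      LSeries (fun n => (ArithmeticFunction.vonMangoldt n : ℂ)) s := by
  have hs0 : s ≠ 0 := by rintro rfl; simp at hs; linarith
  have hs1 : s ≠ 1 := by rintro rfl; simp at hs
  have hs1' : s - 1 ≠ 0 := sub_ne_zero.2 hs1
  obtain ⟨g1, g2⟩ := logDeriv_Gammaℝ (s := s) (by linarith)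
  have hg0 : Gammaℝ s ≠ 0 := Gammaℝ_ne_zero_of_re_pos (by linarith)
  have hz0 : riemannZeta s ≠ 0 := riemannZeta_ne_zero_of_one_lt_re hs
  have hz1 := differentiableAt_riemannZeta hs1
  have hev : xiF =ᶠ[nhds s] fun w => (w * (w - 1)) * (Gammaℝ w * riemannZeta w) := by
    have ho : IsOpen {w : ℂ | 1 < w.re} := isOpen_lt continuous_const Complex.continuous_re
    filter_upwards [ho.mem_nhds hs] with w hw
    have hw' : 1 < w.re := hw
    have hw0 : w ≠ 0 := by rintro rfl; simp at hw'; linarith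
    have hw1 : w ≠ 1 := by rintro rfl; simp at hw'
    have hgw : Gammaℝ w ≠ 0 := Gammaℝ_ne_zero_of_re_pos (by linarith)
    rw [xiF_eq hw0 hw1, riemannZeta_def_of_ne_zero hw0]
    field_simp
  have h1 : logDeriv xiF s = logDeriv (fun w => (w * (w - 1)) * (Gammaℝ w * riemannZeta w)) s := by
    rw [logDeriv_apply, logDeriv_apply, hev.deriv_eq, hev.eq_of_nhds]
  have d1 : DifferentiableAt ℂ (fun w : ℂ => w) s := differentiableAt_id
  have d2 : DifferentiableAt ℂ (fun w : ℂ => w - 1) s := by fun_prop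
  rw [h1, logDeriv_mul s (f := fun w => w * (w - 1)) (g := fun w => Gammaℝ w * riemannZeta w) (mul_ne_zero hs0 hs1')
    (mul_ne_zero hg0 hz0) (d1.mul d2) (g1.mul hz1), logDeriv_mul s (f := Gammaℝ) (g := riemannZeta) hg0 hz0 g1 hz1, g2,
    logDeriv_mul s (f := fun w => w) (g := fun w => w - 1) hs0 hs1' d1 d2]
  have hL := ArithmeticFunction.LSeries_vonMangoldt_eq_deriv_riemannZeta_div hs
  rw [hL]
  simp only [logDeriv_apply]
  have e1 : deriv (fun w : ℂ => w) s = 1 := deriv_id s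
  have e2 : deriv (fun w : ℂ => w - 1) s = 1 := by simp
  rw [e1, e2]
  ring

/-- von Mangoldt function -/
def vM (n : ℕ) : ℝ := ArithmeticFunction.vonMangoldt n

lemma vM_nonneg (n : ℕ) : 0 ≤ vM n := ArithmeticFunction.vonMangoldt_nonneg

lemma vM_zero : vM 0 = 0 := by simp [vM]

lemma vM_one : vM 1 = 0 := by simp [vM]

lemma vM_summable : Summable (fun n : ℕ => vM n * (n:ℝ) ^ (-(3/2) : ℝ)) := by
  have h := (ArithmeticFunction.LSeriesSummable_vonMangoldt (s := (3/2 : ℂ)) (by norm_num)).norm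
  refine h.congr fun n => ?_
  rw [LSeries.norm_term_eq]
  split_ifs with h0
  · subst h0; simp [vM_zero]
  · have : ‖((ArithmeticFunction.vonMangoldt n : ℝ) : ℂ)‖ = vM n := by
      rw [Complex.norm_real]; exact Real.norm_of_nonneg (vM_nonneg n)
    rw [this]
    norm_num
    rw [Real.rpow_neg (by positivity), div_eq_mul_inv]

lemma prime_term (n : ℕ) (y : ℝ) : LSeries.term (fun n => (ArithmeticFunction.vonMangoldt n : ℂ)) (1/2 + ((1:ℝ) + y * I)) n =
    ((vM n * (n:ℝ) ^ (-(1/2) : ℝ) : ℝ) : ℂ) * cexp (-((Real.log n : ℝ) : ℂ) * ((1:ℝ) + y * I)) := by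
  rcases Nat.eq_zero_or_pos n with h0 | h0
  · subst h0; simp [vM_zero]
  · have hn : (n:ℂ) ≠ 0 := by exact_mod_cast h0.ne'
    have hn' : (0:ℝ) < n := by exact_mod_cast h0
    rw [LSeries.term_of_ne_zero h0.ne', div_eq_mul_inv, ← Complex.cpow_neg, Complex.ofReal_mul, mul_assoc]
    congr 1
    rw [Complex.ofReal_cpow hn'.le, Complex.ofReal_natCast, Complex.cpow_def_of_ne_zero hn, Complex.cpow_def_of_ne_zero hn, ← Complex.exp_add,
      Complex.ofReal_log hn'.le]
    congr 1
    push_cast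
    ring

lemma gG_exp (a : ℝ) (b d p : ℂ) (l : ℂ) : gG a b d p * cexp (-l * p) = gG a (b - l) d p := by
  rw [gG, gG, ← Complex.exp_add]; congr 1; ring

lemma prime_side {a : ℝ} (ha : 0 < a) (b d : ℂ) :
    HasSum (fun n : ℕ => ((vM n * (n:ℝ) ^ (-(1/2) : ℝ) : ℝ) : ℂ) * ((√(π/a) : ℝ) * cexp (d - (b - (Real.log n : ℝ)) ^ 2 / (4 * a))))
    (∫ y : ℝ, gG a b d ((1:ℝ) + y * I) * LSeries (fun n => (ArithmeticFunction.vonMangoldt n : ℂ)) (1/2 + ((1:ℝ) + y * I))) := by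
  have h := gG_swap ha b d 1 (F := fun (n : ℕ) (y : ℝ) => LSeries.term (fun n => (ArithmeticFunction.vonMangoldt n : ℂ)) (1/2 + ((1:ℝ) + y * I)) n)
    vM_summable (fun n => ?_) (fun n y => ?_)
  · have e : ∀ n : ℕ, ∫ y : ℝ, gG a b d ((1:ℝ) + y * I) * LSeries.term (fun n => (ArithmeticFunction.vonMangoldt n : ℂ)) (1/2 + ((1:ℝ) + y * I)) n =
        ((vM n * (n:ℝ) ^ (-(1/2) : ℝ) : ℝ) : ℂ) * ((√(π/a) : ℝ) * cexp (d - (b - (Real.log n : ℝ)) ^ 2 / (4 * a))) := by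
      intro n
      simp_rw [prime_term, mul_left_comm (gG _ _ _ _), gG_exp]
      rw [integral_const_mul, gG_integral ha]
    simp_rw [e] at h
    exact h
  · simp_rw [prime_term]
    exact Continuous.aestronglyMeasurable (by fun_prop)
  · rw [prime_term, norm_mul, Complex.norm_exp]
    have hy : 1 ≤ (1 + y ^ 2) ^ 2 := by nlinarith [sq_nonneg y]
    have h1 : (-((Real.log n : ℝ) : ℂ) * ((1:ℝ) + y * I)).re = -Real.log n := by
      rw [← Complex.ofReal_neg, Complex.re_ofReal_mul]; simp
    rw [h1, Complex.norm_real, Real.norm_of_nonneg (by have := vM_nonneg n; positivity)]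
    have h2 : vM n * (n:ℝ) ^ (-(1/2) : ℝ) * Real.exp (-Real.log n) = vM n * (n:ℝ) ^ (-(3/2) : ℝ) := by
      rcases Nat.eq_zero_or_pos n with h0 | h0
      · subst h0; simp [vM_zero]
      · have hn' : (0:ℝ) < n := by exact_mod_cast h0
        rw [Real.exp_neg, Real.exp_log hn', mul_assoc, ← Real.rpow_neg_one, ← Real.rpow_add hn']
        norm_num
    rw [h2]
    exact le_mul_of_one_le_right (mul_nonneg (vM_nonneg n) (by positivity)) hy

/-- the archimedean density -/
def phi (y : ℝ) : ℂ := Lg y + Lg (-y)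

lemma Lg_cont : Continuous Lg :=
  continuous_const.add ((digamma_line_cont le_rfl).div_const 2)

lemma phi_cont : Continuous phi := Lg_cont.add (Lg_cont.comp continuous_neg)

lemma phi_bound : ∃ C : ℝ, 0 ≤ C ∧ ∀ y : ℝ, ‖phi y - (Real.log (1 + |y|) : ℝ)‖ ≤ C := by
  obtain ⟨C, hC0, hC⟩ := digamma_growth
  refine ⟨C + |Real.log π|, by positivity, fun y => ?_⟩
  have h1 := hC y
  have h2 := hC (-y)
  rw [abs_neg] at h2
  have e : phi y - (Real.log (1 + |y|) : ℝ) = (1/2 : ℂ) * (Complex.digamma (1/4 + (y/2 : ℝ) * I) - (Real.log (1 + |y|) : ℝ)) +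
     (1/2 : ℂ) * (Complex.digamma (1/4 + (-y/2 : ℝ) * I) - (Real.log (1 + |y|) : ℝ)) - (Real.log π : ℝ) := by
    rw [phi, Lg, Lg]
    have a1 : (1/4 + ((0:ℝ) + y * I) / 2 : ℂ) = 1/4 + (y/2 : ℝ) * I := by push_cast; ring
    have a2 : (1/4 + ((0:ℝ) + (-y : ℝ) * I) / 2 : ℂ) = 1/4 + (-y/2 : ℝ) * I := by push_cast; ring
    rw [a1, a2]
    push_cast
    ring
  rw [e]
  refine (norm_sub_le _ _).trans ?_
  rw [Complex.norm_real, Real.norm_eq_abs]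
  gcongr
  refine (norm_add_le _ _).trans ?_
  rw [norm_mul, norm_mul]
  have : ‖(1/2 : ℂ)‖ = 1/2 := by norm_num
  rw [this]
  linarith

theorem explicit_formula (hRH : RiemannHypothesis) {a : ℝ} (ha : 0 < a) (b d : ℂ) :
    2 * π * ∑' γ : ℝ, (zm γ : ℂ) * gG a b d (γ * I) =
    2 * π * (gG a b d (1/2) + gG a b d (-(1/2))) + (∫ y : ℝ, gG a b d (y * I) * phi y) -
    (√(π/a) : ℝ) * ∑' n : ℕ, ((vM n * (n:ℝ) ^ (-(1/2) : ℝ) : ℝ) : ℂ) *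
      (cexp (d - (b - (Real.log n : ℝ)) ^ 2 / (4 * a)) + cexp (d - (b + (Real.log n : ℝ)) ^ 2 / (4 * a))) := by
  rw [← zeros_side hRH ha b d]
  have hline : ∀ y : ℝ, logDeriv xiF (1/2 + ((1:ℝ) + y * I)) =
      (((1:ℝ) + y * I - 1/2)⁻¹ + ((1:ℝ) + y * I + 1/2)⁻¹) + (- (Real.log π / 2 : ℝ) + Complex.digamma (1/4 + ((1:ℝ) + y * I) / 2) / 2) -
        LSeries (fun n => (ArithmeticFunction.vonMangoldt n : ℂ)) (1/2 + ((1:ℝ) + y * I)) := by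
    intro y
    rw [logDeriv_xiF_right (by simp)]
    rw [show (1/2 + ((1:ℝ) + y * I) : ℂ) / 2 = 1/4 + ((1:ℝ) + y * I) / 2 by ring,
      show (1/2 + ((1:ℝ) + y * I) : ℂ) - 1 = (1:ℝ) + y * I - 1/2 by ring,
      show (1/2 + ((1:ℝ) + y * I) : ℂ)⁻¹ = ((1:ℝ) + y * I + 1/2 : ℂ)⁻¹ by rw [add_comm]]
    ring
  have hhalf : ((1/2 : ℂ)).re < 1 := by norm_num
  have hhalf' : ((-(1/2) : ℂ)).re < 1 := by norm_num
  have split : ∀ b : ℂ, ∫ y : ℝ, gG a b d ((1:ℝ) + y * I) * logDeriv xiF (1/2 + ((1:ℝ) + y * I)) =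
      (∫ y : ℝ, gG a b d ((1:ℝ) + y * I) * (((1:ℝ) + y * I - 1/2)⁻¹ + ((1:ℝ) + y * I + 1/2)⁻¹)) +
      (∫ y : ℝ, gG a b d (y * I) * Lg y) -
      (√(π/a) : ℝ) * ∑' n : ℕ, ((vM n * (n:ℝ) ^ (-(1/2) : ℝ) : ℝ) : ℂ) * cexp (d - (b - (Real.log n : ℝ)) ^ 2 / (4 * a)) := by
    intro b
    have hp := prime_side ha b d
    have i1 : Integrable (fun y : ℝ => gG a b d ((1:ℝ) + y * I) * (((1:ℝ) + y * I - 1/2)⁻¹ + ((1:ℝ) + y * I + 1/2)⁻¹)) := by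
      have := (gG_inv_integrable ha b d hhalf).add (gG_inv_integrable ha b d hhalf')
      refine this.congr (Eventually.of_forall fun y => ?_)
      simp only [Pi.add_apply, sub_neg_eq_add]
      ring
    have id : ∀ c : ℝ, 0 ≤ c → c ≤ 1 → Integrable (fun y : ℝ => gG a b d (c + y * I) * (- (Real.log π / 2 : ℝ) + Complex.digamma (1/4 + (c + y * I) / 2) / 2)) := by
      intro c hc hc1
      have := ((gG_integrable ha b d c).mul_const (- (Real.log π / 2 : ℝ))).add ((gG_digamma_integrable ha b d hc hc1).div_const 2)
      refine this.congr (Eventually.of_forall fun y => ?_)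
      simp only [Pi.add_apply]
      ring
    have i2 := id 1 zero_le_one le_rfl
    have i3 : Integrable (fun y : ℝ => gG a b d ((1:ℝ) + y * I) * LSeries (fun n => (ArithmeticFunction.vonMangoldt n : ℂ)) (1/2 + ((1:ℝ) + y * I))) := by
      refine gG_mul_integrable ha b d 1 (C := ∑' n : ℕ, vM n * (n:ℝ) ^ (-(3/2) : ℝ)) ?_ (fun y => ?_)
      · refine Continuous.aestronglyMeasurable ?_
        have hx : ∀ y : ℝ, LSeries (fun n => (ArithmeticFunction.vonMangoldt n : ℂ)) (1/2 + ((1:ℝ) + y * I)) =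
          - deriv riemannZeta (1/2 + ((1:ℝ) + y * I)) / riemannZeta (1/2 + ((1:ℝ) + y * I)) := fun y =>
          ArithmeticFunction.LSeries_vonMangoldt_eq_deriv_riemannZeta_div (by norm_num)
        rw [continuous_iff_continuousAt]
        intro y
        have ho : IsOpen {w : ℂ | 1 < w.re} := isOpen_lt continuous_const Complex.continuous_re
        have hd : DifferentiableOn ℂ riemannZeta {w : ℂ | 1 < w.re} := fun w hw => by
          refine (differentiableAt_riemannZeta ?_).differentiableWithinAt
          rintro rfl
          simp at hw
        have hs : (1/2 + ((1:ℝ) + y * I) : ℂ) ∈ {w : ℂ | 1 < w.re} := by simp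
        have hc : ContinuousAt (fun s => - deriv riemannZeta s / riemannZeta s) (1/2 + ((1:ℝ) + y * I)) :=
          ((hd.deriv ho).differentiableAt (ho.mem_nhds hs)).continuousAt.neg.div
            (hd.differentiableAt (ho.mem_nhds hs)).continuousAt (riemannZeta_ne_zero_of_one_lt_re hs)
        simp_rw [hx]
        exact ContinuousAt.comp (f := fun y : ℝ => (1/2 + ((1:ℝ) + y * I) : ℂ)) hc (by fun_prop)
      · have hy : 1 ≤ (1 + y ^ 2) ^ 2 := by nlinarith [sq_nonneg y]
        have hb : ∀ n, ‖LSeries.term (fun n => (ArithmeticFunction.vonMangoldt n : ℂ)) (1/2 + ((1:ℝ) + y * I)) n‖ ≤ vM n * (n:ℝ) ^ (-(3/2) : ℝ) := by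
          intro n
          rw [LSeries.norm_term_eq]
          split_ifs with h0
          · subst h0; simp [vM_zero]
          · have : ‖((ArithmeticFunction.vonMangoldt n : ℝ) : ℂ)‖ = vM n := by
              rw [Complex.norm_real]; exact Real.norm_of_nonneg (vM_nonneg n)
            rw [this]
            rw [Real.rpow_neg (by positivity), div_eq_mul_inv]
            norm_num
        refine (tsum_of_norm_bounded vM_summable.hasSum hb).trans ?_
        refine le_mul_of_one_le_right (tsum_nonneg fun n => mul_nonneg (vM_nonneg n) (by positivity)) hy
    simp_rw [hline]
    have e1 : ∀ y : ℝ, gG a b d ((1:ℝ) + y * I) * ((((1:ℝ) + y * I - 1/2)⁻¹ + ((1:ℝ) + y * I + 1/2)⁻¹) + (- (Real.log π / 2 : ℝ) + Complex.digamma (1/4 + ((1:ℝ) + y * I) / 2) / 2) -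
        LSeries (fun n => (ArithmeticFunction.vonMangoldt n : ℂ)) (1/2 + ((1:ℝ) + y * I))) =
        (gG a b d ((1:ℝ) + y * I) * (((1:ℝ) + y * I - 1/2)⁻¹ + ((1:ℝ) + y * I + 1/2)⁻¹) +
        gG a b d ((1:ℝ) + y * I) * (- (Real.log π / 2 : ℝ) + Complex.digamma (1/4 + ((1:ℝ) + y * I) / 2) / 2)) -
        gG a b d ((1:ℝ) + y * I) * LSeries (fun n => (ArithmeticFunction.vonMangoldt n : ℂ)) (1/2 + ((1:ℝ) + y * I)) := fun y => by ring
    simp_rw [e1]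
    rw [integral_sub (f := fun y : ℝ => gG a b d ((1:ℝ) + y * I) * (((1:ℝ) + y * I - 1/2)⁻¹ + ((1:ℝ) + y * I + 1/2)⁻¹) +
        gG a b d ((1:ℝ) + y * I) * (- (Real.log π / 2 : ℝ) + Complex.digamma (1/4 + ((1:ℝ) + y * I) / 2) / 2)) (i1.add i2) i3, integral_add i1 i2, ← hp.tsum_eq]
    have e2 : ∀ c : ℝ, 0 ≤ c → c ≤ 1 → ∫ y : ℝ, gG a b d (c + y * I) * (- (Real.log π / 2 : ℝ) + Complex.digamma (1/4 + (c + y * I) / 2) / 2) =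
       (∫ y : ℝ, gG a b d (c + y * I)) * (- (Real.log π / 2 : ℝ)) + (∫ y : ℝ, gG a b d (c + y * I) * Complex.digamma (1/4 + (c + y * I) / 2)) / 2 := by
      intro c hc hc1
      rw [← integral_mul_const, ← integral_div, ← integral_add ((gG_integrable ha b d c).mul_const _) ((gG_digamma_integrable ha b d hc hc1).div_const 2)]
      congr 1
      ext y
      ring
    have e3 : ∫ y : ℝ, gG a b d (y * I) * Lg y = ∫ y : ℝ, gG a b d ((0:ℝ) + y * I) * (- (Real.log π / 2 : ℝ) + Complex.digamma (1/4 + ((0:ℝ) + y * I) / 2) / 2) := by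
      congr 1
      ext y
      rw [Lg, Complex.ofReal_zero, zero_add]
    rw [e3, e2 1 zero_le_one le_rfl, e2 0 le_rfl zero_le_one, arch_shift ha b d (c := 1) zero_le_one le_rfl, gG_integral ha, gG_integral ha]
    congr 1
    rw [← tsum_mul_left]
    congr 1
    ext n
    ring
  have iL : ∀ b : ℂ, Integrable (fun y : ℝ => gG a b d (y * I) * Lg y) := by
    intro b
    obtain ⟨C, hC⟩ := digamma_line_bound
    have := gG_mul_integrable ha b d 0 (h := Lg) Lg_cont.aestronglyMeasurable (C := |Real.log π / 2| + C / 2) (fun y => ?_)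
    · simpa using this
    · have hy : 1 ≤ (1 + y ^ 2) ^ 2 := by nlinarith [sq_nonneg y]
      have := hC 0 le_rfl zero_le_one y
      rw [Lg]
      refine (norm_add_le _ _).trans ?_
      rw [norm_neg, Complex.norm_real, Real.norm_eq_abs, norm_div, Complex.norm_ofNat, add_mul]
      gcongr
      · exact le_mul_of_one_le_right (abs_nonneg _) hy
      · linarith
  have hneg : ∫ y : ℝ, gG a (-b) d (y * I) * Lg y = ∫ y : ℝ, gG a b d (y * I) * Lg (-y) := by
    rw [← integral_neg_eq_self (fun y : ℝ => gG a b d (y * I) * Lg (-y))]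
    congr 1
    ext y
    rw [neg_neg, ← gG_neg]
    push_cast
    rw [neg_mul]
  have iL2 : Integrable (fun y : ℝ => gG a b d (y * I) * Lg (-y)) := by
    have := (iL (-b)).comp_neg
    refine this.congr (Eventually.of_forall fun y => ?_)
    simp only
    rw [← gG_neg]
    push_cast
    rw [neg_mul, neg_neg]
  have hphi : ∫ y : ℝ, gG a b d (y * I) * phi y = (∫ y : ℝ, gG a b d (y * I) * Lg y) + ∫ y : ℝ, gG a (-b) d (y * I) * Lg y := by
    rw [hneg, ← integral_add (iL b) iL2]
    congr 1
    ext y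
    rw [phi]
    ring
  have hpair := gG_pair ha b d (c := 1) (p0 := 1/2) (by norm_num [abs_of_pos])
  have hsm : ∀ b : ℂ, Summable (fun n : ℕ => ((vM n * (n:ℝ) ^ (-(1/2) : ℝ) : ℝ) : ℂ) * cexp (d - (b - (Real.log n : ℝ)) ^ 2 / (4 * a))) := by
    intro b
    have h0 : ((√(π/a) : ℝ) : ℂ) ≠ 0 := by
      have : 0 < √(π/a) := Real.sqrt_pos.2 (by positivity)
      exact_mod_cast this.ne'
    have := (prime_side ha b d).summable.mul_left ((√(π/a) : ℝ) : ℂ)⁻¹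
    refine this.congr fun n => ?_
    field_simp
  have hbb : ∀ n : ℕ, (-b - (Real.log n : ℝ)) ^ 2 = (b + (Real.log n : ℝ)) ^ 2 := fun n => by ring
  have s2 := hsm (-b)
  have hs := split (-b)
  simp_rw [hbb] at s2 hs
  rw [split b, hs, hphi]
  simp_rw [mul_add (((vM _ * _ : ℝ)) : ℂ)]
  rw [(hsm b).tsum_add s2, ← hpair]
  ring

/-- Gaussian weighted exponential -/
def wv (a v ω y : ℝ) : ℂ := cexp (((-a * (y - v) ^ 2 : ℝ) : ℂ) + ((ω * y : ℝ) : ℂ) * I)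

/-- sum over zeros -/
def Sv (a v ω : ℝ) : ℂ := ∑' γ : ℝ, (zm γ : ℂ) * wv a v ω γ

/-- dual Gaussian -/
def Ev (a v x : ℝ) : ℂ := cexp (((-x ^ 2 / (4 * a) : ℝ) : ℂ) + ((v * x : ℝ) : ℂ) * I)

/-- archimedean error -/
def Bv (a v ℓ ω : ℝ) : ℂ := ∫ y : ℝ, wv a v ω y * (phi y - ℓ)

/-- prime coefficients -/
def cn (n : ℕ) : ℝ := vM n * (n:ℝ) ^ (-(1/2) : ℝ)

lemma cn_nonneg (n : ℕ) : 0 ≤ cn n := mul_nonneg (vM_nonneg n) (by positivity)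

lemma norm_wv (a v ω y : ℝ) : ‖wv a v ω y‖ = Real.exp (-a * (y - v) ^ 2) := by
  rw [wv, Complex.norm_exp, Complex.add_re, Complex.ofReal_re, Complex.re_ofReal_mul]; simp

lemma norm_Ev (a v x : ℝ) : ‖Ev a v x‖ = Real.exp (-x ^ 2 / (4 * a)) := by
  rw [Ev, Complex.norm_exp, Complex.add_re, Complex.ofReal_re, Complex.re_ofReal_mul]; simp

lemma gG_wv (a v ω y : ℝ) : gG a (ω - 2 * a * v * I) (-a * v ^ 2) (y * I) = wv a v ω y := by
  rw [gG, wv]; congr 1; push_cast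
  linear_combination (a * y ^ 2 - 2 * a * v * y : ℂ) * I_sq

lemma gG_Ev {a : ℝ} (ha : 0 < a) (v ω l : ℝ) :
    cexp ((-a * v ^ 2 : ℂ) - ((ω - 2 * a * v * I) - l) ^ 2 / (4 * a)) = Ev a v (ω - l) := by
  have ha' : (a:ℂ) ≠ 0 := by exact_mod_cast ha.ne'
  rw [Ev]; congr 1; push_cast
  field_simp
  linear_combination (-4 * a ^ 2 * v ^ 2 : ℂ) * I_sq

lemma wv_cont (a v ω : ℝ) : Continuous (wv a v ω) := by unfold wv; fun_prop

lemma wv_integrable {a : ℝ} (ha : 0 < a) (v ω : ℝ) : Integrable (wv a v ω) := by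
  have := gG_integrable ha (ω - 2 * a * v * I) (-a * v ^ 2) 0
  simp_rw [Complex.ofReal_zero, zero_add, gG_wv] at this
  exact this

lemma wv_integral {a : ℝ} (ha : 0 < a) (v ω : ℝ) : ∫ y, wv a v ω y = (√(π/a) : ℝ) * Ev a v ω := by
  have := gG_integral ha (ω - 2 * a * v * I) (-a * v ^ 2) 0
  simp_rw [Complex.ofReal_zero, zero_add, gG_wv] at this
  rw [this]
  have := gG_Ev ha v ω 0
  simp only [Complex.ofReal_zero, sub_zero] at this
  rw [this]

lemma phi_bound2 : ∃ C : ℝ, ∀ y : ℝ, ‖phi y‖ ≤ C * (1 + y ^ 2) ^ 2 := by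
  obtain ⟨C, hC, h⟩ := phi_bound
  refine ⟨C + 1, fun y => ?_⟩
  have h1 := h y
  have h2 : ‖phi y‖ ≤ ‖phi y - (Real.log (1 + |y|) : ℝ)‖ + ‖((Real.log (1 + |y|) : ℝ) : ℂ)‖ := by
    have := norm_add_le (phi y - (Real.log (1 + |y|) : ℝ)) ((Real.log (1 + |y|) : ℝ) : ℂ)
    simpa using this
  rw [Complex.norm_real, Real.norm_of_nonneg (Real.log_nonneg (by linarith [abs_nonneg y]))] at h2
  have h3 := Real.log_le_sub_one_of_pos (show 0 < 1 + |y| by positivity)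
  have h4 : |y| ≤ (1 + y ^ 2) ^ 2 := by
    have e1 : |y| ^ 2 = y ^ 2 := sq_abs y
    have e2 : |y| ≤ 1 + y ^ 2 := by nlinarith [sq_nonneg (|y| - 1), sq_nonneg y]
    nlinarith [sq_nonneg y]
  have h5 : 1 ≤ (1 + y ^ 2) ^ 2 := by nlinarith [sq_nonneg y]
  nlinarith

lemma wv_phi_integrable {a : ℝ} (ha : 0 < a) (v ω : ℝ) : Integrable (fun y => wv a v ω y * phi y) := by
  obtain ⟨C, hC⟩ := phi_bound2
  have := gG_mul_integrable ha (ω - 2 * a * v * I) (-a * v ^ 2) 0 phi_cont.aestronglyMeasurable hC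
  simp_rw [Complex.ofReal_zero, zero_add, gG_wv] at this
  exact this

lemma wv_phi_split {a : ℝ} (ha : 0 < a) (v ω ℓ : ℝ) : ∫ y : ℝ, wv a v ω y * phi y = ℓ * ((√(π/a) : ℝ) * Ev a v ω) + Bv a v ℓ ω := by
  rw [← wv_integral ha, ← integral_const_mul, Bv, ← integral_add ((wv_integrable ha v ω).const_mul _)]
  · congr 1; ext y; ring
  · have := (wv_phi_integrable ha v ω).sub ((wv_integrable ha v ω).mul_const (ℓ:ℂ))
    refine this.congr (Eventually.of_forall fun y => ?_)
    simp only [Pi.sub_apply]; ring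

lemma tail_gauss {a x L : ℝ} {n : ℕ} (ha : 0 < a) (ha1 : a ≤ 1/8) (hn : 1 ≤ n) (hx : 1/2 ≤ |x|) (hxL : Real.log n - L ≤ |x|) :
    Real.exp (-x ^ 2 / (4 * a)) ≤ Real.exp (L - (1 / (8 * a) - 1) / 2) * (n:ℝ)⁻¹ := by
  have hn' : (0:ℝ) < n := by exact_mod_cast hn
  have : (n:ℝ)⁻¹ = Real.exp (- Real.log n) := by rw [Real.exp_neg, Real.exp_log hn']
  rw [this, ← Real.exp_add, Real.exp_le_exp]
  have hq : 1 ≤ 1 / (8 * a) := by rw [le_div_iff₀ (by positivity)]; linarith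
  have e : -x ^ 2 / (4 * a) = - (1 / (8 * a)) * (2 * |x| ^ 2) := by rw [sq_abs]; field_simp; ring
  rw [e]
  set q := 1 / (8 * a)
  have h1 : |x| ≤ 2 * |x| ^ 2 := by nlinarith
  have h2 : q * |x| ≤ q * (2 * |x| ^ 2) := by gcongr
  nlinarith

lemma cn_tail_summable : Summable (fun n : ℕ => cn n * (n:ℝ)⁻¹) := by
  refine vM_summable.congr fun n => ?_
  rw [cn, mul_assoc]
  rcases Nat.eq_zero_or_pos n with h0 | h0
  · subst h0; simp [vM_zero]
  · have hn' : (0:ℝ) < n := by exact_mod_cast h0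
    rw [← Real.rpow_neg_one, ← Real.rpow_add hn']
    norm_num

lemma cn_small {n : ℕ} (hn : n < 2) : cn n = 0 := by
  interval_cases n <;> simp [cn, vM_zero, vM_one]

theorem main_formula (hRH : RiemannHypothesis) : ∃ C : ℝ, 0 ≤ C ∧ ∀ (a v ω L ℓ : ℝ) (N : ℕ), 0 < a → a ≤ 1/8 → 0 ≤ ω → ω ≤ L →
    (∀ n : ℕ, N ≤ n → 2 ≤ n → 1/2 ≤ |ω - Real.log n|) →
    ‖2 * π * Sv a v ω - (√(π/a) : ℝ) * (ℓ * Ev a v ω - ∑ n ∈ Finset.range N, (cn n : ℂ) * Ev a v (ω - Real.log n)) - Bv a v ℓ ω‖ ≤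
      C * (Real.exp (L/2) + √(π/a) * Real.exp (L - (1 / (8 * a) - 1) / 2)) := by
  set K := ∑' n : ℕ, cn n * (n:ℝ)⁻¹ with hK
  have hK0 : 0 ≤ K := tsum_nonneg fun n => mul_nonneg (cn_nonneg n) (by positivity)
  refine ⟨4 * π * Real.exp 1 + 2 * K, by positivity, ?_⟩
  intro a v ω L ℓ N ha ha1 hω hωL hN
  have hL : 0 ≤ L := hω.trans hωL
  have hf := explicit_formula hRH ha (ω - 2 * a * v * I) (-a * v ^ 2)
  have hb2 : ∀ l : ℝ, (-a * v ^ 2 : ℂ) - ((ω - 2 * a * v * I) + l) ^ 2 / (4 * a) = (-a * v ^ 2 : ℂ) - ((ω - 2 * a * v * I) - ((-l : ℝ) : ℂ)) ^ 2 / (4 * a) := by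
    intro l; push_cast; ring
  simp_rw [gG_wv, hb2, gG_Ev ha, sub_neg_eq_add] at hf
  rw [wv_phi_split ha v ω ℓ] at hf
  change 2 * π * Sv a v ω = _ - _ * ∑' n : ℕ, (cn n : ℂ) * _ at hf
  set κ := √(π/a) with hκ
  have hκ0 : 0 ≤ κ := Real.sqrt_nonneg _
  set D := Real.exp (L - (1 / (8 * a) - 1) / 2) with hD
  -- split sums
  have hlog : ∀ n : ℕ, 2 ≤ n → 1/2 ≤ Real.log n := by
    intro n hn
    have h2 : Real.log 2 ≤ Real.log n := Real.log_le_log (by norm_num) (by exact_mod_cast hn)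
    have := Real.log_two_gt_d9
    linarith
  have bneg : ∀ n : ℕ, ‖(cn n : ℂ) * Ev a v (ω + Real.log n)‖ ≤ D * (cn n * (n:ℝ)⁻¹) := by
    intro n
    rw [norm_mul, norm_Ev, Complex.norm_real, Real.norm_of_nonneg (cn_nonneg n)]
    by_cases h2 : n < 2
    · simp [cn_small h2]
    · push Not at h2
      have h1 := hlog n h2
      have := tail_gauss (x := ω + Real.log n) (L := L) (n := n) ha ha1 (by omega) (by rw [abs_of_nonneg] <;> linarith) (by rw [abs_of_nonneg] <;> linarith)
      calc _ ≤ cn n * (D * (n:ℝ)⁻¹) := mul_le_mul_of_nonneg_left this (cn_nonneg n)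
        _ = _ := by ring
  set tl : ℕ → ℂ := fun n => if n ∈ Finset.range N then 0 else (cn n : ℂ) * Ev a v (ω - Real.log n) with htl
  have bpos : ∀ n : ℕ, ‖tl n‖ ≤ D * (cn n * (n:ℝ)⁻¹) := by
    intro n
    have hnn : 0 ≤ D * (cn n * (n:ℝ)⁻¹) := mul_nonneg (Real.exp_nonneg _) (mul_nonneg (cn_nonneg n) (by positivity))
    simp only [htl]
    split_ifs with hm
    · simpa using hnn
    · rw [norm_mul, norm_Ev, Complex.norm_real, Real.norm_of_nonneg (cn_nonneg n)]
      by_cases h2 : n < 2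
      · simp [cn_small h2]
      · push Not at h2
        simp at hm
        have := tail_gauss (x := ω - Real.log n) (L := L) (n := n) ha ha1 (by omega) (hN n hm h2) (by
          have := neg_abs_le (ω - Real.log n); linarith)
        calc _ ≤ cn n * (D * (n:ℝ)⁻¹) := mul_le_mul_of_nonneg_left this (cn_nonneg n)
          _ = _ := by ring
  have hsD := cn_tail_summable.mul_left D
  have sneg : Summable (fun n : ℕ => (cn n : ℂ) * Ev a v (ω + Real.log n)) := Summable.of_norm_bounded hsD bneg
  have spos : Summable tl := Summable.of_norm_bounded hsD bpos
  set fi : ℕ → ℂ := fun n => if n ∈ Finset.range N then (cn n : ℂ) * Ev a v (ω - Real.log n) else 0 with hfi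
  have sfin : HasSum fi (∑ n ∈ Finset.range N, (cn n : ℂ) * Ev a v (ω - Real.log n)) := by
    have := hasSum_sum_of_ne_finset_zero (L := SummationFilter.unconditional ℕ) (f := fi) (s := Finset.range N) (fun n hn => by simp only [hfi, if_neg hn])
    convert this using 1
    exact Finset.sum_congr rfl fun n hn => by simp only [hfi, if_pos hn]
  have htot : ∑' n : ℕ, (cn n : ℂ) * (Ev a v (ω - Real.log n) + Ev a v (ω + Real.log n)) =
      (∑ n ∈ Finset.range N, (cn n : ℂ) * Ev a v (ω - Real.log n)) + ((∑' n, tl n) + ∑' n : ℕ, (cn n : ℂ) * Ev a v (ω + Real.log n)) := by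
    rw [← sfin.tsum_eq, ← spos.tsum_add sneg, ← sfin.summable.tsum_add (spos.add sneg)]
    refine tsum_congr fun n => ?_
    simp only [hfi, htl]
    split_ifs <;> ring
  rw [htot] at hf
  have t1 : ‖∑' n, tl n‖ ≤ D * K := tsum_of_norm_bounded (cn_tail_summable.hasSum.mul_left D) bpos
  have t2 : ‖∑' n : ℕ, (cn n : ℂ) * Ev a v (ω + Real.log n)‖ ≤ D * K := tsum_of_norm_bounded (cn_tail_summable.hasSum.mul_left D) bneg
  have gp : ∀ x : ℝ, |x| ≤ 1/2 → ‖gG a (ω - 2 * a * v * I) (-a * v ^ 2) x‖ ≤ Real.exp 1 * Real.exp (L/2) := by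
    intro x hx
    rw [gG, Complex.norm_exp, ← Real.exp_add, Real.exp_le_exp]
    have hre : ((a:ℂ) * x ^ 2 + (ω - 2 * a * v * I) * x + -a * v ^ 2).re = a * x ^ 2 + ω * x - a * v ^ 2 := by
      have : (a:ℂ) * x ^ 2 + (ω - 2 * a * v * I) * x + -a * v ^ 2 = ((a * x ^ 2 + ω * x - a * v ^ 2 : ℝ) : ℂ) + ((- 2 * a * v * x : ℝ) : ℂ) * I := by
        push_cast; ring
      rw [this, Complex.add_re, Complex.re_ofReal_mul, Complex.ofReal_re, Complex.I_re]; ring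
    rw [hre]
    obtain ⟨x1, x2⟩ := abs_le.1 hx
    have hx2 : x ^ 2 ≤ 1 := by nlinarith
    have : 0 ≤ a * v ^ 2 := by positivity
    nlinarith
  have g1 := gp (1/2) (by norm_num [abs_of_pos])
  have g2 := gp (-(1/2)) (by norm_num [abs_of_pos])
  push_cast at g1 g2
  have hfin : 2 * π * Sv a v ω - (κ : ℝ) * (ℓ * Ev a v ω - ∑ n ∈ Finset.range N, (cn n : ℂ) * Ev a v (ω - Real.log n)) - Bv a v ℓ ω =
     2 * π * (gG a (ω - 2 * a * v * I) (-a * v ^ 2) (1/2) + gG a (ω - 2 * a * v * I) (-a * v ^ 2) (-(1/2))) -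
      κ * ((∑' n, tl n) + ∑' n : ℕ, (cn n : ℂ) * Ev a v (ω + Real.log n)) := by
    rw [hf]; ring
  rw [hfin]
  refine (norm_sub_le _ _).trans ?_
  have n1 : ‖(2 * π : ℂ)‖ = 2 * π := by
    rw [norm_mul, Complex.norm_real, Real.norm_of_nonneg Real.pi_pos.le]; simp
  rw [norm_mul _ (gG a _ _ _ + _), n1, norm_mul, Complex.norm_real, Real.norm_of_nonneg hκ0]
  have m1 := norm_add_le (gG a (ω - 2 * a * v * I) (-a * v ^ 2) (1/2)) (gG a (ω - 2 * a * v * I) (-a * v ^ 2) (-(1/2)))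
  have m2 := norm_add_le (∑' n, tl n) (∑' n : ℕ, (cn n : ℂ) * Ev a v (ω + Real.log n))
  have hpi := Real.pi_pos
  calc _ ≤ 2 * π * (Real.exp 1 * Real.exp (L/2) + Real.exp 1 * Real.exp (L/2)) + κ * (D * K + D * K) := by
        gcongr
        · linarith
        · linarith
    _ ≤ _ := by
        have p1 : 0 ≤ K * Real.exp (L/2) := by positivity
        have p2 : 0 ≤ π * Real.exp 1 * (κ * D) := by positivity
        nlinarith

/-- Fourier-type transform -/
def fh (h : ℝ → ℂ) (ω : ℝ) : ℂ := ∫ y : ℝ, cexp (((ω * y : ℝ) : ℂ) * I) * h y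

lemma fh_norm_le (h : ℝ → ℂ) (ω : ℝ) : ‖fh h ω‖ ≤ ∫ y, ‖h y‖ := by
  refine (norm_integral_le_integral_norm _).trans (le_of_eq ?_)
  congr 1; ext y
  rw [norm_mul, Complex.norm_exp_ofReal_mul_I, one_mul]

lemma fh_cont {h : ℝ → ℂ} (hc : Continuous h) (hi : Integrable h) : Continuous (fh h) := by
  refine continuous_of_dominated (bound := fun y => ‖h y‖) ?_ ?_ hi.norm ?_
  · intro ω
    exact (Continuous.mul (by fun_prop) hc).aestronglyMeasurable
  · intro ω
    refine Eventually.of_forall fun y => ?_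
    rw [norm_mul, Complex.norm_exp_ofReal_mul_I, one_mul]
  · refine Eventually.of_forall fun y => ?_
    fun_prop

lemma fh_sq (h : ℝ → ℂ) (ω : ℝ) :
    ((‖fh h ω‖ ^ 2 : ℝ) : ℂ) = ∫ z : ℝ × ℝ, (h z.1 * (starRingEnd ℂ) (h z.2)) * cexp (((ω * (z.1 - z.2) : ℝ) : ℂ) * I) := by
  have e1 : ((‖fh h ω‖ ^ 2 : ℝ) : ℂ) = fh h ω * (starRingEnd ℂ) (fh h ω) := by
    rw [Complex.mul_conj, Complex.normSq_eq_norm_sq]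
  rw [e1, fh, ← integral_conj, ← integral_prod_mul]
  congr 1; ext z
  rw [map_mul, ← Complex.exp_conj, map_mul, Complex.conj_ofReal, Complex.conj_I]
  have : cexp (((ω * (z.1 - z.2) : ℝ) : ℂ) * I) = cexp (((ω * z.1 : ℝ) : ℂ) * I) * cexp (((ω * z.2 : ℝ) : ℂ) * -I) := by
    rw [← Complex.exp_add]; congr 1; push_cast; ring
  rw [this]; ring

lemma planch {h : ℝ → ℂ} (hc : Continuous h) (hi : Integrable h) (h2 : Integrable (fun y => ‖h y‖ ^ 2)) {ε : ℝ} (hε : 0 < ε) :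
    ∫ ω : ℝ, Real.exp (-ε * ω ^ 2) * ‖fh h ω‖ ^ 2 ≤ 2 * π * ∫ y, ‖h y‖ ^ 2 := by
  set H : ℝ × ℝ → ℂ := fun z => h z.1 * (starRingEnd ℂ) (h z.2) with hH
  have hci : Integrable (fun y => (starRingEnd ℂ) (h y)) := by
    refine hi.mono (Complex.continuous_conj.comp hc).aestronglyMeasurable (Eventually.of_forall fun y => ?_)
    simp
  have hHi : Integrable H (volume.prod volume) := hi.mul_prod hci
  have hHc : Continuous H := (hc.comp continuous_fst).mul (Complex.continuous_conj.comp (hc.comp continuous_snd))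
  have key : ((∫ ω : ℝ, Real.exp (-ε * ω ^ 2) * ‖fh h ω‖ ^ 2 : ℝ) : ℂ) =
      ∫ z : ℝ × ℝ, H z * ((√(π/ε) : ℝ) * Ev ε 0 (z.1 - z.2)) := by
    have s1 : ((∫ ω : ℝ, Real.exp (-ε * ω ^ 2) * ‖fh h ω‖ ^ 2 : ℝ) : ℂ) = ∫ ω : ℝ, ∫ z : ℝ × ℝ, H z * wv ε 0 (z.1 - z.2) ω := by
      rw [← integral_complex_ofReal]
      congr 1; ext ω
      push_cast
      have := fh_sq h ω
      push_cast at this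
      rw [this, ← integral_const_mul]
      congr 1; ext z
      rw [hH, wv, Complex.exp_add]
      push_cast
      rw [sub_zero, mul_comm ((z.1:ℂ) - z.2) (ω:ℂ)]
      ring
    rw [s1, integral_integral_swap]
    · congr 1; ext z
      rw [integral_const_mul, wv_integral hε]
    · have hg : Integrable (fun p : ℝ × (ℝ × ℝ) => wv ε 0 0 p.1 * H p.2) (volume.prod (volume.prod volume)) :=
        (wv_integrable hε 0 0).mul_prod hHi
      refine hg.mono ?_ (Eventually.of_forall fun p => ?_)
      · refine Continuous.aestronglyMeasurable ?_
        simp only [Function.uncurry_def]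
        unfold wv
        fun_prop
      · simp only [Function.uncurry_def]
        exact le_of_eq (by rw [norm_mul (H p.2), norm_mul _ (H p.2), norm_wv, norm_wv, mul_comm])
  set G : ℝ → ℝ := fun t => √(π/ε) * Real.exp (-(1 / (4 * ε)) * t ^ 2) with hG
  have hGi : Integrable G := (integrable_exp_neg_mul_sq (by positivity)).const_mul _
  have hGint : ∫ t, G t = 2 * π := by
    rw [hG, integral_const_mul, integral_gaussian, ← Real.sqrt_mul (by positivity)]
    have : π / ε * (π / (1 / (4 * ε))) = (2 * π) ^ 2 := by field_simp; ring
    rw [this, Real.sqrt_sq (by positivity)]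
  have hc1 : Integrable (fun p : ℝ × ℝ => ‖h p.2‖ ^ 2 * G (p.1 - p.2)) (volume.prod volume) :=
    h2.convolution_integrand (ContinuousLinearMap.mul ℝ ℝ) hGi
  have hi1 : ∫ p : ℝ × ℝ, ‖h p.2‖ ^ 2 * G (p.1 - p.2) = (∫ y, ‖h y‖ ^ 2) * (2 * π) := by
    have := integral_convolution (L := ContinuousLinearMap.mul ℝ ℝ) (μ := volume) (ν := volume) h2 hGi
    rw [hGint] at this
    simp only [ContinuousLinearMap.mul_apply'] at this
    rw [← this]
    rw [Measure.volume_eq_prod, integral_prod _ hc1]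
    rfl
  have hGe : ∀ t, G (-t) = G t := fun t => by simp [hG]
  have hc2 : Integrable (fun p : ℝ × ℝ => ‖h p.1‖ ^ 2 * G (p.1 - p.2)) (volume.prod volume) := by
    have := hc1.swap
    refine this.congr (Eventually.of_forall fun p => ?_)
    simp only [Function.comp, Prod.swap]
    rw [← hGe, neg_sub]
  have hi2 : ∫ p : ℝ × ℝ, ‖h p.1‖ ^ 2 * G (p.1 - p.2) = (∫ y, ‖h y‖ ^ 2) * (2 * π) := by
    rw [← hi1, Measure.volume_eq_prod, ← integral_prod_swap]
    congr 1; ext p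
    simp only [Prod.swap]
    rw [← hGe, neg_sub]
  have hn : ∫ ω : ℝ, Real.exp (-ε * ω ^ 2) * ‖fh h ω‖ ^ 2 ≤ ‖∫ z : ℝ × ℝ, H z * ((√(π/ε) : ℝ) * Ev ε 0 (z.1 - z.2))‖ := by
    rw [← key, Complex.norm_real]; exact le_abs_self _
  refine hn.trans ?_
  calc ‖∫ z : ℝ × ℝ, H z * ((√(π/ε) : ℝ) * Ev ε 0 (z.1 - z.2))‖ ≤ ∫ z : ℝ × ℝ, (1/2) * (‖h z.1‖ ^ 2 * G (z.1 - z.2) + ‖h z.2‖ ^ 2 * G (z.1 - z.2)) := by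
        refine norm_integral_le_of_norm_le ((hc2.add hc1).const_mul _) (Eventually.of_forall fun z => ?_)
        have g0 : ‖((√(π/ε) : ℝ) : ℂ) * Ev ε 0 (z.1 - z.2)‖ = G (z.1 - z.2) := by
          rw [norm_mul, norm_Ev, Complex.norm_real, Real.norm_of_nonneg (Real.sqrt_nonneg _), hG]
          congr 2; ring
        have g1 : 0 ≤ G (z.1 - z.2) := by rw [hG]; positivity
        rw [norm_mul, g0, hH]
        simp only [norm_mul, RCLike.norm_conj]
        nlinarith [mul_nonneg (sq_nonneg (‖h z.1‖ - ‖h z.2‖)) g1]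
    _ = 2 * π * ∫ y, ‖h y‖ ^ 2 := by
        rw [integral_const_mul, Measure.volume_eq_prod, integral_add hc2 hc1, ← Measure.volume_eq_prod, hi1, hi2]; ring

lemma planch_local {h : ℝ → ℂ} (hc : Continuous h) (hi : Integrable h) (h2 : Integrable (fun y => ‖h y‖ ^ 2)) {L : ℝ} (hL : 0 < L) :
    ∫ ω in (0:ℝ)..L, ‖fh h ω‖ ^ 2 ≤ 2 * π * Real.exp 1 * ∫ y, ‖h y‖ ^ 2 := by
  have hp := planch hc hi h2 (ε := 1 / L ^ 2) (by positivity)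
  have hcf := fh_cont hc hi
  have hintg : Integrable (fun ω : ℝ => Real.exp (-(1 / L ^ 2) * ω ^ 2) * ‖fh h ω‖ ^ 2) := by
    refine (integrable_exp_neg_mul_sq (b := 1 / L ^ 2) (by positivity)).mul_bdd (c := (∫ y, ‖h y‖) ^ 2) (by fun_prop) (Eventually.of_forall fun ω => ?_)
    rw [norm_pow, norm_norm]
    gcongr; exact fh_norm_le h ω
  have h1 : ∫ ω in (0:ℝ)..L, ‖fh h ω‖ ^ 2 ≤ ∫ ω in (0:ℝ)..L, Real.exp 1 * (Real.exp (-(1 / L ^ 2) * ω ^ 2) * ‖fh h ω‖ ^ 2) := by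
    refine intervalIntegral.integral_mono_on hL.le (by apply Continuous.intervalIntegrable; fun_prop) (by apply Continuous.intervalIntegrable; fun_prop) fun ω hω => ?_
    rw [← mul_assoc, ← Real.exp_add]
    have : 1 ≤ Real.exp (1 + -(1 / L ^ 2) * ω ^ 2) := by
      apply Real.one_le_exp
      have : 1 / L ^ 2 * ω ^ 2 ≤ 1 := by
        rw [div_mul_eq_mul_div, one_mul, div_le_one (by positivity)]
        exact pow_le_pow_left₀ hω.1 hω.2 2
      linarith
    nlinarith [sq_nonneg ‖fh h ω‖]
  rw [intervalIntegral.integral_const_mul] at h1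
  have h3 : ∫ ω in Ioc 0 L, Real.exp (-(1 / L ^ 2) * ω ^ 2) * ‖fh h ω‖ ^ 2 ≤ ∫ ω, Real.exp (-(1 / L ^ 2) * ω ^ 2) * ‖fh h ω‖ ^ 2 :=
    setIntegral_le_integral hintg (Eventually.of_forall fun ω => by positivity)
  rw [← intervalIntegral.integral_of_le hL.le] at h3
  calc _ ≤ _ := h1
    _ ≤ Real.exp 1 * (2 * π * ∫ y, ‖h y‖ ^ 2) := by
      gcongr; exact h3.trans hp
    _ = _ := by ring

lemma log_sq_le {u : ℝ} (hu : 1 ≤ u) : Real.log u ^ 2 ≤ 4 * u := by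
  have h0 : 0 < u := by linarith
  have h1 : Real.log u = 2 * Real.log (√u) := by rw [Real.log_sqrt h0.le]; ring
  have h2 : Real.log (√u) ≤ √u := by
    have := Real.log_le_sub_one_of_pos (Real.sqrt_pos.2 h0); linarith
  have h3 : 0 ≤ Real.log (√u) := Real.log_nonneg (by rw [Real.one_le_sqrt]; exact hu)
  have h4 : √u ^ 2 = u := Real.sq_sqrt h0.le
  rw [h1]; nlinarith

lemma log_sq_cut {u ℓ : ℝ} (hu : 0 < u) (hℓ : 1 ≤ ℓ) (hl : -ℓ ≤ Real.log u) :
    Real.log u ^ 2 ≤ 4 * u + 4 * ℓ + (if u ≤ 1 / ℓ then ℓ ^ 2 else 0) := by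
  rcases le_or_gt 1 u with h1 | h1
  · have := log_sq_le h1
    split_ifs <;> nlinarith [sq_nonneg ℓ]
  · have h2 : Real.log u < 0 := Real.log_neg hu h1
    split_ifs with h3
    · nlinarith
    · push Not at h3
      have h4 := log_sq_le (u := 1 / u) (by rw [le_div_iff₀ hu]; linarith)
      rw [one_div, Real.log_inv, neg_sq] at h4
      have : u⁻¹ ≤ ℓ := by
        rw [inv_le_comm₀ hu (by linarith), ← one_div]; exact h3.le
      linarith

/-- the archimedean integrand -/
def hvv (a v ℓ y : ℝ) : ℂ := ((Real.exp (-a * (y - v) ^ 2) : ℝ) : ℂ) * (phi y - ℓ)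

lemma hv_cont (a v ℓ : ℝ) : Continuous (hvv a v ℓ) := by
  unfold hvv
  have := phi_cont
  fun_prop

lemma Bv_eq (a v ℓ ω : ℝ) : Bv a v ℓ ω = fh (hvv a v ℓ) ω := by
  rw [Bv, fh]; congr 1; ext y
  rw [wv, hvv, Complex.exp_add, Complex.ofReal_exp]; ring

lemma hv_norm (a v ℓ y : ℝ) : ‖hvv a v ℓ y‖ = Real.exp (-a * (y - v) ^ 2) * ‖phi y - ℓ‖ := by
  rw [hvv, norm_mul, Complex.norm_real, Real.norm_of_nonneg (Real.exp_nonneg _)]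

lemma hv_integrable {a : ℝ} (ha : 0 < a) (v ℓ : ℝ) : Integrable (hvv a v ℓ) := by
  have := (wv_phi_integrable ha v 0).sub ((wv_integrable ha v 0).mul_const (ℓ:ℂ))
  refine this.congr (Eventually.of_forall fun y => ?_)
  simp only [Pi.sub_apply, hvv, wv]; push_cast; ring_nf

lemma gauss_int {q : ℝ} (hq : 0 < q) (v : ℝ) : Integrable (fun y : ℝ => Real.exp (-q * (y - v) ^ 2)) :=
  (integrable_exp_neg_mul_sq hq).comp_sub_right v

lemma gauss_integral (q : ℝ) (v : ℝ) : ∫ y : ℝ, Real.exp (-q * (y - v) ^ 2) = √(π / q) := by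
  rw [integral_sub_right_eq_self (fun y : ℝ => Real.exp (-q * y ^ 2)) v, integral_gaussian]

lemma J_bound {c : ℝ} (hc : 0 < c) : ∃ C : ℝ, 0 ≤ C ∧ ∀ T v : ℝ, 3 ≤ T → |v| ≤ 2 * T →
    Integrable (fun y => Real.exp (-(c / T ^ 2) * (y - v) ^ 2) * ‖phi y - (Real.log T : ℝ)‖ ^ 2) ∧
    ∫ y, Real.exp (-(c / T ^ 2) * (y - v) ^ 2) * ‖phi y - (Real.log T : ℝ)‖ ^ 2 ≤ C * (T * Real.log T) := by
  obtain ⟨C0, hC0, hphi⟩ := phi_bound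
  refine ⟨√(π/c) * (2 * C0 ^ 2 + 40) + (16/c) * √(2*π/c) + 4, by positivity, fun T v hT hv => ?_⟩
  have hT0 : 0 < T := by linarith
  set ℓ := Real.log T with hℓ
  have hℓ1 : 1 ≤ ℓ := by
    rw [hℓ, Real.le_log_iff_exp_le hT0]; linarith [Real.exp_one_lt_d9]
  set q := c / T ^ 2 with hq
  have hq0 : 0 < q := by positivity
  set M : ℝ → ℝ := fun y => (2 * C0 ^ 2 + 32 + 8 * ℓ) * Real.exp (-q * (y - v) ^ 2) + (16/c) * Real.exp (-(q/2) * (y - v) ^ 2) +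
    (Set.Icc (-(T/ℓ)) (T/ℓ)).indicator (fun _ => 2 * ℓ ^ 2) y with hM
  have i1 : Integrable (fun y : ℝ => (2 * C0 ^ 2 + 32 + 8 * ℓ) * Real.exp (-q * (y - v) ^ 2)) := (gauss_int hq0 v).const_mul _
  have i2 : Integrable (fun y : ℝ => (16/c) * Real.exp (-(q/2) * (y - v) ^ 2)) := (gauss_int (half_pos hq0) v).const_mul _
  have i3 : Integrable ((Set.Icc (-(T/ℓ)) (T/ℓ)).indicator (fun _ => 2 * ℓ ^ 2)) :=
    (integrable_indicator_iff measurableSet_Icc).2 (integrableOn_const (by simp))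
  have iM : Integrable M := (i1.add i2).add i3
  have hle : ∀ y, Real.exp (-q * (y - v) ^ 2) * ‖phi y - (ℓ : ℝ)‖ ^ 2 ≤ M y := by
    intro y
    set u := (1 + |y|) / T with hu
    have hy := abs_nonneg y
    have hu0 : 0 < u := by positivity
    have hlu : Real.log u = Real.log (1 + |y|) - ℓ := Real.log_div (by positivity) hT0.ne'
    have hl : -ℓ ≤ Real.log u := by
      rw [hlu]; linarith [Real.log_nonneg (show 1 ≤ 1 + |y| by linarith)]
    have hcut := log_sq_cut hu0 hℓ1 hl
    have hn : ‖phi y - (ℓ : ℝ)‖ ≤ C0 + |Real.log u| := by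
      have e : phi y - (ℓ:ℝ) = (phi y - (Real.log (1 + |y|) : ℝ)) + ((Real.log u : ℝ) : ℂ) := by
        rw [hlu]; push_cast; ring
      rw [e]
      refine (norm_add_le _ _).trans ?_
      rw [Complex.norm_real, Real.norm_eq_abs]
      linarith [hphi y]
    have hn2 : ‖phi y - (ℓ : ℝ)‖ ^ 2 ≤ 2 * C0 ^ 2 + 2 * Real.log u ^ 2 := by
      have := sq_abs (Real.log u)
      have h0 := norm_nonneg (phi y - (ℓ : ℝ))
      nlinarith [sq_nonneg (C0 - |Real.log u|)]
    have hu4 : u ≤ 4 + (y - v) ^ 2 / T ^ 2 := by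
      set x := |y - v| / T with hx
      have hx2 : (y - v) ^ 2 / T ^ 2 = x ^ 2 := by rw [hx, div_pow, sq_abs]
      have : u ≤ 3 + x := by
        rw [hu, hx, div_le_iff₀ hT0]
        have : (3 + |y - v| / T) * T = 3 * T + |y - v| := by field_simp
        rw [this]
        have := abs_add_le (y - v) v
        rw [sub_add_cancel] at this
        linarith
      rw [hx2]; nlinarith [sq_nonneg (x - 1/2)]
    have hind : (if u ≤ 1 / ℓ then ℓ ^ 2 else 0) * 2 ≤ (Set.Icc (-(T/ℓ)) (T/ℓ)).indicator (fun _ => 2 * ℓ ^ 2) y := by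
      split_ifs with h
      · have hm : y ∈ Set.Icc (-(T/ℓ)) (T/ℓ) := by
          rw [Set.mem_Icc, ← abs_le]
          rw [hu, div_le_iff₀ hT0] at h
          have : 1 / ℓ * T = T / ℓ := by ring
          linarith
        rw [Set.indicator_of_mem hm]; linarith
      · rw [zero_mul]; exact Set.indicator_nonneg (fun _ _ => by positivity) _
    set g := Real.exp (-q * (y - v) ^ 2) with hg
    have hg0 : 0 ≤ g := Real.exp_nonneg _
    have hg1 : g ≤ 1 := by
      rw [hg, Real.exp_le_one_iff]
      have : 0 ≤ q * (y - v) ^ 2 := by positivity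
      linarith
    have hgx : g * ((y - v) ^ 2 / T ^ 2) ≤ 2 / c * Real.exp (-(q/2) * (y - v) ^ 2) := by
      have e1 : g = Real.exp (-(q/2) * (y - v) ^ 2) * Real.exp (-(q/2) * (y - v) ^ 2) := by
        rw [hg, ← Real.exp_add]; congr 1; ring
      have e2 : (y - v) ^ 2 / T ^ 2 = 2 / c * (q / 2 * (y - v) ^ 2) := by rw [hq]; field_simp
      have e3 : q / 2 * (y - v) ^ 2 * Real.exp (-(q/2) * (y - v) ^ 2) ≤ 1 := by
        have h1 := Real.add_one_le_exp (q / 2 * (y - v) ^ 2)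
        rw [neg_mul, Real.exp_neg, ← div_eq_mul_inv, div_le_one (Real.exp_pos _)]
        linarith
      rw [e1, e2]
      set p := Real.exp (-(q/2) * (y - v) ^ 2)
      have p0 : 0 ≤ 2 / c * p := by positivity
      calc _ = 2 / c * p * (q / 2 * (y - v) ^ 2 * p) := by ring
        _ ≤ 2 / c * p * 1 := by gcongr
        _ = _ := by ring
    have hi0 : 0 ≤ (if u ≤ 1 / ℓ then ℓ ^ 2 else 0) := by split_ifs <;> positivity
    set ii := (if u ≤ 1 / ℓ then ℓ ^ 2 else 0)
    calc g * ‖phi y - (ℓ : ℝ)‖ ^ 2 ≤ g * (2 * C0 ^ 2 + 2 * (4 * (4 + (y - v) ^ 2 / T ^ 2) + 4 * ℓ + ii)) := by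
          gcongr; linarith
      _ = (2 * C0 ^ 2 + 32 + 8 * ℓ) * g + 8 * (g * ((y - v) ^ 2 / T ^ 2)) + g * (ii * 2) := by ring
      _ ≤ (2 * C0 ^ 2 + 32 + 8 * ℓ) * g + 8 * (2 / c * Real.exp (-(q/2) * (y - v) ^ 2)) + 1 * (ii * 2) := by gcongr
      _ ≤ _ := by
          rw [hM]; simp only
          have : 8 * (2 / c * Real.exp (-(q/2) * (y - v) ^ 2)) = 16 / c * Real.exp (-(q/2) * (y - v) ^ 2) := by ring
          linarith
  constructor
  · refine iM.mono' ?_ (Eventually.of_forall fun y => ?_)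
    · have := phi_cont
      exact Continuous.aestronglyMeasurable (by fun_prop)
    · rw [Real.norm_of_nonneg (by positivity)]; exact hle y
  · refine (integral_mono_of_nonneg (Eventually.of_forall fun y => by positivity) iM (Eventually.of_forall hle)).trans ?_
    have e1 : √(π / q) = T * √(π/c) := by
      have : π / q = T ^ 2 * (π / c) := by rw [hq]; field_simp
      rw [this, Real.sqrt_mul (by positivity), Real.sqrt_sq hT0.le]
    have e2 : √(π / (q/2)) = T * √(2*π/c) := by
      have : π / (q/2) = T ^ 2 * (2*π / c) := by rw [hq]; field_simp
      rw [this, Real.sqrt_mul (by positivity), Real.sqrt_sq hT0.le]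
    have eM : ∫ y, M y = (∫ y, ((2 * C0 ^ 2 + 32 + 8 * ℓ) * Real.exp (-q * (y - v) ^ 2))) + (∫ y, ((16/c) * Real.exp (-(q/2) * (y - v) ^ 2))) +
        ∫ y, (Set.Icc (-(T/ℓ)) (T/ℓ)).indicator (fun _ => 2 * ℓ ^ 2) y := by
      rw [← integral_add i1 i2, ← integral_add (by exact i1.add i2) i3]
    rw [eM, integral_const_mul, integral_const_mul, gauss_integral, gauss_integral,
      integral_indicator measurableSet_Icc, setIntegral_const, e1, e2]
    have e3 : (volume.real (Set.Icc (-(T/ℓ)) (T/ℓ))) = 2 * (T/ℓ) := by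
      rw [Measure.real, Real.volume_Icc, ENNReal.toReal_ofReal (by have : 0 ≤ T/ℓ := by positivity
                                                                   linarith)]; ring
    rw [e3, smul_eq_mul]
    have e4 : 2 * (T/ℓ) * (2 * ℓ ^ 2) = 4 * (T * ℓ) := by field_simp; ring
    rw [e4]
    have s1 : 0 ≤ √(π/c) := Real.sqrt_nonneg _
    have s2 : 0 ≤ √(2*π/c) := Real.sqrt_nonneg _
    have t1 : T ≤ T * ℓ := by nlinarith
    calc _ = (2 * C0 ^ 2 + 32) * √(π/c) * T + 8 * √(π/c) * (T * ℓ) + 16/c * √(2*π/c) * T + 4 * (T * ℓ) := by ring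
      _ ≤ (2 * C0 ^ 2 + 32) * √(π/c) * (T * ℓ) + 8 * √(π/c) * (T * ℓ) + 16/c * √(2*π/c) * (T * ℓ) + 4 * (T * ℓ) := by gcongr
      _ = _ := by ring

lemma B_l2 {c : ℝ} (hc : 0 < c) : ∃ C : ℝ, 0 ≤ C ∧ ∀ T v L : ℝ, 3 ≤ T → |v| ≤ 2 * T → 0 < L →
    ∫ ω in (0:ℝ)..L, ‖Bv (c / T ^ 2) v (Real.log T) ω‖ ^ 2 ≤ C * (T * Real.log T) := by
  obtain ⟨C, hC, h⟩ := J_bound (c := 2 * c) (by positivity)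
  refine ⟨2 * π * Real.exp 1 * C, by positivity, fun T v L hT hv hL => ?_⟩
  obtain ⟨h1, h2⟩ := h T v hT hv
  have e : (fun y => ‖hvv (c / T ^ 2) v (Real.log T) y‖ ^ 2) = (fun y => Real.exp (-(2 * c / T ^ 2) * (y - v) ^ 2) * ‖phi y - (Real.log T : ℝ)‖ ^ 2) := by
    ext y
    rw [hv_norm, mul_pow, ← Real.exp_nat_mul]; congr 2; push_cast; ring
  simp_rw [Bv_eq]
  refine (planch_local (hv_cont _ _ _) (hv_integrable (by positivity) _ _) (by rw [e]; exact h1) hL).trans ?_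
  rw [e, mul_assoc _ C]
  gcongr

lemma B_zero {c : ℝ} (hc : 0 < c) : ∃ C : ℝ, 0 ≤ C ∧ ∀ T v : ℝ, 3 ≤ T → |v| ≤ 2 * T →
    ‖Bv (c / T ^ 2) v (Real.log T) 0‖ ≤ C * (T * √(Real.log T)) := by
  obtain ⟨C, hC, h⟩ := J_bound hc
  refine ⟨√(π/c) + C, by positivity, fun T v hT hv => ?_⟩
  obtain ⟨h1, h2⟩ := h T v hT hv
  have hT0 : 0 < T := by linarith
  have hq : 0 < c / T ^ 2 := by positivity
  have hℓ1 : 1 ≤ Real.log T := by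
    rw [Real.le_log_iff_exp_le hT0]; linarith [Real.exp_one_lt_d9]
  set ℓ := Real.log T
  set s := √ℓ with hs
  have hs2 : s ^ 2 = ℓ := Real.sq_sqrt (by linarith)
  have hs0 : 0 < s := Real.sqrt_pos.2 (by linarith)
  rw [Bv_eq]
  refine (fh_norm_le _ _).trans ?_
  have hmaj : ∀ y, ‖hvv (c / T ^ 2) v ℓ y‖ ≤ s * Real.exp (-(c / T ^ 2) * (y - v) ^ 2) + s⁻¹ * (Real.exp (-(c / T ^ 2) * (y - v) ^ 2) * ‖phi y - (ℓ : ℝ)‖ ^ 2) := by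
    intro y
    rw [hv_norm]
    have g0 := Real.exp_nonneg (-(c / T ^ 2) * (y - v) ^ 2)
    set g := Real.exp (-(c / T ^ 2) * (y - v) ^ 2)
    set p := ‖phi y - (ℓ : ℝ)‖
    have : p ≤ s + s⁻¹ * p ^ 2 := by
      have e : s + s⁻¹ * p ^ 2 - p = s⁻¹ * (s ^ 2 - s * p + p ^ 2) := by field_simp; ring
      have : 0 ≤ s⁻¹ * (s ^ 2 - s * p + p ^ 2) := mul_nonneg (by positivity) (by nlinarith [sq_nonneg (s - p), sq_nonneg (s+p)])
      linarith
    nlinarith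
  refine (integral_mono (hv_integrable hq v ℓ).norm (((gauss_int hq v).const_mul s).add (h1.const_mul s⁻¹)) hmaj).trans ?_
  have e1 : √(π / (c / T ^ 2)) = T * √(π/c) := by
    have : π / (c / T ^ 2) = T ^ 2 * (π / c) := by field_simp
    rw [this, Real.sqrt_mul (by positivity), Real.sqrt_sq hT0.le]
  rw [integral_add' (((gauss_int hq v).const_mul s)) (h1.const_mul s⁻¹), integral_const_mul, integral_const_mul, gauss_integral, e1]
  have : s⁻¹ * (C * (T * ℓ)) = C * (T * s) := by rw [← hs2]; field_simp
  have h3 : s⁻¹ * ∫ y, Real.exp (-(c / T ^ 2) * (y - v) ^ 2) * ‖phi y - (ℓ : ℝ)‖ ^ 2 ≤ s⁻¹ * (C * (T * ℓ)) := by gcongr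
  rw [this] at h3
  linarith

lemma cos_int (L u : ℝ) (hu : u ≠ 0) : ∫ ω in (0:ℝ)..L, (L - ω) * Real.cos (ω * u) = (1 - Real.cos (L * u)) / u ^ 2 := by
  have hd : ∀ x ∈ uIcc 0 L, HasDerivAt (fun ω : ℝ => (L - ω) * (Real.sin (ω * u) / u) - Real.cos (ω * u) / u ^ 2) ((L - x) * Real.cos (x * u)) x := by
    intro x _
    have h1 : HasDerivAt (fun ω : ℝ => ω * u) u x := by simpa using (hasDerivAt_id x).mul_const u
    have h2 := ((hasDerivAt_id x).const_sub L).mul ((h1.sin).div_const u)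
    have h3 := h2.sub ((h1.cos).div_const (u ^ 2))
    have h4 : -1 * (Real.sin (x * u) / u) + (L - id x) * (Real.cos (x * u) * u / u) - -Real.sin (x * u) * u / u ^ 2 = (L - x) * Real.cos (x * u) := by
      simp only [id]
      field_simp; ring
    rw [h4] at h3
    exact h3
  rw [intervalIntegral.integral_eq_sub_of_hasDerivAt hd (by apply Continuous.intervalIntegrable; fun_prop)]
  simp
  ring

lemma cos_int_nonneg (L u : ℝ) (hL : 0 ≤ L) : 0 ≤ ∫ ω in (0:ℝ)..L, (L - ω) * Real.cos (ω * u) := by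
  by_cases hu : u = 0
  · subst hu
    apply intervalIntegral.integral_nonneg hL
    intro x hx; simp; exact hx.2
  · rw [cos_int L u hu]
    exact div_nonneg (by linarith [Real.cos_le_one (L * u)]) (sq_nonneg u)

lemma lin_int (L : ℝ) : ∫ ω in (0:ℝ)..L, (L - ω) = L ^ 2 / 2 := by
  rw [intervalIntegral.integral_sub (by simp) (by simp)]
  simp; ring

lemma norm_sq_sum (F : Finset ℝ) (z : ℝ → ℝ) (ω : ℝ) : ‖∑ γ ∈ F, (z γ : ℂ) * cexp (((ω * γ : ℝ) : ℂ) * I)‖ ^ 2 =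
    ∑ γ ∈ F, ∑ γ' ∈ F, z γ * z γ' * Real.cos (ω * (γ - γ')) := by
  have h : ((‖∑ γ ∈ F, (z γ : ℂ) * cexp (((ω * γ : ℝ) : ℂ) * I)‖ ^ 2 : ℝ) : ℂ) =
      ∑ γ ∈ F, ∑ γ' ∈ F, ((z γ * z γ' : ℝ) : ℂ) * cexp (((ω * (γ - γ') : ℝ) : ℂ) * I) := by
    rw [← Complex.normSq_eq_norm_sq, ← Complex.mul_conj, map_sum, Finset.sum_mul_sum]
    refine Finset.sum_congr rfl fun γ _ => Finset.sum_congr rfl fun γ' _ => ?_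
    rw [map_mul, ← Complex.exp_conj, map_mul, Complex.conj_ofReal, Complex.conj_I, Complex.conj_ofReal]
    have : cexp (((ω * (γ - γ') : ℝ) : ℂ) * I) = cexp (((ω * γ : ℝ) : ℂ) * I) * cexp (((ω * γ' : ℝ) : ℂ) * -I) := by
      rw [← Complex.exp_add]; congr 1; push_cast; ring
    rw [this]; push_cast; ring
  have h2 := congrArg Complex.re h
  rw [Complex.ofReal_re] at h2
  rw [h2, Complex.re_sum]
  refine Finset.sum_congr rfl fun γ _ => ?_
  rw [Complex.re_sum]
  refine Finset.sum_congr rfl fun γ' _ => ?_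
  rw [Complex.re_ofReal_mul, Complex.exp_ofReal_mul_I_re]

lemma finite_lower (F : Finset ℝ) (z : ℝ → ℝ) (hz : ∀ γ, 0 ≤ z γ) {L : ℝ} (hL : 0 ≤ L) :
    L ^ 2 / 2 * ∑ γ ∈ F, z γ ^ 2 ≤ ∫ ω in (0:ℝ)..L, (L - ω) * ‖∑ γ ∈ F, (z γ : ℂ) * cexp (((ω * γ : ℝ) : ℂ) * I)‖ ^ 2 := by
  have e : ∫ ω in (0:ℝ)..L, (L - ω) * ‖∑ γ ∈ F, (z γ : ℂ) * cexp (((ω * γ : ℝ) : ℂ) * I)‖ ^ 2 =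
      ∑ γ ∈ F, ∑ γ' ∈ F, z γ * z γ' * ∫ ω in (0:ℝ)..L, (L - ω) * Real.cos (ω * (γ - γ')) := by
    simp_rw [norm_sq_sum, Finset.mul_sum]
    rw [intervalIntegral.integral_finsetSum (fun γ _ => by apply Continuous.intervalIntegrable; fun_prop)]
    refine Finset.sum_congr rfl fun γ _ => ?_
    rw [intervalIntegral.integral_finsetSum (fun γ _ => by apply Continuous.intervalIntegrable; fun_prop)]
    refine Finset.sum_congr rfl fun γ' _ => ?_
    rw [← intervalIntegral.integral_const_mul]
    congr 1; ext ω; ring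
  rw [e, Finset.mul_sum]
  refine Finset.sum_le_sum fun γ hγ => ?_
  have hnn : ∀ γ' ∈ F, 0 ≤ z γ * z γ' * ∫ ω in (0:ℝ)..L, (L - ω) * Real.cos (ω * (γ - γ')) := fun γ' _ =>
    mul_nonneg (mul_nonneg (hz _) (hz _)) (cos_int_nonneg L _ hL)
  refine le_trans (le_of_eq ?_) (Finset.single_le_sum hnn hγ)
  have : ∫ ω in (0:ℝ)..L, (L - ω) * Real.cos (ω * (γ - γ)) = L ^ 2 / 2 := by
    rw [← lin_int]; congr 1; ext ω; simp
  rw [this]; ring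

/-- weights -/
def zw (a v γ : ℝ) : ℝ := zm γ * Real.exp (-a * (γ - v) ^ 2)

lemma zw_nonneg (a v γ : ℝ) : 0 ≤ zw a v γ := mul_nonneg (Nat.cast_nonneg _) (Real.exp_nonneg _)

lemma zw_term (a v ω γ : ℝ) : (zm γ : ℂ) * wv a v ω γ = (zw a v γ : ℂ) * cexp (((ω * γ : ℝ) : ℂ) * I) := by
  rw [wv, zw, Complex.exp_add]; push_cast; ring

lemma norm_term (a v ω γ : ℝ) : ‖(zm γ : ℂ) * wv a v ω γ‖ = zw a v γ := by
  rw [norm_mul, norm_wv, zw]; simp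

lemma zw_summable {a : ℝ} (ha : 0 < a) (v : ℝ) : Summable (zw a v) := by
  have := (summable_zm_gG ha ((0:ℝ) - 2 * a * v * I) (-a * v ^ 2)).norm
  simp_rw [gG_wv, norm_term] at this
  exact this

lemma Sv_cont {a : ℝ} (ha : 0 < a) (v : ℝ) : Continuous (Sv a v) := by
  unfold Sv
  refine continuous_tsum (u := zw a v) (fun γ => ?_) (zw_summable ha v) (fun γ ω => (norm_term a v ω γ).le)
  unfold wv; fun_prop

lemma Sv_lower {a : ℝ} (ha : 0 < a) (v : ℝ) (F : Finset ℝ) {L : ℝ} (hL : 0 ≤ L) :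
    L ^ 2 / 2 * ∑ γ ∈ F, zw a v γ ^ 2 ≤ ∫ ω in (0:ℝ)..L, (L - ω) * ‖Sv a v ω‖ ^ 2 := by
  have hs := zw_summable ha v
  set K := ∑' γ, zw a v γ with hK
  have hK0 : 0 ≤ K := tsum_nonneg (zw_nonneg a v)
  have hcont := Sv_cont ha v
  refine le_of_forall_pos_le_add fun η hη => ?_
  set ε := η / (K * L ^ 2 + 1) with hε
  have hε0 : 0 < ε := by positivity
  have hev : ∀ᶠ G : Finset ℝ in atTop, K - ε < ∑ γ ∈ G, zw a v γ :=
    hs.hasSum.eventually (lt_mem_nhds (by linarith))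
  obtain ⟨G, hG1, hG2⟩ := (hev.and (eventually_ge_atTop F)).exists
  have hdiff : ∀ ω, ‖Sv a v ω - ∑ γ ∈ G, (zw a v γ : ℂ) * cexp (((ω * γ : ℝ) : ℂ) * I)‖ ≤ ε := by
    intro ω
    have hsum : Summable (fun γ => (zm γ : ℂ) * wv a v ω γ) := Summable.of_norm (by simp_rw [norm_term]; exact hs)
    have e1 : Sv a v ω - ∑ γ ∈ G, (zw a v γ : ℂ) * cexp (((ω * γ : ℝ) : ℂ) * I) = ∑' γ : {x // x ∉ G}, (zm (γ:ℝ) : ℂ) * wv a v ω γ := by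
      rw [Sv, ← hsum.sum_add_tsum_subtype_compl G]
      simp_rw [← zw_term]; ring
    rw [e1]
    have e2 := hs.sum_add_tsum_subtype_compl G
    have e3 : ‖∑' γ : {x // x ∉ G}, (zm (γ:ℝ) : ℂ) * wv a v ω γ‖ ≤ ∑' γ : {x // x ∉ G}, zw a v γ := by
      refine tsum_of_norm_bounded (hs.subtype _).hasSum fun γ => ?_
      rw [norm_term]; rfl
    linarith
  have hSb : ∀ ω, ‖Sv a v ω‖ ≤ K := fun ω => tsum_of_norm_bounded hs.hasSum fun γ => (norm_term a v ω γ).le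
  have hGb : ∀ ω, ‖∑ γ ∈ G, (zw a v γ : ℂ) * cexp (((ω * γ : ℝ) : ℂ) * I)‖ ≤ K := by
    intro ω
    refine (norm_sum_le _ _).trans ?_
    simp_rw [← zw_term, norm_term]
    exact hs.sum_le_tsum G (fun γ _ => zw_nonneg a v γ)
  have hf := finite_lower G (zw a v) (zw_nonneg a v) hL
  have hFG : ∑ γ ∈ F, zw a v γ ^ 2 ≤ ∑ γ ∈ G, zw a v γ ^ 2 := Finset.sum_le_sum_of_subset_of_nonneg hG2 fun _ _ _ => sq_nonneg _
  have hmono : ∫ ω in (0:ℝ)..L, (L - ω) * ‖∑ γ ∈ G, (zw a v γ : ℂ) * cexp (((ω * γ : ℝ) : ℂ) * I)‖ ^ 2 ≤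
      ∫ ω in (0:ℝ)..L, ((L - ω) * ‖Sv a v ω‖ ^ 2 + (L - ω) * (2 * K * ε)) := by
    refine intervalIntegral.integral_mono_on hL (by apply Continuous.intervalIntegrable; fun_prop) (by apply Continuous.intervalIntegrable; fun_prop) fun ω hω => ?_
    rw [← mul_add]
    refine mul_le_mul_of_nonneg_left ?_ (by linarith [hω.2])
    have h1 := hdiff ω
    have h2 := hSb ω
    have h3 := hGb ω
    set s := Sv a v ω
    set g := ∑ γ ∈ G, (zw a v γ : ℂ) * cexp (((ω * γ : ℝ) : ℂ) * I)
    have h4 : ‖g‖ - ‖s‖ ≤ ε := by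
      have := norm_sub_norm_le g s
      rw [norm_sub_rev] at this; linarith
    nlinarith [norm_nonneg s, norm_nonneg g]
  rw [intervalIntegral.integral_add (by apply Continuous.intervalIntegrable; fun_prop) (by apply Continuous.intervalIntegrable; fun_prop),
    intervalIntegral.integral_mul_const, lin_int] at hmono
  have hη' : L ^ 2 / 2 * (2 * K * ε) ≤ η := by
    have : L ^ 2 / 2 * (2 * K * ε) = η * ((K * L ^ 2) / (K * L ^ 2 + 1)) := by rw [hε]; field_simp
    rw [this]
    have h1 : (K * L ^ 2) / (K * L ^ 2 + 1) ≤ 1 := by rw [div_le_one (by positivity)]; linarith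
    nlinarith
  have : L ^ 2 / 2 * ∑ γ ∈ F, zw a v γ ^ 2 ≤ L ^ 2 / 2 * ∑ γ ∈ G, zw a v γ ^ 2 := by gcongr
  linarith

/-- partial Mertens sums -/
def Am (N : ℕ) : ℝ := ∑ n ∈ Finset.Ioc 0 N, vM n / n

lemma factorial_sum (N : ℕ) : Real.log (N.factorial) = ∑ n ∈ Finset.Ioc 0 N, vM n * ((N / n : ℕ) : ℝ) := by
  have h := ArithmeticFunction.sum_Ioc_mul_zeta_eq_sum ArithmeticFunction.vonMangoldt N
  rw [ArithmeticFunction.vonMangoldt_mul_zeta] at h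
  have h2 : ∑ n ∈ Finset.Ioc 0 N, vM n * ((N / n : ℕ) : ℝ) = ∑ n ∈ Finset.Ioc 0 N, ArithmeticFunction.log n := by
    rw [h]; rfl
  rw [h2]
  clear h h2
  induction N with
  | zero => simp
  | succ k ih =>
    rw [Finset.sum_Ioc_succ_top (by omega), ← ih, Nat.factorial_succ, Nat.cast_mul, Real.log_mul (by positivity) (by positivity), ArithmeticFunction.log_apply]
    ring

lemma mertens : ∃ C : ℝ, 0 ≤ C ∧ ∀ N : ℕ, 1 ≤ N → |Am N - Real.log N| ≤ C := by
  refine ⟨Real.log 4 + 5, by have := Real.log_nonneg (show (1:ℝ) ≤ 4 by norm_num); linarith, fun N hN => ?_⟩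
  have hN0 : (0:ℝ) < N := by exact_mod_cast hN
  have l4 := Real.log_nonneg (show (1:ℝ) ≤ 4 by norm_num)
  have hf := factorial_sum N
  have up : ∑ n ∈ Finset.Ioc 0 N, vM n * ((N / n : ℕ) : ℝ) ≤ N * Am N := by
    rw [Am, Finset.mul_sum]
    refine Finset.sum_le_sum fun n hn => ?_
    have : ((N / n : ℕ) : ℝ) ≤ N / n := Nat.cast_div_le
    calc _ ≤ vM n * (N / n) := mul_le_mul_of_nonneg_left this (vM_nonneg n)
      _ = _ := by ring
  have psi : ∑ n ∈ Finset.Ioc 0 N, vM n ≤ (Real.log 4 + 4) * N := by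
    have := Chebyshev.psi_le_const_mul_self hN0.le
    rw [Chebyshev.psi, Nat.floor_natCast] at this
    exact this
  have lo : N * Am N - ∑ n ∈ Finset.Ioc 0 N, vM n ≤ ∑ n ∈ Finset.Ioc 0 N, vM n * ((N / n : ℕ) : ℝ) := by
    rw [Am, Finset.mul_sum, ← Finset.sum_sub_distrib]
    refine Finset.sum_le_sum fun n hn => ?_
    have hn0 : 0 < n := (Finset.mem_Ioc.1 hn).1
    have : (N:ℝ) / n ≤ ((N / n : ℕ) : ℝ) + 1 := by
      have h1 := Nat.lt_div_mul_add (a := N) hn0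
      rw [div_le_iff₀ (by exact_mod_cast hn0)]
      have : (N:ℝ) < ((N / n : ℕ) : ℝ) * n + n := by exact_mod_cast h1
      linarith
    have h2 := mul_le_mul_of_nonneg_left this (vM_nonneg n)
    calc _ = vM n * (N / n) - vM n := by ring
      _ ≤ _ := by linarith
  have f1 : Real.log (N.factorial) ≤ N * Real.log N := by
    have : ((N.factorial : ℕ) : ℝ) ≤ (N:ℝ) ^ N := by exact_mod_cast Nat.factorial_le_pow N
    have := Real.log_le_log (by positivity) this
    rwa [Real.log_pow] at this
  have f2 : N * Real.log N - N ≤ Real.log (N.factorial) := by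
    have := Real.pow_div_factorial_le_exp _ hN0.le N
    have := Real.log_le_log (by positivity) this
    rw [Real.log_exp, Real.log_div (by positivity) (by positivity), Real.log_pow] at this
    linarith
  rw [abs_le]
  constructor
  · have : N * (Real.log N - 1) ≤ N * Am N := by linarith
    have := le_of_mul_le_mul_left this hN0
    linarith
  · have : N * Am N ≤ N * (Real.log N + (Real.log 4 + 4)) := by linarith
    have := le_of_mul_le_mul_left this hN0
    linarith

lemma mertens_exp : ∃ C : ℝ, 0 ≤ C ∧ ∀ t : ℝ, 0 ≤ t → |Am ⌊Real.exp t⌋₊ - t| ≤ C := by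
  obtain ⟨C, hC, h⟩ := mertens
  refine ⟨C + 1, by positivity, fun t ht => ?_⟩
  have h1 : 1 ≤ Real.exp t := Real.one_le_exp ht
  have hf : 1 ≤ ⌊Real.exp t⌋₊ := by rw [Nat.one_le_floor_iff]; exact h1
  have h2 := h _ hf
  have hf' : (1:ℝ) ≤ (⌊Real.exp t⌋₊ : ℝ) := by exact_mod_cast hf
  have u : Real.log ⌊Real.exp t⌋₊ ≤ t := by
    rw [Real.log_le_iff_le_exp (by linarith)]; exact Nat.floor_le (by positivity)
  have l : t - 1 ≤ Real.log ⌊Real.exp t⌋₊ := by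
    rw [Real.le_log_iff_exp_le (by linarith), Real.exp_sub, div_le_iff₀ (Real.exp_pos _)]
    have := Nat.lt_floor_add_one (Real.exp t)
    have e := Real.add_one_le_exp (1:ℝ)
    nlinarith
  rw [abs_le] at *
  constructor <;> linarith

lemma ind_int {x L : ℝ} (hx : 0 < x) : IntegrableOn ((Set.Ici x).indicator (fun t : ℝ => 2 * t - L)) (Ioc 0 L) ∧
    ∫ t in Ioc 0 L, (Set.Ici x).indicator (fun t : ℝ => 2 * t - L) t = x * max (L - x) 0 := by
  have hc : Continuous (fun t : ℝ => 2 * t - L) := by fun_prop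
  constructor
  · exact (hc.integrableOn_Ioc).indicator measurableSet_Ici
  · rw [setIntegral_indicator measurableSet_Ici]
    rcases le_or_gt x L with h | h
    · have : Ioc 0 L ∩ Set.Ici x = Icc x L := by
        ext t; simp only [mem_inter_iff, mem_Ioc, mem_Ici, mem_Icc]
        constructor
        · rintro ⟨⟨_, h2⟩, h3⟩; exact ⟨h3, h2⟩
        · rintro ⟨h1, h2⟩; exact ⟨⟨by linarith, h2⟩, h1⟩
      rw [this, integral_Icc_eq_integral_Ioc, ← intervalIntegral.integral_of_le h, max_eq_left (by linarith),
        intervalIntegral.integral_sub (by apply Continuous.intervalIntegrable; fun_prop) (by simp), intervalIntegral.integral_const_mul]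
      simp; ring
    · have : Ioc 0 L ∩ Set.Ici x = ∅ := by
        ext t; simp only [mem_inter_iff, mem_Ioc, mem_Ici, mem_empty_iff_false, iff_false]
        rintro ⟨⟨_, h2⟩, h3⟩; linarith
      rw [this, max_eq_right (by linarith)]; simp

lemma cn_sq {n : ℕ} (hn : 1 ≤ n) : cn n ^ 2 = vM n ^ 2 / n := by
  have hn' : (0:ℝ) < n := by exact_mod_cast hn
  rw [cn, mul_pow, ← Real.rpow_natCast ((n:ℝ) ^ _), ← Real.rpow_mul hn'.le]
  norm_num [Real.rpow_neg_one]; rfl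

lemma prime_sum : ∃ C : ℝ, 0 ≤ C ∧ ∀ (L : ℝ) (N : ℕ), 0 ≤ L →
    ∑ n ∈ Finset.range N, cn n ^ 2 * max (L - Real.log n) 0 ≤ L ^ 3 / 6 + C * L ^ 2 := by
  obtain ⟨C, hC, hA⟩ := mertens_exp
  refine ⟨C, hC, fun L N hL => ?_⟩
  set M := N + ⌊Real.exp L⌋₊ with hM
  set b : ℕ → ℝ := fun n => vM n / n with hb
  have hb0 : ∀ n, 0 ≤ b n := fun n => div_nonneg (vM_nonneg n) (by positivity)
  have s1 : ∑ n ∈ Finset.range N, cn n ^ 2 * max (L - Real.log n) 0 ≤ ∑ n ∈ Finset.Ioc 1 M, b n * (Real.log n * max (L - Real.log n) 0) := by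
    have hsub : ∑ n ∈ Finset.range N, cn n ^ 2 * max (L - Real.log n) 0 ≤ ∑ n ∈ Finset.Ioc 1 M, cn n ^ 2 * max (L - Real.log n) 0 := by
      rw [← Finset.sum_filter_add_sum_filter_not (Finset.range N) (fun n => 2 ≤ n)]
      have z : ∑ n ∈ (Finset.range N).filter (fun n => ¬ 2 ≤ n), cn n ^ 2 * max (L - Real.log n) 0 = 0 := by
        refine Finset.sum_eq_zero fun n hn => ?_
        rw [cn_small (by have := (Finset.mem_filter.1 hn).2; omega)]; simp
      rw [z, add_zero]
      refine Finset.sum_le_sum_of_subset_of_nonneg ?_ (fun n _ _ => by positivity)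
      intro n hn
      simp only [Finset.mem_filter, Finset.mem_range] at hn
      rw [Finset.mem_Ioc]; omega
    refine hsub.trans (Finset.sum_le_sum fun n hn => ?_)
    have hn1 : 1 ≤ n := by have := (Finset.mem_Ioc.1 hn).1; omega
    rw [cn_sq hn1, ← mul_assoc]
    refine mul_le_mul_of_nonneg_right ?_ (le_max_right _ _)
    have h1 : vM n ≤ Real.log n := ArithmeticFunction.vonMangoldt_le_log
    have hn' : (0:ℝ) < n := by exact_mod_cast hn1
    rw [hb]; simp only
    rw [div_mul_eq_mul_div]
    have := mul_le_mul_of_nonneg_left h1 (vM_nonneg n)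
    gcongr
    nlinarith
  have hlog : ∀ n ∈ Finset.Ioc 1 M, 0 < Real.log n := fun n hn => Real.log_pos (by exact_mod_cast (Finset.mem_Ioc.1 hn).1)
  have s2 : ∑ n ∈ Finset.Ioc 1 M, b n * (Real.log n * max (L - Real.log n) 0) =
      ∫ t in Ioc 0 L, ∑ n ∈ Finset.Ioc 1 M, b n * (Set.Ici (Real.log n)).indicator (fun t : ℝ => 2 * t - L) t := by
    rw [integral_finsetSum _ (fun n hn => (ind_int (hlog n hn)).1.const_mul _)]
    refine Finset.sum_congr rfl fun n hn => ?_
    rw [integral_const_mul, (ind_int (hlog n hn)).2]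
  have hintg : IntegrableOn (fun t => ∑ n ∈ Finset.Ioc 1 M, b n * (Set.Ici (Real.log n)).indicator (fun t : ℝ => 2 * t - L) t) (Ioc 0 L) :=
    integrable_finsetSum _ (fun n hn => (ind_int (hlog n hn)).1.const_mul _)
  have pt : ∀ t ∈ Ioc 0 L, ∑ n ∈ Finset.Ioc 1 M, b n * (Set.Ici (Real.log n)).indicator (fun t : ℝ => 2 * t - L) t = (2 * t - L) * Am ⌊Real.exp t⌋₊ := by
    intro t ht
    have e1 : ∀ n ∈ Finset.Ioc 1 M, b n * (Set.Ici (Real.log n)).indicator (fun t : ℝ => 2 * t - L) t = if n ≤ ⌊Real.exp t⌋₊ then (2 * t - L) * b n else 0 := by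
      intro n hn
      have hn' : (0:ℝ) < n := by have := (Finset.mem_Ioc.1 hn).1; exact_mod_cast (by omega : 0 < n)
      have : Real.log n ≤ t ↔ n ≤ ⌊Real.exp t⌋₊ := by
        rw [Nat.le_floor_iff (Real.exp_nonneg t), Real.log_le_iff_le_exp hn']
      by_cases h : Real.log n ≤ t
      · rw [Set.indicator_of_mem (by exact h), if_pos (this.1 h)]; ring
      · rw [Set.indicator_of_notMem (by exact h), if_neg (fun h' => h (this.2 h'))]; ring
    rw [Finset.sum_congr rfl e1, ← Finset.sum_filter, ← Finset.mul_sum]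
    congr 1
    rw [Am]
    have hle : ⌊Real.exp t⌋₊ ≤ M := (Nat.floor_le_floor (Real.exp_le_exp.2 ht.2)).trans (by omega)
    refine Finset.sum_subset ?_ ?_
    · intro n hn
      simp only [Finset.mem_filter, Finset.mem_Ioc] at *
      omega
    · intro n hn hn2
      simp only [Finset.mem_filter, Finset.mem_Ioc] at *
      have : n = 1 := by omega
      rw [this]; simp [hb, vM_one]
  have s3 : ∫ t in Ioc 0 L, ∑ n ∈ Finset.Ioc 1 M, b n * (Set.Ici (Real.log n)).indicator (fun t : ℝ => 2 * t - L) t ≤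
      ∫ t in Ioc 0 L, ((2 * t - L) * t + L * C) := by
    refine setIntegral_mono_on hintg (Continuous.integrableOn_Ioc (by fun_prop)) measurableSet_Ioc fun t ht => ?_
    rw [pt t ht]
    have h1 := hA t ht.1.le
    have h2 : |2 * t - L| ≤ L := by rw [abs_le]; constructor <;> linarith [ht.1, ht.2]
    have h3 : |(2 * t - L) * (Am ⌊Real.exp t⌋₊ - t)| ≤ L * C := by rw [abs_mul]; gcongr
    have := le_abs_self ((2 * t - L) * (Am ⌊Real.exp t⌋₊ - t))
    linarith
  have s4 : ∫ t in Ioc 0 L, ((2 * t - L) * t + L * C) = L ^ 3 / 6 + C * L ^ 2 := by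
    rw [← intervalIntegral.integral_of_le hL]
    have hd : ∀ x ∈ uIcc 0 L, HasDerivAt (fun t : ℝ => 2 / 3 * t ^ 3 - L / 2 * t ^ 2 + L * C * t) ((2 * x - L) * x + L * C) x := by
      intro x _
      have h3 := ((((hasDerivAt_id x).pow 3).const_mul (2/3 : ℝ)).sub (((hasDerivAt_id x).pow 2).const_mul (L/2))).add ((hasDerivAt_id x).const_mul (L * C))
      have e : 2 / 3 * (((3:ℕ):ℝ) * id x ^ (3 - 1) * 1) - L / 2 * (((2:ℕ):ℝ) * id x ^ (2 - 1) * 1) + L * C * 1 = (2 * x - L) * x + L * C := by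
        simp only [id]; push_cast; norm_num; ring
      rw [e] at h3
      exact h3
    rw [intervalIntegral.integral_eq_sub_of_hasDerivAt hd (by apply Continuous.intervalIntegrable; fun_prop)]
    ring
  linarith

/-- main term -/
def Mv (a v ℓ : ℝ) (N : ℕ) (ω : ℝ) : ℂ := ℓ * Ev a v ω - ∑ n ∈ Finset.range N, (cn n : ℂ) * Ev a v (ω - Real.log n)

lemma Ev_cont (a v : ℝ) : Continuous (Ev a v) := by unfold Ev; fun_prop

lemma Mv_cont (a v ℓ : ℝ) (N : ℕ) : Continuous (Mv a v ℓ N) := by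
  unfold Mv
  have := Ev_cont a v
  fun_prop

lemma cn_le_two (n : ℕ) : cn n ≤ 2 := by
  rcases Nat.eq_zero_or_pos n with h | h
  · subst h; rw [cn_small (by norm_num)]; norm_num
  · have hn' : (0:ℝ) < n := by exact_mod_cast h
    have h1 : vM n ≤ Real.log n := ArithmeticFunction.vonMangoldt_le_log
    have h2 := log_sq_le (u := n) (by exact_mod_cast h)
    have h3 : cn n ^ 2 ≤ 2 ^ 2 := by
      rw [cn_sq h, div_le_iff₀ hn']
      nlinarith [vM_nonneg n]
    exact le_of_sq_le_sq h3 (by norm_num)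

/-- Gaussian bump -/
def en (a ω : ℝ) (n : ℕ) : ℝ := Real.exp (-(ω - Real.log n) ^ 2 / (4 * a))

/-- coefficients -/
def dn (ℓ : ℝ) (n : ℕ) : ℝ := if n = 1 then ℓ else cn n

lemma dn_nonneg {ℓ : ℝ} (hℓ : 1 ≤ ℓ) (n : ℕ) : 0 ≤ dn ℓ n := by
  unfold dn; split_ifs
  · linarith
  · exact cn_nonneg n

lemma dn_le {ℓ : ℝ} (hℓ : 1 ≤ ℓ) (n : ℕ) : dn ℓ n ≤ 2 * ℓ := by
  unfold dn; split_ifs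
  · linarith
  · linarith [cn_le_two n]

lemma Mv_norm {a v ℓ : ℝ} {N : ℕ} (hℓ : 1 ≤ ℓ) (hN : 2 ≤ N) (ω : ℝ) :
    ‖Mv a v ℓ N ω‖ ≤ ∑ n ∈ Finset.Ico 1 N, dn ℓ n * en a ω n := by
  have h1 : ‖Mv a v ℓ N ω‖ ≤ ℓ * en a ω 1 + ∑ n ∈ Finset.range N, cn n * en a ω n := by
    unfold Mv
    refine (norm_sub_le _ _).trans (add_le_add (le_of_eq ?_) ((norm_sum_le _ _).trans (Finset.sum_le_sum fun n _ => le_of_eq ?_)))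
    · rw [norm_mul, norm_Ev, Complex.norm_real, Real.norm_of_nonneg (by linarith), en]; simp
    · rw [norm_mul, norm_Ev, Complex.norm_real, Real.norm_of_nonneg (cn_nonneg n), en]
  refine h1.trans (le_of_eq ?_)
  rw [Finset.range_eq_Ico, Finset.sum_eq_sum_Ico_succ_bot (by omega : 0 < N), Finset.sum_eq_sum_Ico_succ_bot (by omega : 0 + 1 < N),
    Finset.sum_eq_sum_Ico_succ_bot (by omega : 1 < N), cn_small (by norm_num), cn_small (by norm_num)]
  have : ∑ k ∈ Finset.Ico (1 + 1) N, dn ℓ k * en a ω k = ∑ k ∈ Finset.Ico (0 + 1 + 1) N, cn k * en a ω k := by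
    refine Finset.sum_congr rfl fun k hk => ?_
    rw [dn, if_neg (by have := (Finset.mem_Ico.1 hk).1; omega)]
  rw [this, dn, if_pos rfl]; ring

lemma log_gap {n m N : ℕ} (hn : 1 ≤ n) (hnm : n < m) (hm : m < N) : 1 / (N:ℝ) ≤ Real.log m - Real.log n := by
  have hn' : (0:ℝ) < n := by exact_mod_cast hn
  have hm' : (0:ℝ) < m := by exact_mod_cast (by omega : 0 < m)
  have hN' : (0:ℝ) < N := by exact_mod_cast (by omega : 0 < N)
  rw [← Real.log_div hm'.ne' hn'.ne']
  have h1 := Real.one_sub_inv_le_log_of_pos (show 0 < (m:ℝ) / n by positivity)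
  rw [inv_div] at h1
  have h2 : 1 / (N:ℝ) ≤ 1 / m := by
    apply one_div_le_one_div_of_le hm'; exact_mod_cast hm.le
  have h3 : (1:ℝ) / m ≤ 1 - n / m := by
    rw [one_sub_div hm'.ne']
    gcongr
    have : (n:ℝ) + 1 ≤ m := by exact_mod_cast hnm
    linarith
  linarith

lemma en_cross {a : ℝ} (ha : 0 < a) (ω : ℝ) {n m N : ℕ} (hn : n ∈ Finset.Ico 1 N) (hm : m ∈ Finset.Ico 1 N) (hne : n ≠ m) :
    en a ω n * en a ω m ≤ Real.exp (-(1 / (8 * a * N ^ 2))) := by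
  rw [Finset.mem_Ico] at hn hm
  have hN' : (0:ℝ) < N := by exact_mod_cast (by omega : 0 < N)
  have hgap : (1 / (N:ℝ)) ^ 2 ≤ (Real.log m - Real.log n) ^ 2 := by
    have p : 0 < 1 / (N:ℝ) := by positivity
    rcases lt_or_gt_of_ne hne with h | h
    · have := log_gap hn.1 h hm.2; nlinarith
    · have := log_gap hm.1 h hn.2; nlinarith
  rw [en, en, ← Real.exp_add, Real.exp_le_exp]
  have e1 : -(ω - Real.log n) ^ 2 / (4 * a) + -(ω - Real.log m) ^ 2 / (4 * a) = -(2 * ((ω - Real.log n) ^ 2 + (ω - Real.log m) ^ 2) / (8 * a)) := by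
    field_simp; ring
  have e2 : 1 / (8 * a * N ^ 2) = (1 / (N:ℝ)) ^ 2 / (8 * a) := by field_simp
  rw [e1, e2, neg_le_neg_iff]
  gcongr
  nlinarith [sq_nonneg ((ω - Real.log n) + (ω - Real.log m))]

lemma Mv_sq {a v ℓ : ℝ} {N : ℕ} (ha : 0 < a) (hℓ : 1 ≤ ℓ) (hN : 2 ≤ N) (ω : ℝ) :
    ‖Mv a v ℓ N ω‖ ^ 2 ≤ (∑ n ∈ Finset.Ico 1 N, dn ℓ n ^ 2 * en a ω n ^ 2) + 4 * N ^ 2 * ℓ ^ 2 * Real.exp (-(1 / (8 * a * N ^ 2))) := by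
  set D := Real.exp (-(1 / (8 * a * N ^ 2))) with hD
  have hD0 : 0 ≤ D := Real.exp_nonneg _
  have h1 := Mv_norm (a := a) (v := v) hℓ hN ω
  have h2 : ‖Mv a v ℓ N ω‖ ^ 2 ≤ (∑ n ∈ Finset.Ico 1 N, dn ℓ n * en a ω n) ^ 2 := pow_le_pow_left₀ (norm_nonneg _) h1 2
  refine h2.trans ?_
  rw [sq, Finset.sum_mul_sum]
  have h3 : ∀ n ∈ Finset.Ico 1 N, ∑ m ∈ Finset.Ico 1 N, dn ℓ n * en a ω n * (dn ℓ m * en a ω m) ≤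
      dn ℓ n ^ 2 * en a ω n ^ 2 + N * (4 * ℓ ^ 2 * D) := by
    intro n hn
    calc _ ≤ ∑ m ∈ Finset.Ico 1 N, ((if n = m then dn ℓ n ^ 2 * en a ω n ^ 2 else 0) + 4 * ℓ ^ 2 * D) := by
          refine Finset.sum_le_sum fun m hm => ?_
          split_ifs with h
          · subst h
            have : 0 ≤ 4 * ℓ ^ 2 * D := by positivity
            nlinarith
          · have h4 := en_cross ha ω hn hm h
            have h5 : dn ℓ n * dn ℓ m ≤ (2 * ℓ) * (2 * ℓ) := mul_le_mul (dn_le hℓ n) (dn_le hℓ m) (dn_nonneg hℓ m) (by linarith)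
            calc _ = (dn ℓ n * dn ℓ m) * (en a ω n * en a ω m) := by ring
              _ ≤ ((2 * ℓ) * (2 * ℓ)) * D := mul_le_mul h5 h4 (mul_nonneg (Real.exp_nonneg _) (Real.exp_nonneg _)) (by nlinarith)
              _ = _ := by ring
      _ = dn ℓ n ^ 2 * en a ω n ^ 2 + ((N - 1 : ℕ) : ℝ) * (4 * ℓ ^ 2 * D) := by
          rw [Finset.sum_add_distrib, Finset.sum_ite_eq, if_pos hn, Finset.sum_const, Nat.card_Ico, nsmul_eq_mul]
      _ ≤ _ := by gcongr; omega
  calc _ ≤ ∑ n ∈ Finset.Ico 1 N, (dn ℓ n ^ 2 * en a ω n ^ 2 + N * (4 * ℓ ^ 2 * D)) := Finset.sum_le_sum h3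
    _ = (∑ n ∈ Finset.Ico 1 N, dn ℓ n ^ 2 * en a ω n ^ 2) + ((N - 1 : ℕ) : ℝ) * (N * (4 * ℓ ^ 2 * D)) := by
        rw [Finset.sum_add_distrib, Finset.sum_const, Nat.card_Ico, nsmul_eq_mul]
    _ ≤ (∑ n ∈ Finset.Ico 1 N, dn ℓ n ^ 2 * en a ω n ^ 2) + (N : ℝ) * (N * (4 * ℓ ^ 2 * D)) := by gcongr; omega
    _ = _ := by ring

lemma en_sq {a : ℝ} (ha : 0 < a) (ω : ℝ) (n : ℕ) : en a ω n ^ 2 = Real.exp (-(1 / (2 * a)) * (ω - Real.log n) ^ 2) := by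
  rw [en, ← Real.exp_nat_mul]; congr 1; push_cast; field_simp; ring

lemma sqrt_two_pi {a : ℝ} : √(π / (1 / (2 * a))) = √(2 * π * a) := by
  congr 1; rw [div_div_eq_mul_div]; ring

lemma In_bound {a L : ℝ} (ha : 0 < a) (hL : 0 ≤ L) (x : ℝ) :
    ∫ ω in (0:ℝ)..L, (L - ω) * Real.exp (-(1 / (2 * a)) * (ω - x) ^ 2) ≤ max (L - x) 0 * √(2 * π * a) + 8 * a := by
  have h1 : ∫ ω in (0:ℝ)..L, (L - ω) * Real.exp (-(1 / (2 * a)) * (ω - x) ^ 2) ≤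
      ∫ ω in (0:ℝ)..L, (max (L - x) 0 * Real.exp (-(1 / (2 * a)) * (ω - x) ^ 2) + √(4 * a) * Real.exp (-(1 / (4 * a)) * (ω - x) ^ 2)) := by
    refine intervalIntegral.integral_mono_on hL (by apply Continuous.intervalIntegrable; fun_prop) (by apply Continuous.intervalIntegrable; fun_prop) fun ω hω => ?_
    have s0 : 0 < √(4 * a) := Real.sqrt_pos.2 (by positivity)
    have s2 : √(4 * a) ^ 2 = 4 * a := Real.sq_sqrt (by positivity)
    have e1 : Real.exp (-(1 / (2 * a)) * (ω - x) ^ 2) = Real.exp (-(1 / (4 * a)) * (ω - x) ^ 2) * Real.exp (-(1 / (4 * a)) * (ω - x) ^ 2) := by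
      rw [← Real.exp_add]; congr 1; field_simp; ring
    have e2 : |ω - x| * Real.exp (-(1 / (4 * a)) * (ω - x) ^ 2) ≤ √(4 * a) := by
      set s := |ω - x| / √(4 * a) with hs
      have hs2 : (1 / (4 * a)) * (ω - x) ^ 2 = s ^ 2 := by
        rw [hs, div_pow, s2, sq_abs]; ring
      rw [neg_mul, hs2, Real.exp_neg]
      have : |ω - x| = s * √(4 * a) := by rw [hs]; field_simp
      rw [this]
      have h4 := Real.add_one_le_exp (s ^ 2)
      have h5 : s ≤ Real.exp (s ^ 2) := by nlinarith [sq_nonneg (s - 1/2)]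
      rw [← div_eq_mul_inv, div_le_iff₀ (Real.exp_pos _)]
      nlinarith
    have e3 : L - ω ≤ max (L - x) 0 + |ω - x| := by
      have := le_max_left (L - x) 0
      have := neg_abs_le (ω - x)
      linarith
    have p := Real.exp_nonneg (-(1 / (4 * a)) * (ω - x) ^ 2)
    calc _ ≤ (max (L - x) 0 + |ω - x|) * Real.exp (-(1 / (2 * a)) * (ω - x) ^ 2) := by gcongr
      _ = max (L - x) 0 * Real.exp (-(1 / (2 * a)) * (ω - x) ^ 2) + (|ω - x| * Real.exp (-(1 / (4 * a)) * (ω - x) ^ 2)) * Real.exp (-(1 / (4 * a)) * (ω - x) ^ 2) := by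
          rw [e1]; ring
      _ ≤ _ := by gcongr
  refine h1.trans ?_
  have i1 := (gauss_int (q := 1 / (2 * a)) (by positivity) x).const_mul (max (L - x) 0)
  have i2 := (gauss_int (q := 1 / (4 * a)) (by positivity) x).const_mul (√(4 * a))
  rw [intervalIntegral.integral_of_le hL]
  refine (setIntegral_le_integral (by exact i1.add i2) (Eventually.of_forall fun ω => by positivity)).trans ?_
  rw [integral_add i1 i2, integral_const_mul, integral_const_mul, gauss_integral, gauss_integral, sqrt_two_pi, ← Real.sqrt_mul (by positivity)]
  have : √(4 * a * (π / (1 / (4 * a)))) ≤ 8 * a := by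
    rw [Real.sqrt_le_left (by positivity)]
    have : 4 * a * (π / (1 / (4 * a))) = 16 * a ^ 2 * π := by field_simp; ring
    rw [this]
    nlinarith [Real.pi_lt_four, sq_nonneg a]
  linarith

lemma I1_bound {a L : ℝ} (ha : 0 < a) (hL : 0 ≤ L) :
    ∫ ω in (0:ℝ)..L, (L - ω) * Real.exp (-(1 / (2 * a)) * ω ^ 2) ≤ L * (√(2 * π * a) / 2) := by
  have h1 : ∫ ω in (0:ℝ)..L, (L - ω) * Real.exp (-(1 / (2 * a)) * ω ^ 2) ≤ ∫ ω in (0:ℝ)..L, L * Real.exp (-(1 / (2 * a)) * ω ^ 2) := by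
    refine intervalIntegral.integral_mono_on hL (by apply Continuous.intervalIntegrable; fun_prop) (by apply Continuous.intervalIntegrable; fun_prop) fun ω hω => ?_
    have := hω.1
    gcongr; linarith
  refine h1.trans ?_
  rw [intervalIntegral.integral_const_mul, intervalIntegral.integral_of_le hL]
  have i1 := (integrable_exp_neg_mul_sq (b := 1 / (2 * a)) (by positivity)).integrableOn (s := Ioi (0:ℝ))
  have h2 := integral_gaussian_Ioi (1 / (2 * a))
  rw [sqrt_two_pi] at h2
  rw [← h2]
  refine mul_le_mul_of_nonneg_left ?_ hL
  exact setIntegral_mono_set i1 (Eventually.of_forall fun ω => Real.exp_nonneg _) (Eventually.of_forall fun ω hω => hω.1)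

lemma M_bound : ∃ C : ℝ, 0 ≤ C ∧ ∀ (a v ℓ L : ℝ) (N : ℕ), 0 < a → 1 ≤ ℓ → 0 ≤ L → 2 ≤ N →
    ∫ ω in (0:ℝ)..L, (L - ω) * ‖Mv a v ℓ N ω‖ ^ 2 ≤
      √(2 * π * a) * (ℓ ^ 2 * L / 2 + L ^ 3 / 6 + C * L ^ 2) + 32 * a * N + 2 * L ^ 2 * (N ^ 2 * ℓ ^ 2 * Real.exp (-(1 / (8 * a * N ^ 2)))) := by
  obtain ⟨C, hC, hp⟩ := prime_sum
  refine ⟨C, hC, fun a v ℓ L N ha hℓ hL hN => ?_⟩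
  have hMc := Mv_cont a v ℓ N
  set D := Real.exp (-(1 / (8 * a * N ^ 2))) with hD
  have h1 : ∫ ω in (0:ℝ)..L, (L - ω) * ‖Mv a v ℓ N ω‖ ^ 2 ≤
      ∫ ω in (0:ℝ)..L, ((∑ n ∈ Finset.Ico 1 N, dn ℓ n ^ 2 * ((L - ω) * Real.exp (-(1 / (2 * a)) * (ω - Real.log n) ^ 2))) + (L - ω) * (4 * N ^ 2 * ℓ ^ 2 * D)) := by
    refine intervalIntegral.integral_mono_on hL (by apply Continuous.intervalIntegrable; fun_prop) (by apply Continuous.intervalIntegrable; fun_prop) fun ω hω => ?_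
    have h2 := mul_le_mul_of_nonneg_left (Mv_sq (v := v) ha hℓ hN ω) (show 0 ≤ L - ω by linarith [hω.2])
    refine h2.trans (le_of_eq ?_)
    rw [mul_add, Finset.mul_sum]
    congr 1
    refine Finset.sum_congr rfl fun n _ => ?_
    rw [en_sq ha]; ring
  rw [intervalIntegral.integral_add (by apply Continuous.intervalIntegrable; fun_prop) (by apply Continuous.intervalIntegrable; fun_prop),
    intervalIntegral.integral_mul_const, lin_int, intervalIntegral.integral_finsetSum (fun n _ => by apply Continuous.intervalIntegrable; fun_prop)] at h1
  simp_rw [intervalIntegral.integral_const_mul] at h1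
  rw [Finset.sum_eq_sum_Ico_succ_bot (by omega : 1 < N)] at h1
  have hI1 := I1_bound ha hL
  have hs0 : 0 ≤ √(2 * π * a) := Real.sqrt_nonneg _
  have t1 : dn ℓ 1 ^ 2 * ∫ ω in (0:ℝ)..L, (L - ω) * Real.exp (-(1 / (2 * a)) * (ω - Real.log (1:ℕ)) ^ 2) ≤ ℓ ^ 2 * (L * (√(2 * π * a) / 2)) := by
    rw [dn, if_pos rfl, Nat.cast_one, Real.log_one]
    simp_rw [sub_zero]
    gcongr
  have t2 : ∑ n ∈ Finset.Ico (1 + 1) N, dn ℓ n ^ 2 * ∫ ω in (0:ℝ)..L, (L - ω) * Real.exp (-(1 / (2 * a)) * (ω - Real.log n) ^ 2) ≤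
      √(2 * π * a) * (∑ n ∈ Finset.range N, cn n ^ 2 * max (L - Real.log n) 0) + 32 * a * N := by
    calc _ ≤ ∑ n ∈ Finset.Ico (1 + 1) N, (√(2 * π * a) * (cn n ^ 2 * max (L - Real.log n) 0) + 32 * a) := by
          refine Finset.sum_le_sum fun n hn => ?_
          rw [dn, if_neg (by have := (Finset.mem_Ico.1 hn).1; omega)]
          have h3 := mul_le_mul_of_nonneg_left (In_bound ha hL (Real.log n)) (sq_nonneg (cn n))
          have h4 : cn n ^ 2 ≤ 4 := by nlinarith [cn_le_two n, cn_nonneg n]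
          nlinarith
      _ ≤ ∑ n ∈ Finset.range N, (√(2 * π * a) * (cn n ^ 2 * max (L - Real.log n) 0) + 32 * a) := by
          refine Finset.sum_le_sum_of_subset_of_nonneg ?_ (fun n _ _ => by positivity)
          intro n hn
          rw [Finset.mem_range]; exact (Finset.mem_Ico.1 hn).2
      _ = _ := by
          rw [Finset.sum_add_distrib, Finset.sum_const, Finset.card_range, nsmul_eq_mul, Finset.mul_sum]; ring
  have t3 := mul_le_mul_of_nonneg_left (hp L N hL) hs0
  nlinarith

lemma norm_three (x y w : ℂ) {ε R : ℝ} (hε : 0 < ε) (h : ‖w - x - y‖ ≤ R) :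
    ‖w‖^2 ≤ (1+ε)*‖x‖^2 + 2*(1+1/ε)*(‖y‖^2 + R^2) := by
  have h1 : ‖w‖ ≤ ‖x‖ + (‖y‖ + R) := by
    have e : w = x + (y + (w - x - y)) := by ring
    calc ‖w‖ = ‖x + (y + (w - x - y))‖ := by rw [← e]
      _ ≤ ‖x‖ + ‖y + (w - x - y)‖ := norm_add_le _ _
      _ ≤ ‖x‖ + (‖y‖ + ‖w - x - y‖) := by gcongr; exact norm_add_le _ _
      _ ≤ _ := by gcongr
  have hR : 0 ≤ R := le_trans (norm_nonneg _) h
  have hx := norm_nonneg x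
  have hy := norm_nonneg y
  have hw := norm_nonneg w
  set p := ‖x‖
  set q := ‖y‖
  have h2 : ‖w‖^2 ≤ (p + (q+R))^2 := by gcongr
  have h3 : (p + (q+R))^2 ≤ (1+ε)*p^2 + (1+1/ε)*(q+R)^2 := by
    have : (1+ε)*p^2 + (1+1/ε)*(q+R)^2 - (p + (q+R))^2 = (1/ε)*(ε*p - (q+R))^2 := by
      field_simp; ring
    have h4 : 0 ≤ (1/ε)*(ε*p - (q+R))^2 := by positivity
    linarith
  have h5 : (q+R)^2 ≤ 2*(q^2+R^2) := by nlinarith [sq_nonneg (q-R)]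
  have h6 : (1+1/ε)*(q+R)^2 ≤ (1+1/ε)*(2*(q^2+R^2)) := by gcongr
  nlinarith

lemma Bv_cont {a : ℝ} (ha : 0 < a) (v ℓ : ℝ) : Continuous (fun ω => Bv a v ℓ ω) := by
  have : (fun ω => Bv a v ℓ ω) = fh (hvv a v ℓ) := by
    funext ω; exact Bv_eq ..
  rw [this]
  exact fh_cont (hv_cont a v ℓ) (hv_integrable ha v ℓ)

lemma comb {a v ℓ L ε R : ℝ} {N : ℕ} (ha : 0 < a) (hL : 0 ≤ L) (hε : 0 < ε)
    (hR : ∀ ω, 0 ≤ ω → ω ≤ L →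
      ‖2*π*Sv a v ω - (√(π/a):ℝ)*Mv a v ℓ N ω - Bv a v ℓ ω‖ ≤ R) (F : Finset ℝ) :
    2*π^2*L^2*∑ γ ∈ F, zw a v γ^2 ≤
      (1+ε)*(π/a)*(∫ ω in (0:ℝ)..L, (L-ω)*‖Mv a v ℓ N ω‖^2)
      + 2*(1+1/ε)*(L*(∫ ω in (0:ℝ)..L, ‖Bv a v ℓ ω‖^2) + L^2/2*R^2) := by
  have hS := Sv_lower ha v F hL
  have cS := Sv_cont ha v
  have cM := Mv_cont a v ℓ N
  have cB := Bv_cont ha v ℓ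
  have key : ∫ ω in (0:ℝ)..L, 4*π^2*((L-ω)*‖Sv a v ω‖^2) ≤
      ∫ ω in (0:ℝ)..L, ((1+ε)*(π/a)*((L-ω)*‖Mv a v ℓ N ω‖^2)
        + (2*(1+1/ε)*(L*‖Bv a v ℓ ω‖^2) + 2*(1+1/ε)*R^2*(L-ω))) := by
    apply intervalIntegral.integral_mono_on hL
    · apply Continuous.intervalIntegrable; fun_prop
    · apply Continuous.intervalIntegrable; fun_prop
    · intro ω hω
      have h1 := norm_three ((√(π/a):ℝ)*Mv a v ℓ N ω) (Bv a v ℓ ω) _ hε (hR ω hω.1 hω.2)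
      have e1 : ‖2*(π:ℂ)*Sv a v ω‖^2 = 4*π^2*‖Sv a v ω‖^2 := by
        rw [norm_mul, norm_mul, Complex.norm_of_nonneg pi_pos.le]
        norm_num; ring
      have e2 : ‖((√(π/a):ℝ):ℂ)*Mv a v ℓ N ω‖^2 = (π/a)*‖Mv a v ℓ N ω‖^2 := by
        rw [norm_mul, Complex.norm_of_nonneg (Real.sqrt_nonneg _), mul_pow,
          Real.sq_sqrt (by positivity)]
      rw [e1, e2] at h1
      have h0 : 0 ≤ L - ω := by linarith [hω.2]
      have h2 := mul_le_mul_of_nonneg_left h1 h0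
      have h3 : (L-ω)*‖Bv a v ℓ ω‖^2 ≤ L*‖Bv a v ℓ ω‖^2 := by
        gcongr; linarith [hω.1]
      have h4 : 2*(1+1/ε)*((L-ω)*‖Bv a v ℓ ω‖^2) ≤ 2*(1+1/ε)*(L*‖Bv a v ℓ ω‖^2) := by gcongr
      nlinarith
  rw [intervalIntegral.integral_add (by apply Continuous.intervalIntegrable; fun_prop)
    (by apply Continuous.intervalIntegrable; fun_prop),
    intervalIntegral.integral_add (by apply Continuous.intervalIntegrable; fun_prop)
    (by apply Continuous.intervalIntegrable; fun_prop)] at key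
  simp only [intervalIntegral.integral_const_mul] at key
  rw [lin_int] at key
  have := mul_le_mul_of_nonneg_left hS (by positivity : 0 ≤ 4*π^2)
  nlinarith

lemma ev_exp1 {c η : ℝ} (hc : 0 < c) (hη : 0 < η) :
    ∀ᶠ T : ℝ in atTop, T^4*Real.exp (-(T^(2*η)/(128*c))) ≤ 1 := by
  have h1 : Tendsto (fun x : ℝ => x^(4/(2*η)) * Real.exp (-(1/(128*c))*x)) atTop (nhds 0) :=
    tendsto_rpow_mul_exp_neg_mul_atTop_nhds_zero _ _ (by positivity)
  have h2 := h1.comp (tendsto_rpow_atTop (show 0 < 2*η by positivity))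
  filter_upwards [h2.eventually_le_const (show (0:ℝ) < 1 by norm_num), eventually_gt_atTop 0] with T hT h0
  simp only [Function.comp] at hT
  rw [← Real.rpow_mul h0.le] at hT
  have e : 2*η*(4/(2*η)) = (4:ℕ) := by field_simp; norm_num
  rw [e, Real.rpow_natCast] at hT
  rw [show -(T^(2*η)/(128*c)) = -(1/(128*c))*T^(2*η) by ring]
  exact hT

lemma ev_exp2 {c : ℝ} (hc : 0 < c) :
    ∀ᶠ T : ℝ in atTop, T^4*Real.exp (-(T^2/(8*c))) ≤ 1 := by
  have h := ev_exp1 (show 0 < c/16 by positivity) (show (0:ℝ) < 1 by norm_num)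
  filter_upwards [h] with T hT
  rw [show -(T^2/(8*c)) = -(T^(2*(1:ℝ))/(128*(c/16))) by norm_num; ring]
  exact hT

set_option maxHeartbeats 1000000 in
lemma upper1 (hRH : RiemannHypothesis) {c η ε : ℝ} (hc : 0 < c) (hη : 0 < η) (hη1 : η < 1)
    (hε : 0 < ε) : ∃ K : ℝ, 0 ≤ K ∧ ∀ᶠ T : ℝ in atTop, ∀ v : ℝ, |v| ≤ 2*T → ∀ F : Finset ℝ,
      2*π^2*((1-η)*Real.log T)^2*∑ γ ∈ F, zw (c/T^2) v γ^2 ≤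
      (1+ε)*(π*√(2*π)/√c)*T*((2/3)*(1-η)*Real.log T^3) + K*(T*Real.log T^2) := by
  obtain ⟨C1, hC1, H1⟩ := main_formula hRH
  obtain ⟨C2, hC2, H2⟩ := B_l2 hc
  obtain ⟨C3, hC3, H3⟩ := M_bound
  refine ⟨(1+ε)*(π*√(2*π)/√c)*C3 + (1+ε)*(32*π*4) + (1+ε)*(π/c*2*16*4)
    + 2*(1+1/ε)*(C2 + C1^2*(1 + π/c*Real.exp 1)), by positivity, ?_⟩
  have hb : ∀ᶠ T : ℝ in atTop, 8*c ≤ T := eventually_ge_atTop _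
  filter_upwards [ev_exp1 hc hη, ev_exp2 hc, hb, eventually_ge_atTop 3] with T hT1 hT2 hT3 hT4 v hv F
  have hT0 : 0 < T := by linarith
  set ℓ := Real.log T with hℓ
  have hℓ1 : 1 ≤ ℓ := by
    rw [hℓ, Real.le_log_iff_exp_le hT0]
    linarith [Real.exp_one_lt_d9]
  have hlsq : ℓ^2 ≤ 4*T := log_sq_le (by linarith)
  set L := (1-η)*ℓ with hL
  have hη' : 0 < 1 - η := by linarith
  have hL0 : 0 < L := by positivity
  have hLℓ : L ≤ ℓ := by rw [hL]; nlinarith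
  set a := c/T^2 with ha
  have ha0 : 0 < a := by positivity
  have ha8 : a ≤ 1/8 := by
    rw [ha, div_le_iff₀ (by positivity)]; nlinarith
  have heL : Real.exp L = T^(1-η) := by
    rw [hL, Real.rpow_def_of_pos hT0, ← hℓ, mul_comm]
  have heL1 : 1 ≤ Real.exp L := Real.one_le_exp hL0.le
  have heLT : Real.exp L ≤ T := by
    rw [← Real.exp_log hT0]; exact Real.exp_le_exp.2 hLℓ
  set N := ⌈Real.exp (L+1)⌉₊ with hN
  have hN1 : Real.exp (L+1) ≤ N := Nat.le_ceil _
  have hN2 : (N:ℝ) ≤ 4*Real.exp L := by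
    have h1 : (N:ℝ) < Real.exp (L+1) + 1 := Nat.ceil_lt_add_one (Real.exp_nonneg (L+1))
    rw [Real.exp_add] at h1
    have h9 := Real.exp_one_lt_d9
    have h8 : Real.exp L*Real.exp 1 ≤ Real.exp L*2.8 := by gcongr; linarith
    linarith
  have hN3 : 2 ≤ N := by
    have h1 : Real.exp 1 ≤ Real.exp (L+1) := Real.exp_le_exp.2 (by linarith)
    have h2 : (1:ℝ) < N := by linarith [Real.exp_one_gt_d9]
    exact_mod_cast h2
  have hN0 : (0:ℝ) < N := by positivity
  have hR : ∀ ω, 0 ≤ ω → ω ≤ L →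
      ‖2*π*Sv a v ω - (√(π/a):ℝ)*Mv a v ℓ N ω - Bv a v ℓ ω‖ ≤
      C1*(Real.exp (L/2) + √(π/a)*Real.exp (L-(1/(8*a)-1)/2)) := by
    intro ω h0 h1
    apply H1 a v ω L ℓ N ha0 ha8 h0 h1
    intro n hn _
    have h2 : L + 1 ≤ Real.log n := by
      rw [Real.le_log_iff_exp_le (by exact_mod_cast (by omega : 0 < n))]
      exact hN1.trans (by exact_mod_cast hn)
    rw [abs_sub_comm, abs_of_nonneg (by linarith)]; linarith
  have h1 := comb ha0 hL0.le hε hR F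
  have h2 := H3 a v ℓ L N ha0 hℓ1 hL0.le hN3
  have h3 := H2 T v L hT4 hv hL0
  have pia : π/a = π/c*T^2 := by rw [ha]; field_simp
  -- main terms
  have m1 : π/a*√(2*π*a) = π*√(2*π)/√c*T := by
    have : √(2*π*a) = √(2*π)*(√c/T) := by
      rw [Real.sqrt_mul (by positivity), ha, Real.sqrt_div hc.le, Real.sqrt_sq hT0.le]
    have hs : √c*√c = c := Real.mul_self_sqrt hc.le
    have hs0 : √c ≠ 0 := by positivity
    rw [this, pia, show π/c = π/(√c*√c) by rw [hs]]
    field_simp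
  have m2 : ℓ^2*L/2 + L^3/6 ≤ (2/3)*(1-η)*ℓ^3 := by
    have : L^3 ≤ L*ℓ^2 := by
      have h7 : L^2 ≤ ℓ^2 := by gcongr
      have h8 : L*L^2 ≤ L*ℓ^2 := by gcongr
      linarith [show L^3 = L*L^2 by ring]
    have e : (2/3)*(1-η)*ℓ^3 = (2/3)*(L*ℓ^2) := by rw [hL]; ring
    rw [e]; linarith
  have m3 : L^2 ≤ ℓ^2 := by gcongr
  have m4 : π/a*(32*a*N) ≤ 32*π*4*(T*ℓ^2) := by
    have : π/a*(32*a*N) = 32*π*N := by field_simp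
    rw [this]
    have : (N:ℝ) ≤ 4*(T*ℓ^2) := by
      have h7 : 1 ≤ ℓ^2 := one_le_pow₀ hℓ1
      have h8 : T*1 ≤ T*ℓ^2 := by gcongr
      linarith
    calc 32*π*N ≤ 32*π*(4*(T*ℓ^2)) := by gcongr
      _ = _ := by ring
  have m5 : Real.exp (-(1/(8*a*N^2))) ≤ Real.exp (-(T^(2*η)/(128*c))) := by
    apply Real.exp_le_exp.2
    have hNT : (N:ℝ)^2*T^(2*η) ≤ 16*T^2 := by
      have e1 : (Real.exp L)^2*T^(2*η) = T^2 := by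
        rw [heL, ← Real.rpow_natCast, ← Real.rpow_mul hT0.le, ← Real.rpow_add hT0,
          ← Real.rpow_natCast]
        congr 1; push_cast; ring
      have : (N:ℝ)^2 ≤ (4*Real.exp L)^2 := by gcongr
      calc (N:ℝ)^2*T^(2*η) ≤ (4*Real.exp L)^2*T^(2*η) := by gcongr
        _ = 16*((Real.exp L)^2*T^(2*η)) := by ring
        _ = _ := by rw [e1]
    apply neg_le_neg
    rw [ha]
    rw [div_le_div_iff₀ (by positivity) (by positivity)]
    have : T^(2*η)*(8*(c/T^2)*N^2) = 8*c*((N:ℝ)^2*T^(2*η))/T^2 := by ring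
    rw [this, div_le_iff₀ (by positivity)]
    have h8 : 8*c*((N:ℝ)^2*T^(2*η)) ≤ 8*c*(16*T^2) := by gcongr
    linarith
  have m6 : π/a*(2*L^2*(N^2*ℓ^2*Real.exp (-(1/(8*a*N^2))))) ≤ π/c*2*16*4*(T*ℓ^2) := by
    rw [pia]
    have hNT : (N:ℝ)^2 ≤ 16*T^2 := by
      have : (N:ℝ) ≤ 4*T := by linarith
      calc (N:ℝ)^2 ≤ (4*T)^2 := by gcongr
        _ = _ := by ring
    calc π/c*T^2*(2*L^2*(N^2*ℓ^2*Real.exp (-(1/(8*a*N^2)))))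
        ≤ π/c*T^2*(2*ℓ^2*((16*T^2)*ℓ^2*Real.exp (-(T^(2*η)/(128*c))))) := by gcongr
      _ = π/c*2*16*ℓ^2*ℓ^2*(T^4*Real.exp (-(T^(2*η)/(128*c)))) := by ring
      _ ≤ π/c*2*16*ℓ^2*ℓ^2*1 := by gcongr
      _ ≤ π/c*2*16*ℓ^2*(4*T)*1 := by gcongr
      _ = _ := by ring
  have m7 : L^2/2*(C1*(Real.exp (L/2) + √(π/a)*Real.exp (L-(1/(8*a)-1)/2)))^2
      ≤ C1^2*(1 + π/c*Real.exp 1)*(T*ℓ^2) := by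
    have e1 : Real.exp (L/2)^2 ≤ T := by
      rw [← Real.exp_nat_mul]; convert heLT using 2; push_cast; ring
    have e2 : (√(π/a)*Real.exp (L-(1/(8*a)-1)/2))^2 ≤ π/c*Real.exp 1 := by
      rw [mul_pow, Real.sq_sqrt (by positivity), ← Real.exp_nat_mul, pia]
      have : Real.exp ((2:ℕ)*(L-(1/(8*a)-1)/2)) =
          Real.exp 1*(Real.exp L^2*Real.exp (-(T^2/(8*c)))) := by
        rw [← Real.exp_nat_mul, ← Real.exp_add, ← Real.exp_add]
        congr 1; rw [ha]; push_cast; field_simp; ring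
      rw [this]
      calc π/c*T^2*(Real.exp 1*(Real.exp L^2*Real.exp (-(T^2/(8*c)))))
          ≤ π/c*T^2*(Real.exp 1*(T^2*Real.exp (-(T^2/(8*c))))) := by gcongr
        _ = π/c*Real.exp 1*(T^4*Real.exp (-(T^2/(8*c)))) := by ring
        _ ≤ π/c*Real.exp 1*1 := by gcongr
        _ = _ := by ring
    set p := Real.exp (L/2)
    set q := √(π/a)*Real.exp (L-(1/(8*a)-1)/2)
    have e3 : (p+q)^2 ≤ 2*(1 + π/c*Real.exp 1)*T := by
      have h6 : 0 ≤ π/c*Real.exp 1 := by positivity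
      have h7 : (p+q)^2 ≤ 2*(p^2+q^2) := by linarith [sq_nonneg (p-q), sq_nonneg (p+q), show 2*(p^2+q^2) = (p+q)^2 + (p-q)^2 by ring]
      have h8 : π/c*Real.exp 1*1 ≤ π/c*Real.exp 1*T := by gcongr; linarith
      linarith
    calc L^2/2*(C1*(p+q))^2 = L^2/2*(C1^2*(p+q)^2) := by ring
      _ ≤ ℓ^2/2*(C1^2*(2*(1 + π/c*Real.exp 1)*T)) := by gcongr
      _ = _ := by ring
  have m8 : L*(∫ ω in (0:ℝ)..L, ‖Bv a v ℓ ω‖^2) ≤ C2*(T*ℓ^2) := by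
    calc L*(∫ ω in (0:ℝ)..L, ‖Bv a v ℓ ω‖^2) ≤ ℓ*(C2*(T*ℓ)) := by
          apply mul_le_mul hLℓ h3 _ (by linarith)
          exact intervalIntegral.integral_nonneg hL0.le (fun _ _ => by positivity)
      _ = _ := by ring
  have t1 : π/a*(∫ ω in (0:ℝ)..L, (L-ω)*‖Mv a v ℓ N ω‖^2) ≤
      (π*√(2*π)/√c)*T*((2/3)*(1-η)*ℓ^3) + ((π*√(2*π)/√c)*C3 + (32*π*4) + (π/c*2*16*4))*(T*ℓ^2) := by
    have := mul_le_mul_of_nonneg_left h2 (show 0 ≤ π/a by positivity)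
    have h5 : π/a*(√(2*π*a)*(ℓ^2*L/2 + L^3/6 + C3*L^2)) ≤
        (π*√(2*π)/√c)*T*((2/3)*(1-η)*ℓ^3) + (π*√(2*π)/√c)*C3*(T*ℓ^2) := by
      rw [← mul_assoc, m1]
      calc π*√(2*π)/√c*T*(ℓ^2*L/2 + L^3/6 + C3*L^2)
          ≤ π*√(2*π)/√c*T*((2/3)*(1-η)*ℓ^3 + C3*ℓ^2) := by gcongr
        _ = _ := by ring
    linarith
  have t2 := mul_le_mul_of_nonneg_left t1 (show 0 ≤ 1+ε by positivity)
  have t3 := mul_le_mul_of_nonneg_left (add_le_add m8 m7) (show 0 ≤ 2*(1+1/ε) by positivity)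
  linarith

lemma upper2 (hRH : RiemannHypothesis) {c δ : ℝ} (hc : 0 < c) (hδ : 0 < δ) :
    ∀ᶠ T : ℝ in atTop, ∀ v : ℝ, |v| ≤ 2*T → ∀ F : Finset ℝ,
      ∑ γ ∈ F, zw (c/T^2) v γ^2 ≤ (1+δ)*((2/3)*(T*Real.log T)/(√c*√(2*π))) := by
  set η := δ/(4+δ) with hη
  have hη0 : 0 < η := by positivity
  have hη1 : η < 1 := by rw [hη, div_lt_one (by positivity)]; linarith
  have hη2 : 0 < 1 - η := by linarith
  obtain ⟨K, hK, H⟩ := upper1 hRH hc hη0 hη1 hη0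
  have hs : 0 < √c := by positivity
  have hp : 0 < √(2*π) := by positivity
  have hlog : ∀ᶠ T : ℝ in atTop, K/(2*π^2*(1-η)^2)/((δ/2)*((2/3)/(√c*√(2*π)))) ≤ Real.log T :=
    Real.tendsto_log_atTop.eventually_ge_atTop _
  filter_upwards [H, hlog, eventually_gt_atTop 1] with T hT hl hT1 v hv F
  have h1 := hT v hv F
  have hT0 : 0 < T := by linarith
  have hℓ : 0 < Real.log T := Real.log_pos hT1
  set ℓ := Real.log T
  set Z := ∑ γ ∈ F, zw (c/T^2) v γ^2
  rw [div_le_iff₀ (by positivity)] at hl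
  have hpp : √(2*π)*√(2*π) = 2*π := Real.mul_self_sqrt (by positivity)
  have e : (1+η)/(1-η) = 1+δ/2 := by
    have h2 : 1 - η = 4/(4+δ) := by rw [hη]; field_simp; ring
    have h3 : 1 + η = (4+2*δ)/(4+δ) := by rw [hη]; field_simp; ring
    rw [h2, h3]; field_simp; ring
  have h4 : (1+η)*(π*√(2*π)/√c)*T*((2/3)*(1-η)*ℓ^3) =
      (2*π^2*((1-η)*ℓ)^2)*((1+η)/(1-η)*((2/3)*(T*ℓ)/(√c*√(2*π)))) := by
    have h5 : π*√(2*π) = 2*π^2/√(2*π) := by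
      rw [eq_div_iff hp.ne', mul_assoc, hpp]; ring
    rw [h5]; field_simp
  have h6 : K*(T*ℓ^2) = (2*π^2*((1-η)*ℓ)^2)*(K/(2*π^2*(1-η)^2)*T) := by
    field_simp
  rw [h4, h6, ← mul_add] at h1
  have h7 := le_of_mul_le_mul_left h1 (by positivity)
  rw [e] at h7
  have h8 : K/(2*π^2*(1-η)^2)*T ≤ ℓ*((δ/2)*((2/3)/(√c*√(2*π))))*T := by gcongr
  have h9 : ℓ*((δ/2)*((2/3)/(√c*√(2*π))))*T = (δ/2)*((2/3)*(T*ℓ)/(√c*√(2*π))) := by ring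
  linarith

lemma gauss_trunc {q d x lo hi : ℝ} (hq : 0 < q) (hd : 0 ≤ d) (h1 : lo ≤ x - d) (h2 : x + d ≤ hi) :
    √(π/q) - Real.exp (-(q/2)*d^2)*√(π/(q/2)) ≤ ∫ v in lo..hi, Real.exp (-q*(x-v)^2) := by
  have i1 : Integrable (fun v => Real.exp (-q*(x-v)^2)) := by
    have := gauss_int hq x
    convert this using 3; ring
  have i2 : Integrable (fun v => Real.exp (-(q/2)*(x-v)^2)) := by
    have := gauss_int (show 0 < q/2 by positivity) x
    convert this using 3; ring
  have e1 : ∫ v, Real.exp (-q*(x-v)^2) = √(π/q) := by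
    rw [← gauss_integral q x]; congr 1; funext v; congr 1; ring
  have e2 : ∫ v, Real.exp (-(q/2)*(x-v)^2) = √(π/(q/2)) := by
    rw [← gauss_integral (q/2) x]; congr 1; funext v; congr 1; ring
  rw [intervalIntegral.integral_of_le (by linarith), ← integral_indicator measurableSet_Ioc,
    ← e1, ← e2, ← integral_const_mul, sub_le_iff_le_add, ← integral_add (i1.indicator measurableSet_Ioc) (i2.const_mul _)]
  apply integral_mono i1 ((i1.indicator measurableSet_Ioc).add (i2.const_mul _))
  intro v
  simp only [Pi.add_apply]
  by_cases hv : v ∈ Ioc lo hi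
  · rw [indicator_of_mem hv]
    have : 0 ≤ Real.exp (-(q/2)*d^2)*Real.exp (-(q/2)*(x-v)^2) := by positivity
    linarith
  · rw [indicator_of_notMem hv, zero_add, ← Real.exp_add]
    apply Real.exp_le_exp.2
    have : d^2 ≤ (x-v)^2 := by
      rw [mem_Ioc, not_and_or, not_lt, not_le] at hv
      rcases hv with h | h
      · have : d ≤ x - v := by linarith
        gcongr
      · have : d ≤ v - x := by linarith
        calc d^2 ≤ (v-x)^2 := by gcongr
          _ = _ := by ring
    nlinarith

lemma exp_small {β : ℝ} (hβ : 0 < β) {c k : ℝ} (hc : c = (1/β^2)^2) (hk : 1/2 ≤ k) :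
    √2*Real.exp (-(k*(c*β^2))) ≤ 3*β^2 := by
  have e : c*β^2 = 1/β^2 := by rw [hc]; field_simp
  rw [e]
  have h1 : √2 ≤ 3/2 := by
    rw [Real.sqrt_le_left (by norm_num)]; norm_num
  have h2 : Real.exp (-(k*(1/β^2))) ≤ 2*β^2 := by
    rw [Real.exp_neg, inv_le_comm₀ (Real.exp_pos _) (by positivity)]
    have h3 := Real.add_one_le_exp (k*(1/β^2))
    have h4 : (1/2)*(1/β^2) ≤ k*(1/β^2) := by gcongr
    have h5 : (2*β^2)⁻¹ = (1/2)*(1/β^2) := by field_simp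
    linarith
  calc √2*Real.exp (-(k*(1/β^2))) ≤ (3/2)*(2*β^2) := by gcongr
    _ = _ := by ring

lemma sqrt_half {p q : ℝ} : √(p/(q/2)) = √2*√(p/q) := by
  rw [← Real.sqrt_mul (by norm_num)]; congr 1
  ring

lemma zw_cont (a γ : ℝ) : Continuous (fun v => zw a v γ) := by
  unfold zw; fun_prop

lemma sum_sq_upper (hRH : RiemannHypothesis) {ε : ℝ} (hε : 0 < ε) (hε1 : ε ≤ 1) :
    ∀ᶠ T : ℝ in atTop, ∑ γ ∈ ZT T, (zm γ:ℝ)^2 ≤ (4/3)*(1+ε)*(T*Real.log T/(2*π)) := by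
  set β := ε/16 with hβd
  have hβ : 0 < β := by positivity
  have hβ1 : β ≤ 1/16 := by rw [hβd]; linarith
  set c := (1/β^2)^2 with hc
  have hc0 : 0 < c := by positivity
  have hsc : √c = 1/β^2 := Real.sqrt_sq (by positivity)
  filter_upwards [upper2 hRH hc0 hβ, eventually_gt_atTop 1] with T hT hT1
  have hT0 : 0 < T := by linarith
  have hℓ : 0 < Real.log T := Real.log_pos hT1
  set ℓ := Real.log T
  set a := c/T^2 with ha
  have ha0 : 0 < a := by positivity
  set U := (1+β)*((2/3)*(T*ℓ)/(√c*√(2*π))) with hU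
  have h1 : ∫ v in (-(β*T))..((1+β)*T), ∑ γ ∈ ZT T, zw a v γ^2 ≤ ∫ v in (-(β*T))..((1+β)*T), U := by
    apply intervalIntegral.integral_mono_on (by nlinarith)
    · apply Continuous.intervalIntegrable
      exact continuous_finsetSum _ (fun γ _ => (zw_cont a γ).pow 2)
    · simp
    · intro v hv
      apply hT v
      rw [abs_le]; constructor <;> nlinarith [hv.1, hv.2]
  rw [intervalIntegral.integral_const, smul_eq_mul,
    intervalIntegral.integral_finsetSum (f := fun γ v => zw a v γ^2) (fun γ _ => ((zw_cont a γ).pow 2).intervalIntegrable _ _)] at h1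
  have hG : ∀ γ ∈ ZT T, (zm γ:ℝ)^2*(T*√(π/2)/√c*(1-3*β^2)) ≤
      ∫ v in (-(β*T))..((1+β)*T), zw a v γ^2 := by
    intro γ hγ
    rw [mem_ZT] at hγ
    have e : ∀ v, zw a v γ^2 = (zm γ:ℝ)^2*Real.exp (-(2*a)*(γ-v)^2) := by
      intro v
      unfold zw
      rw [mul_pow, ← Real.exp_nat_mul]; congr 2; push_cast; ring
    simp only [e]
    rw [intervalIntegral.integral_const_mul]
    gcongr
    refine le_trans ?_ (gauss_trunc (q := 2*a) (d := β*T) (by positivity) (by positivity) (by linarith [hγ.2.1]) (by linarith [hγ.2.2]))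
    rw [sqrt_half]
    have e2 : √(π/(2*a)) = T*√(π/2)/√c := by
      have : π/(2*a) = T^2*(π/2)/c := by rw [ha]; field_simp
      rw [this, Real.sqrt_div (by positivity), Real.sqrt_mul (by positivity), Real.sqrt_sq hT0.le]
    rw [e2]
    have e3 : -(2*a/2)*(β*T)^2 = -(1*(c*β^2)) := by rw [ha]; field_simp
    rw [e3]
    have h5 := exp_small hβ hc (show (1:ℝ)/2 ≤ 1 by norm_num)
    have h6 : 0 ≤ T*√(π/2)/√c := by positivity
    nlinarith
  have h2 := (Finset.sum_le_sum hG).trans h1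
  rw [← Finset.sum_mul] at h2
  set S2 := ∑ γ ∈ ZT T, (zm γ:ℝ)^2
  have h3 : 0 < 1 - 3*β^2 := by nlinarith
  have hpp : √(2*π)*√(π/2) = π := by
    rw [← Real.sqrt_mul (by positivity), show 2*π*(π/2) = π^2 by ring, Real.sqrt_sq pi_pos.le]
  have hsc0 : 0 < √c := by positivity
  have hp2 : 0 < √(π/2) := by positivity
  have e4 : ((1+β)*T - -(β*T))*U = (T*√(π/2)/√c)*((1+2*β)*(1+β)*((4/3)*(T*ℓ/(2*π)))) := by
    have : (1:ℝ)/√(2*π) = √(π/2)/π := by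
      rw [div_eq_div_iff (by positivity) (by positivity)]; linarith
    rw [hU, show (1+β)*(2/3*(T*ℓ)/(√c*√(2*π))) = (1+β)*(2/3*(T*ℓ)/√c)*(1/√(2*π)) by ring, this]
    field_simp; ring
  rw [e4] at h2
  have h4 : S2*(1-3*β^2) ≤ (1+2*β)*(1+β)*((4/3)*(T*ℓ/(2*π))) := by
    apply le_of_mul_le_mul_left _ (show 0 < T*√(π/2)/√c by positivity)
    linarith
  set X := T*ℓ/(2*π) with hX
  have hX0 : 0 < X := by positivity
  have h5 : (1+2*β)*(1+β) ≤ (1+ε)*(1-3*β^2) := by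
    rw [show ε = 16*β by rw [hβd]; ring]
    nlinarith [mul_pos hβ hβ, mul_le_mul_of_nonneg_left hβ1 (mul_pos hβ hβ).le]
  have h6 : S2*(1-3*β^2) ≤ ((4/3)*(1+ε)*X)*(1-3*β^2) := by
    have := mul_le_mul_of_nonneg_right h5 (show 0 ≤ (4/3)*X by positivity)
    linarith
  exact le_of_mul_le_mul_right h6 h3

def Wv (a v : ℝ) : ℝ := ∑' γ, zw a v γ

lemma Sv_zero (a v : ℝ) : Sv a v 0 = (Wv a v : ℂ) := by
  unfold Sv Wv
  rw [Complex.ofReal_tsum]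
  congr 1; funext γ
  unfold wv zw
  push_cast
  simp

lemma Wv_asym (hRH : RiemannHypothesis) {c : ℝ} (hc : 0 < c) : ∃ K : ℝ, 0 ≤ K ∧
    ∀ᶠ T : ℝ in atTop, ∀ v : ℝ, |v| ≤ 2*T →
      |2*π*Wv (c/T^2) v - T*√(π/c)*Real.log T| ≤ K*(T*√(Real.log T)) := by
  obtain ⟨C1, hC1, H1⟩ := main_formula hRH
  obtain ⟨C2, hC2, H2⟩ := B_zero hc
  refine ⟨C2 + C1*(1 + √(π/c)*Real.exp (1/2)), by positivity, ?_⟩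
  filter_upwards [eventually_ge_atTop (8*c), eventually_ge_atTop 3] with T hT3 hT4 v hv
  have hT0 : 0 < T := by linarith
  have hℓ1 : 1 ≤ Real.log T := by
    rw [Real.le_log_iff_exp_le hT0]
    linarith [Real.exp_one_lt_d9]
  have h2 := H2 T v hT4 hv
  set ℓ := Real.log T with hℓ
  set a := c/T^2 with ha
  have ha0 : 0 < a := by positivity
  have ha8 : a ≤ 1/8 := by
    rw [ha, div_le_iff₀ (by positivity)]; nlinarith
  have h1 := H1 a v 0 0 ℓ 0 ha0 ha8 le_rfl le_rfl (by
    intro n _ hn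
    have h5 : Real.log 2 ≤ Real.log n := Real.log_le_log (by norm_num) (by exact_mod_cast hn)
    rw [zero_sub, abs_neg]
    refine le_trans ?_ (le_abs_self _)
    linarith [Real.log_two_gt_d9])
  have hκ : √(π/a) = T*√(π/c) := by
    have : π/a = T^2*(π/c) := by rw [ha]; field_simp
    rw [this, Real.sqrt_mul (by positivity), Real.sqrt_sq hT0.le]
  have hE : Ev a v 0 = 1 := by simp [Ev]
  rw [Sv_zero, hE, hκ] at h1
  simp only [Finset.range_zero, Finset.sum_empty, sub_zero, mul_one, zero_div, Real.exp_zero] at h1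
  set B := Bv a v ℓ 0
  have e : ((2*π*Wv a v - T*√(π/c)*ℓ : ℝ) : ℂ) = (2*π*(Wv a v:ℂ) - ((T*√(π/c):ℝ):ℂ)*ℓ - B) + B := by
    push_cast; ring
  have h6 : |2*π*Wv a v - T*√(π/c)*ℓ| ≤ ‖2*π*(Wv a v:ℂ) - ((T*√(π/c):ℝ):ℂ)*ℓ - B‖ + ‖B‖ := by
    rw [← Real.norm_eq_abs, ← Complex.norm_real, e]
    exact norm_add_le _ _
  have hs : 1 ≤ √ℓ := Real.one_le_sqrt.2 hℓ1
  have h7 : Real.exp (0-(1/(8*a)-1)/2) ≤ Real.exp (1/2) := by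
    apply Real.exp_le_exp.2
    have : 0 ≤ 1/(8*a) := by positivity
    linarith
  have hTs : T*1 ≤ T*√ℓ := by gcongr
  have h8 : C1*(1 + T*√(π/c)*Real.exp (0-(1/(8*a)-1)/2)) ≤ C1*(1 + √(π/c)*Real.exp (1/2))*(T*√ℓ) := by
    have h9 : T*√(π/c)*Real.exp (0-(1/(8*a)-1)/2) ≤ (√(π/c)*Real.exp (1/2))*(T*√ℓ) := by
      calc T*√(π/c)*Real.exp (0-(1/(8*a)-1)/2) ≤ T*√(π/c)*Real.exp (1/2) := by gcongr
        _ = (√(π/c)*Real.exp (1/2))*(T*1) := by ring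
        _ ≤ _ := by gcongr
    calc C1*(1 + T*√(π/c)*Real.exp (0-(1/(8*a)-1)/2)) ≤ C1*(T*√ℓ + (√(π/c)*Real.exp (1/2))*(T*√ℓ)) := by
          gcongr; linarith
      _ = _ := by ring
  linarith

lemma ZT_lower {a v β T : ℝ} (ha : 0 < a) (hβ : 0 ≤ β*T) (h1 : β*T ≤ v) (h2 : v ≤ T - β*T) :
    Wv a v - Real.exp (-(a/2*(β*T)^2))*Wv (a/2) v ≤ ∑ γ ∈ ZT T, zw a v γ := by
  have s1 := zw_summable ha v
  have s2 := zw_summable (show 0 < a/2 by positivity) v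
  have h3 : ∑ γ ∈ ZT T, zw a v γ = ∑' γ, (if γ ∈ ZT T then zw a v γ else 0) := by
    rw [tsum_eq_sum (s := ZT T) (fun γ hγ => by simp [hγ])]
    exact Finset.sum_congr rfl (fun γ hγ => by simp [hγ])
  have s3 : Summable (fun γ => if γ ∈ ZT T then zw a v γ else 0) :=
    summable_of_ne_finset_zero (s := ZT T) (fun γ hγ => by simp [hγ])
  rw [h3, sub_le_iff_le_add]
  unfold Wv
  rw [← tsum_mul_left, ← s3.tsum_add (s2.mul_left _)]
  apply s1.tsum_le_tsum _ (s3.add (s2.mul_left _))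
  intro γ
  by_cases hγ : γ ∈ ZT T
  · rw [if_pos hγ]
    have := mul_nonneg (Real.exp_nonneg (-(a/2*(β*T)^2))) (zw_nonneg (a/2) v γ)
    linarith
  · rw [if_neg hγ, zero_add]
    by_cases h0 : xiF (1/2+γ*I) = 0
    · unfold zw
      rw [mul_left_comm, ← Real.exp_add]
      gcongr
      have : (β*T)^2 ≤ (γ-v)^2 := by
        have h5 : ¬ (0 < γ ∧ γ ≤ T) := fun h => hγ (mem_ZT.2 ⟨h0, h.1, h.2⟩)
        rw [not_and_or, not_lt, not_le] at h5
        rcases h5 with h | h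
        · calc (β*T)^2 ≤ (v-γ)^2 := by gcongr; linarith
            _ = _ := by ring
        · gcongr; linarith
      nlinarith
    · have : zm γ = 0 := ord_eq_zero h0
      simp [zw, this]

lemma N_lower (hRH : RiemannHypothesis) {ε : ℝ} (hε : 0 < ε) (hε1 : ε ≤ 1) :
    ∀ᶠ T : ℝ in atTop, (1-ε)*(T*Real.log T/(2*π)) ≤ ∑ γ ∈ ZT T, (zm γ:ℝ) := by
  set β := ε/16 with hβd
  have hβ : 0 < β := by positivity
  have hβ1 : β ≤ 1/16 := by rw [hβd]; linarith
  set c := (1/β^2)^2 with hc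
  have hc0 : 0 < c := by positivity
  obtain ⟨K1, hK1, H1⟩ := Wv_asym hRH hc0
  obtain ⟨K2, hK2, H2⟩ := Wv_asym hRH (show 0 < c/2 by positivity)
  have hsq : ∀ᶠ T : ℝ in atTop, ((K1+K2)/√(π/c))/(ε/2) ≤ √(Real.log T) :=
    (Real.tendsto_sqrt_atTop.comp Real.tendsto_log_atTop).eventually_ge_atTop _
  filter_upwards [H1, H2, hsq, eventually_gt_atTop 1] with T hT hT' hsq hT1
  have hT0 : 0 < T := by linarith
  have hℓ : 0 < Real.log T := Real.log_pos hT1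
  set ℓ := Real.log T
  set a := c/T^2 with ha
  have ha0 : 0 < a := by positivity
  have ha2 : c/2/T^2 = a/2 := by rw [ha]; ring
  rw [ha2] at hT'
  set κ := T*√(π/c) with hκ
  have hκ0 : 0 < κ := by positivity
  set U := κ*ℓ*(1-3*β^2) - (K1+K2)*(T*√ℓ) with hU
  have hE := exp_small hβ hc (show (1:ℝ)/2 ≤ 1/2 by norm_num)
  have hpt : ∀ v, β*T ≤ v → v ≤ T - β*T → U ≤ 2*π*∑ γ ∈ ZT T, zw a v γ := by
    intro v hv1 hv2
    have hv : |v| ≤ 2*T := by rw [abs_le]; constructor <;> nlinarith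
    have h1 := (abs_le.1 (hT v hv)).1
    have h2 := (abs_le.1 (hT' v hv)).2
    have h3 := ZT_lower ha0 (by positivity) hv1 hv2
    have e3 : a/2*(β*T)^2 = 1/2*(c*β^2) := by rw [ha]; field_simp
    rw [e3] at h3
    set E := Real.exp (-(1/2*(c*β^2)))
    have hE0 : 0 ≤ E := Real.exp_nonneg _
    have hE1 : E ≤ 1 := Real.exp_le_one_iff.2 (by have : 0 ≤ c*β^2 := by positivity
                                                  linarith)
    rw [sqrt_half] at h2
    have h4 : 2*π*Wv (a/2) v ≤ √2*κ*ℓ + K2*(T*√ℓ) := by rw [hκ]; linarith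
    have h5 : E*(2*π*Wv (a/2) v) ≤ E*(√2*κ*ℓ + K2*(T*√ℓ)) := by gcongr
    have h6 : E*(K2*(T*√ℓ)) ≤ 1*(K2*(T*√ℓ)) := by gcongr
    have h7 : √2*E*(κ*ℓ) ≤ 3*β^2*(κ*ℓ) := by gcongr
    have h8 := mul_le_mul_of_nonneg_left h3 (show 0 ≤ 2*π by positivity)
    rw [hU]
    linarith
  have h1 : ∫ v in (β*T)..(T-β*T), U ≤ ∫ v in (β*T)..(T-β*T), 2*π*∑ γ ∈ ZT T, zw a v γ := by
    apply intervalIntegral.integral_mono_on (by nlinarith)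
    · simp
    · apply Continuous.intervalIntegrable
      exact (continuous_finsetSum _ (fun γ _ => (zw_cont a γ))).const_mul _
    · intro v hv
      exact hpt v hv.1 hv.2
  rw [intervalIntegral.integral_const, smul_eq_mul, intervalIntegral.integral_const_mul,
    intervalIntegral.integral_finsetSum (fun γ _ => (zw_cont a γ).intervalIntegrable _ _)] at h1
  have hκa : √(π/a) = κ := by
    have : π/a = T^2*(π/c) := by rw [ha]; field_simp
    rw [this, Real.sqrt_mul (by positivity), Real.sqrt_sq hT0.le]
  have hG : ∀ γ ∈ ZT T, ∫ v in (β*T)..(T-β*T), zw a v γ ≤ (zm γ:ℝ)*κ := by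
    intro γ _
    unfold zw
    rw [intervalIntegral.integral_const_mul]
    gcongr
    have i1 : Integrable (fun v => Real.exp (-a*(γ-v)^2)) := by
      have := gauss_int ha0 γ
      convert this using 3; ring
    have e1 : ∫ v, Real.exp (-a*(γ-v)^2) = √(π/a) := by
      rw [← gauss_integral a γ]; congr 1; funext v; congr 1; ring
    rw [intervalIntegral.integral_of_le (by nlinarith), ← hκa, ← e1]
    exact setIntegral_le_integral i1 (Eventually.of_forall fun v => Real.exp_nonneg _)
  have h2 := Finset.sum_le_sum hG
  rw [← Finset.sum_mul] at h2
  set Nn := ∑ γ ∈ ZT T, (zm γ:ℝ)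
  have h3 : (T - β*T - β*T)*U ≤ 2*π*(Nn*κ) := h1.trans (by gcongr)
  have hU2 : κ*(ℓ*(1-3*β^2-ε/2)) ≤ U := by
    rw [div_le_iff₀ (by positivity), div_le_iff₀ (by positivity)] at hsq
    have hs : √ℓ*√ℓ = ℓ := Real.mul_self_sqrt hℓ.le
    have h4 := mul_le_mul_of_nonneg_right hsq (show 0 ≤ T*√ℓ by positivity)
    have h5 : √ℓ*(ε/2)*√(π/c)*(T*√ℓ) = κ*(ℓ*(ε/2)) := by
      calc √ℓ*(ε/2)*√(π/c)*(T*√ℓ) = (√ℓ*√ℓ)*(ε/2)*√(π/c)*T := by ring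
        _ = _ := by rw [hs, hκ]; ring
    rw [hU]; linarith
  have hT2 : 0 ≤ T - β*T - β*T := by nlinarith
  have h4 : κ*(T*ℓ*((1-2*β)*(1-3*β^2-ε/2))) ≤ κ*(2*π*Nn) := by
    have := mul_le_mul_of_nonneg_left hU2 hT2
    linarith
  have h5 := le_of_mul_le_mul_left h4 hκ0
  have h6 : 1 - ε ≤ (1-2*β)*(1-3*β^2-ε/2) := by
    rw [show ε = 16*β by rw [hβd]; ring]
    nlinarith [mul_pos hβ hβ, mul_le_mul_of_nonneg_left hβ1 hβ.le, mul_pos hβ (mul_pos hβ hβ)]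
  have h7 : T*ℓ*(1-ε) ≤ T*ℓ*((1-2*β)*(1-3*β^2-ε/2)) := by gcongr
  rw [← mul_div_assoc, div_le_iff₀ (by positivity)]
  linarith

theorem final_dev (hRH : RiemannHypothesis) : ∀ ε : ℝ, 0 < ε → ∃ T₀ : ℝ, ∀ T : ℝ, T₀ ≤ T →
    (2/3-ε)*NofT T ≤ NsofT T := by
  intro ε hε
  set δ := min ε 1/8 with hδ
  have hδ0 : 0 < δ := by positivity
  have hδ1 : δ ≤ ε/8 := by rw [hδ]; gcongr; exact min_le_left _ _
  have hδ2 : δ ≤ 1/8 := by rw [hδ]; gcongr; exact min_le_right _ _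
  have h := (sum_sq_upper hRH hδ0 (by linarith)).and
    ((N_lower hRH hδ0 (by linarith)).and (eventually_ge_atTop 1))
  obtain ⟨T₀, hT₀⟩ := eventually_atTop.1 h
  refine ⟨T₀, fun T hT => ?_⟩
  obtain ⟨h1, h2, h3⟩ := hT₀ T hT
  have h4 := NsofT_ge hRH T
  rw [← NofT_eq hRH T] at h2
  have hX : 0 ≤ T*Real.log T/(2*π) := by
    have := Real.log_nonneg h3
    positivity
  set X := T*Real.log T/(2*π)
  have h5 : (4/3)*(1+δ) ≤ (4/3+ε)*(1-δ) := by
    nlinarith [mul_le_mul_of_nonneg_left hδ2 hε.le]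
  have h6 := mul_le_mul_of_nonneg_right h5 hX
  have h7 := mul_le_mul_of_nonneg_left h2 (show 0 ≤ 4/3+ε by positivity)
  linarith

/-- Assuming RH, at least two thirds of the zeros of `ζ` are simple:
`N_s(T) ≥ (2/3 - o(1)) N(T)` as `T → ∞`. -/
theorem two_thirds_simple_zeros (hRH : RiemannHypothesis) :
    ∀ ε : ℝ, 0 < ε → ∃ T₀ : ℝ, ∀ T : ℝ, T₀ ≤ T →
      (2 / 3 - ε) * NofT T ≤ NsofT T := by
  exact final_dev hRH
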